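/- arXiv:1801.05195 — 3 statements merged into one kernel-verified Lean document; each statement's English description precedes it below -/
import Mathlib

section
/- Transference for general order-hereditary properties: Let k ≥ 2, let i ∈ [k] be fixed, and let P be an order-hereditary, i-monotone property of k-colourings of complete graphs with P_n ≠ ∅ for every n. Let p = p(n) ∈ (0,1] satisfy log(1/p(n)) = o(log n). Then for every fixed ε > 0, with probability tending to 1 as n → ∞, p·(ex(n,P) − ε·n²) ≤ ex(T_{n,p}(i), P) ≤ p·(ex(n,P) + 4ε·n²). -/
open Filter

abbrev Edge (n : ℕ) := {p : Fin n × Fin n // p.1 < p.2}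

abbrev Colouring (k n : ℕ) := Edge n → Fin k

abbrev Template (k n : ℕ) := Edge n → Finset (Fin k)

def Proper {k n : ℕ} (t : Template k n) : Prop := ∀ e, (t e).Nonempty

def Realises {k n : ℕ} (c : Colouring k n) (t : Template k n) : Prop := ∀ e, c e ∈ t e

noncomputable def Ent {k n : ℕ} (t : Template k n) : ℝ :=
  ∑ e : Edge n, Real.logb k ((t e).card)

def Edge.map {m n : ℕ} (φ : Fin m → Fin n) (h : StrictMono φ) (e : Edge m) : Edge n :=
  ⟨(φ e.1.1, φ e.1.2), h e.2⟩

def restrictC {k m n : ℕ} (c : Colouring k n) (φ : Fin m → Fin n) (h : StrictMono φ) :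
    Colouring k m := fun e => c (Edge.map φ h e)

def restrictT {k m n : ℕ} (t : Template k n) (φ : Fin m → Fin n) (h : StrictMono φ) :
    Template k m := fun e => t (Edge.map φ h e)

def Forb {k N : ℕ} (F : Set (Colouring k N)) (n : ℕ) : Set (Colouring k n) :=
  {c | ∀ (φ : Fin N → Fin n) (h : StrictMono φ), restrictC c φ h ∉ F}

def OrderHereditary {k : ℕ} (P : ∀ n, Set (Colouring k n)) : Prop :=
  ∀ (m n : ℕ) (φ : Fin m → Fin n) (h : StrictMono φ) (c : Colouring k n),
    c ∈ P n → restrictC c φ h ∈ P m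

noncomputable def exEnt {k n : ℕ} (A : Set (Colouring k n)) : ℝ :=
  sSup {x | ∃ t : Template k n, Proper t ∧ (∀ c, Realises c t → c ∈ A) ∧ Ent t = x}

noncomputable def badPairs {k N n : ℕ} (t : Template k n) (F : Set (Colouring k N)) : ℕ :=
  Set.ncard {p : (Fin N → Fin n) × Colouring k N |
    ∃ h : StrictMono p.1, p.2 ∈ F ∧ Realises p.2 (restrictT t p.1 h)}

def TemplateLE {k m n : ℕ} (t : Template k m) (t' : Template k n) : Prop :=
  ∃ (φ : Fin m → Fin n) (h : StrictMono φ), ∀ e, t e ⊆ restrictT t' φ h e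

def IsContainerFamily {k n : ℕ} (T : Finset (Template k n)) (A : Set (Colouring k n)) : Prop :=
  ∀ t : Template k n, Proper t → (∀ c, Realises c t → c ∈ A) → ∃ t' ∈ T, TemplateLE t t'

/-- The probability weight of a template under the `p`-random template `T_{n,p}(i)`:
each edge independently receives the full palette `[k]` with probability `p` and the
singleton palette `{i}` with probability `1 - p`. -/
noncomputable def templateWeight {k n : ℕ} (p : ℝ) (i : Fin k) (t : Template k n) : ℝ :=
  ∏ e : Edge n,
    (if t e = (Finset.univ : Finset (Fin k)) then p else if t e = {i} then 1 - p else 0)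

/-- The probability that the `p`-random template `T_{n,p}(i)` lies in the set `A`. -/
noncomputable def templateProb {k n : ℕ} (p : ℝ) (i : Fin k) (A : Set (Template k n)) : ℝ :=
  ∑ t : Template k n, Set.indicator A (templateWeight p i) t

/-- `P` is monotone with respect to colour `i`. -/
def IMonotone {k : ℕ} (i : Fin k) (P : ∀ n, Set (Colouring k n)) : Prop :=
  ∀ (n : ℕ) (c : Colouring k n) (e : Edge n), c ∈ P n → Function.update c e i ∈ P n

/-- The extremal entropy of `A` relative to the template `t`. -/
noncomputable def exEntRel {k n : ℕ} (t : Template k n) (A : Set (Colouring k n)) : ℝ :=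
  sSup {x | ∃ t' : Template k n, Proper t' ∧ (∀ e, t' e ⊆ t e) ∧
    (∀ c, Realises c t' → c ∈ A) ∧ Ent t' = x}

namespace Transf

noncomputable def xi {k n : ℕ} (t : Template k n) (e : Edge n) : ℝ :=
  if t e = (Finset.univ : Finset (Fin k)) then 1 else 0

noncomputable def EX {k n : ℕ} (p : ℝ) (i : Fin k) (f : Template k n → ℝ) : ℝ :=
  ∑ t : Template k n, templateWeight p i t * f t

lemma xi_nonneg {k n : ℕ} (t : Template k n) (e : Edge n) : 0 ≤ xi t e := by
  unfold xi; split_ifs <;> norm_num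

lemma xi_le_one {k n : ℕ} (t : Template k n) (e : Edge n) : xi t e ≤ 1 := by
  unfold xi; split_ifs <;> norm_num

lemma weight_nonneg {k n : ℕ} {p : ℝ} (hp : p ∈ Set.Ioc (0 : ℝ) 1) (i : Fin k)
    (t : Template k n) : 0 ≤ templateWeight p i t := by
  unfold templateWeight
  refine Finset.prod_nonneg fun e _ => ?_
  have := hp.1
  have := hp.2
  split_ifs <;> linarith

lemma single_ne_univ {k : ℕ} (hk : 2 ≤ k) (i : Fin k) :
    ({i} : Finset (Fin k)) ≠ Finset.univ := by
  intro h
  have := congrArg Finset.card h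
  simp at this
  omega

lemma EX_prod {k n : ℕ} (hk : 2 ≤ k) (p : ℝ) (i : Fin k) (B : Finset (Edge n)) :
    EX p i (fun t : Template k n => ∏ e ∈ B, xi t e) = p ^ B.card := by
  classical
  unfold EX templateWeight
  have h1 : ∀ t : Template k n, (∏ e : Edge n,
      (if t e = (Finset.univ : Finset (Fin k)) then p else if t e = {i} then 1 - p else 0)) *
      ∏ e ∈ B, xi t e = ∏ e : Edge n,
      (fun (e : Edge n) (s : Finset (Fin k)) =>
        (if s = Finset.univ then p else if s = {i} then 1 - p else 0) *
        (if e ∈ B then (if s = Finset.univ then (1:ℝ) else 0) else 1)) e (t e) := by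
    intro t
    rw [Finset.prod_mul_distrib]
    congr 1
    rw [Finset.prod_ite_mem]
    simp [xi]
  rw [Finset.sum_congr rfl (fun t _ => h1 t)]
  have h2 := Finset.prod_univ_sum (fun _ : Edge n => (Finset.univ : Finset (Finset (Fin k))))
    (fun (e : Edge n) (s : Finset (Fin k)) =>
        (if s = Finset.univ then p else if s = {i} then 1 - p else 0) *
        (if e ∈ B then (if s = Finset.univ then (1:ℝ) else 0) else 1))
  rw [Fintype.piFinset_univ] at h2
  rw [← h2]
  have h3 : ∀ e : Edge n, (∑ s : Finset (Fin k),
      (if s = Finset.univ then p else if s = {i} then 1 - p else 0) *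
        (if e ∈ B then (if s = Finset.univ then (1:ℝ) else 0) else 1)) =
        if e ∈ B then p else 1 := by
    intro e
    have hne := single_ne_univ hk i
    by_cases he : e ∈ B
    · simp [he]
    · simp only [he, if_false, mul_one]
      have : ∀ s : Finset (Fin k), (if s = Finset.univ then p else if s = {i} then 1 - p else 0)
        = (if s = Finset.univ then p else 0) + (if s = {i} then 1 - p else 0) := by
        intro s
        by_cases h : s = Finset.univ
        · subst h; simp [hne.symm]
        · simp [h]
      rw [Finset.sum_congr rfl (fun s _ => this s), Finset.sum_add_distrib]
      simp
  rw [Finset.prod_congr rfl (fun e _ => h3 e), Finset.prod_ite_mem]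
  simp

lemma EX_add {k n : ℕ} (p : ℝ) (i : Fin k) (f g : Template k n → ℝ) :
    EX p i (fun t => f t + g t) = EX p i f + EX p i g := by
  simp [EX, mul_add, Finset.sum_add_distrib]

lemma EX_mul {k n : ℕ} (p : ℝ) (i : Fin k) (c : ℝ) (f : Template k n → ℝ) :
    EX p i (fun t => c * f t) = c * EX p i f := by
  simp only [EX, Finset.mul_sum]
  exact Finset.sum_congr rfl fun t _ => by ring

lemma EX_sum {k n : ℕ} {ι : Type*} (p : ℝ) (i : Fin k) (s : Finset ι)
    (f : ι → Template k n → ℝ) :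
    EX p i (fun t => ∑ j ∈ s, f j t) = ∑ j ∈ s, EX p i (f j) := by
  simp only [EX, Finset.mul_sum]
  exact Finset.sum_comm

lemma EX_one {k n : ℕ} (hk : 2 ≤ k) (p : ℝ) (i : Fin k) :
    EX p i (fun _ : Template k n => 1) = 1 := by
  simpa using EX_prod (n := n) hk p i ∅

lemma cov {k n : ℕ} (hk : 2 ≤ k) (p : ℝ) (i : Fin k) (B C : Finset (Edge n)) :
    EX p i (fun t : Template k n => (∏ e ∈ B, xi t e - p ^ B.card) *
      (∏ e ∈ C, xi t e - p ^ C.card)) = p ^ (B ∪ C).card - p ^ B.card * p ^ C.card := by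
  classical
  have h : ∀ t : Template k n, (∏ e ∈ B, xi t e - p ^ B.card) * (∏ e ∈ C, xi t e - p ^ C.card)
      = ∏ e ∈ B ∪ C, xi t e + ((-p ^ C.card) * ∏ e ∈ B, xi t e +
        ((-p ^ B.card) * ∏ e ∈ C, xi t e + (p ^ B.card * p ^ C.card) * 1)) := by
    intro t
    have : ∏ e ∈ B ∪ C, xi t e = (∏ e ∈ B, xi t e) * ∏ e ∈ C, xi t e := by
      have h0 : ∀ D : Finset (Edge n), ∏ e ∈ D, xi t e =
          if ∀ e ∈ D, t e = Finset.univ then 1 else 0 := by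
        intro D
        unfold xi
        rw [Finset.prod_ite_zero]
        simp
      rw [h0, h0, h0]
      have : (∀ e ∈ B ∪ C, t e = Finset.univ) ↔
        (∀ e ∈ B, t e = Finset.univ) ∧ (∀ e ∈ C, t e = Finset.univ) := by
        simp only [Finset.mem_union]
        constructor
        · intro h; exact ⟨fun e he => h e (Or.inl he), fun e he => h e (Or.inr he)⟩
        · rintro ⟨h1, h2⟩ e (he | he)
          · exact h1 e he
          · exact h2 e he
      rw [if_congr this rfl rfl, ite_and]
      split_ifs <;> simp
    rw [this]; ring
  rw [show (fun t : Template k n => (∏ e ∈ B, xi t e - p ^ B.card) *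
    (∏ e ∈ C, xi t e - p ^ C.card)) = _ from funext h]
  rw [EX_add, EX_add, EX_add, EX_mul, EX_mul, EX_mul, EX_prod hk, EX_prod hk, EX_prod hk,
    EX_one hk]
  ring

open Classical in
lemma var_le {k n : ℕ} (hk : 2 ≤ k) {p : ℝ} (hp : p ∈ Set.Ioc (0 : ℝ) 1) (i : Fin k)
    {ι : Type*} (s : Finset ι) (a : ι → ℝ) (ha : ∀ j ∈ s, a j ∈ Set.Icc (0 : ℝ) 1)
    (B : ι → Finset (Edge n)) :
    EX p i (fun t : Template k n => (∑ j ∈ s, a j * (∏ e ∈ B j, xi t e - p ^ (B j).card)) ^ 2) ≤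
      ∑ j ∈ s, ((s.filter (fun j' => ¬ Disjoint (B j) (B j'))).card : ℝ) := by
  have h : ∀ t : Template k n,
      (∑ j ∈ s, a j * (∏ e ∈ B j, xi t e - p ^ (B j).card)) ^ 2 =
      ∑ j ∈ s, ∑ j' ∈ s, (a j * a j') * ((∏ e ∈ B j, xi t e - p ^ (B j).card) *
      (∏ e ∈ B j', xi t e - p ^ (B j').card)) := by
    intro t
    rw [sq, Finset.sum_mul_sum]
    exact Finset.sum_congr rfl fun _ _ => Finset.sum_congr rfl fun _ _ => by ring
  rw [show (fun t : Template k n =>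
    (∑ j ∈ s, a j * (∏ e ∈ B j, xi t e - p ^ (B j).card)) ^ 2) = _ from funext h]
  rw [EX_sum]
  refine Finset.sum_le_sum fun j hj => ?_
  rw [EX_sum, Finset.card_filter, Nat.cast_sum]
  refine Finset.sum_le_sum fun j' hj' => ?_
  rw [EX_mul, cov hk]
  have h1 := ha j hj
  have h2 := ha j' hj'
  by_cases hd : ¬ Disjoint (B j) (B j')
  · rw [if_pos hd, Nat.cast_one]
    have hq : p ^ (B j ∪ B j').card ≤ 1 := pow_le_one₀ hp.1.le hp.2
    have hq' : 0 ≤ p ^ (B j).card * p ^ (B j').card :=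
      mul_nonneg (pow_nonneg hp.1.le _) (pow_nonneg hp.1.le _)
    have h3 : a j * a j' ≤ 1 := mul_le_one₀ h1.2 h2.1 h2.2
    have h4 : 0 ≤ a j * a j' := mul_nonneg h1.1 h2.1
    have h5 : (a j * a j') * (p ^ (B j ∪ B j').card - p ^ (B j).card * p ^ (B j').card)
      ≤ (a j * a j') * 1 := mul_le_mul_of_nonneg_left (by linarith) h4
    linarith
  · rw [if_neg hd, Nat.cast_zero]
    rw [not_not] at hd
    rw [Finset.card_union_of_disjoint hd, pow_add]
    simp

lemma prob_ge {k n : ℕ} (hk : 2 ≤ k) {p : ℝ} (hp : p ∈ Set.Ioc (0 : ℝ) 1) (i : Fin k)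
    (A : Set (Template k n)) (Z : Template k n → ℝ) (hZ : ∀ t, 0 ≤ Z t)
    (h : ∀ t : Template k n, (∀ e, t e = Finset.univ ∨ t e = {i}) → Z t < 1 → t ∈ A) :
    1 - EX p i Z ≤ templateProb p i A := by
  classical
  rw [← EX_one (n := n) hk p i]
  unfold EX templateProb
  rw [← Finset.sum_sub_distrib]
  refine Finset.sum_le_sum fun t _ => ?_
  have hw := weight_nonneg hp i t
  by_cases hs : ∀ e, t e = Finset.univ ∨ t e = {i}
  · by_cases hA : t ∈ A
    · rw [Set.indicator_of_mem hA]
      nlinarith [mul_nonneg hw (hZ t)]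
    · rw [Set.indicator_of_notMem hA]
      have : 1 ≤ Z t := by
        by_contra hc
        exact hA (h t hs (not_le.1 hc))
      nlinarith
  · push Not at hs
    obtain ⟨e, h1, h2⟩ := hs
    have h0 : templateWeight p i t = 0 := by
      unfold templateWeight
      exact Finset.prod_eq_zero (Finset.mem_univ e) (by simp [h1, h2])
    rw [Set.indicator_apply, h0]
    simp

lemma prob_le {k n : ℕ} (hk : 2 ≤ k) {p : ℝ} (hp : p ∈ Set.Ioc (0 : ℝ) 1) (i : Fin k)
    (A : Set (Template k n)) : templateProb p i A ≤ 1 := by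
  rw [← EX_one (n := n) hk p i]
  unfold EX templateProb
  refine Finset.sum_le_sum fun t _ => ?_
  rw [mul_one]
  exact Set.indicator_le_self' (fun _ _ => weight_nonneg hp i t) t

end Transf

namespace Transf

open Classical in
noncomputable def ES {n : ℕ} (S : Finset (Fin n)) : Finset (Edge n) :=
  Finset.univ.filter (fun e => e.1.1 ∈ S ∧ e.1.2 ∈ S)

lemma mem_ES {n : ℕ} (S : Finset (Fin n)) (e : Edge n) :
    e ∈ ES S ↔ e.1.1 ∈ S ∧ e.1.2 ∈ S := by simp [ES]

lemma sum_ES {n N : ℕ} (S : Finset (Fin n)) (hS : S.card = N) (g : Edge n → ℝ) :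
    ∑ e : Edge N, g (Edge.map (S.orderEmbOfFin hS) (S.orderEmbOfFin hS).strictMono e) =
      ∑ e ∈ ES S, g e := by
  refine Finset.sum_bij (fun e _ => Edge.map (S.orderEmbOfFin hS)
    (S.orderEmbOfFin hS).strictMono e) ?_ ?_ ?_ ?_
  · intro e _
    rw [mem_ES]
    exact ⟨S.orderEmbOfFin_mem hS _, S.orderEmbOfFin_mem hS _⟩
  · intro a _ b _ hab
    have h1 := congrArg Subtype.val hab
    simp only [Edge.map, Prod.mk.injEq] at h1
    exact Subtype.ext (Prod.ext ((S.orderEmbOfFin hS).injective h1.1)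
      ((S.orderEmbOfFin hS).injective h1.2))
  · intro b hb
    rw [mem_ES] at hb
    have hr : ∀ v ∈ S, ∃ j, S.orderEmbOfFin hS j = v := by
      intro v hv
      have := S.range_orderEmbOfFin hS
      have hv' : v ∈ (S : Set (Fin n)) := hv
      rw [← this] at hv'
      exact hv'
    obtain ⟨j1, h1⟩ := hr _ hb.1
    obtain ⟨j2, h2⟩ := hr _ hb.2
    refine ⟨⟨(j1, j2), ?_⟩, Finset.mem_univ _, ?_⟩
    · have := b.2
      rw [← h1, ← h2] at this
      exact (S.orderEmbOfFin hS).lt_iff_lt.1 this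
    · exact Subtype.ext (Prod.ext h1 h2)
  · intro _ _; rfl

lemma card_ES {n N : ℕ} (S : Finset (Fin n)) (hS : S.card = N) :
    (ES S).card = Fintype.card (Edge N) := by
  have := sum_ES S hS (fun _ => 1)
  simp only [Finset.sum_const, nsmul_eq_mul, mul_one, Finset.card_univ] at this
  exact_mod_cast this.symm

lemma card_sup {n N : ℕ} (U : Finset (Fin n)) (hU : U.card ≤ N) :
    ((Finset.powersetCard N Finset.univ).filter (fun S => U ⊆ S)).card =
      (n - U.card).choose (N - U.card) := by
  have : (Finset.powersetCard (N - U.card) Uᶜ).card = (n - U.card).choose (N - U.card) := by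
    rw [Finset.card_powersetCard, Finset.card_compl, Fintype.card_fin]
  rw [← this]
  refine Finset.card_bij (fun S _ => S \ U) ?_ ?_ ?_
  · intro S hS
    simp only [Finset.mem_filter, Finset.mem_powersetCard] at hS ⊢
    refine ⟨?_, ?_⟩
    · intro v hv
      simp only [Finset.mem_sdiff, Finset.mem_compl] at hv ⊢
      exact hv.2
    · rw [Finset.card_sdiff_of_subset hS.2, hS.1.2]
  · intro S hS S' hS' h
    simp only [Finset.mem_filter] at hS hS'
    rw [← Finset.sdiff_union_of_subset hS.2, h, Finset.sdiff_union_of_subset hS'.2]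
  · intro R hR
    rw [Finset.mem_powersetCard] at hR
    have hd : Disjoint R U := by
      rw [Finset.disjoint_left]
      intro v hv hv'
      have := hR.1 hv
      simp [hv'] at this
    refine ⟨R ∪ U, ?_, ?_⟩
    · simp only [Finset.mem_filter, Finset.mem_powersetCard]
      refine ⟨⟨Finset.subset_univ _, ?_⟩, Finset.subset_union_right⟩
      rw [Finset.card_union_of_disjoint hd, hR.2]
      omega
    · exact Finset.union_sdiff_cancel_right hd

open Classical in
noncomputable def Fam {n : ℕ} (N : ℕ) (e : Edge n) : Finset (Finset (Fin n)) :=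
  (Finset.powersetCard N Finset.univ).filter (fun S => e ∈ ES S)

lemma card_Fam {n N : ℕ} (hN : 3 ≤ N) (e : Edge n) :
    (Fam N e).card = (n - 2).choose (N - 2) := by
  classical
  have hc : ({e.1.1, e.1.2} : Finset (Fin n)).card = 2 := Finset.card_pair e.2.ne
  have := card_sup (N := N) ({e.1.1, e.1.2} : Finset (Fin n)) (by omega)
  rw [hc] at this
  rw [← this]
  unfold Fam
  congr 1
  ext S
  simp [mem_ES, Finset.insert_subset_iff]

lemma card_Fam_three {n N : ℕ} (hN : 3 ≤ N) (e : Edge n) (v : Fin n) (h1 : v ≠ e.1.1)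
    (h2 : v ≠ e.1.2) :
    ((Fam N e).filter (fun S => v ∈ S)).card = (n - 3).choose (N - 3) := by
  classical
  have hc : ({v, e.1.1, e.1.2} : Finset (Fin n)).card = 3 := by
    rw [Finset.card_eq_three]
    exact ⟨v, e.1.1, e.1.2, h1, h2, e.2.ne, rfl⟩
  have := card_sup (N := N) ({v, e.1.1, e.1.2} : Finset (Fin n)) (by omega)
  rw [hc] at this
  rw [← this]
  unfold Fam
  congr 1
  ext S
  simp only [mem_ES, Finset.insert_subset_iff, Finset.mem_filter, Finset.singleton_subset_iff]
  tauto

open Classical in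
lemma count_bad {n N : ℕ} (hN : 3 ≤ N) (e : Edge n) (S : Finset (Fin n)) (hS : S ∈ Fam N e) :
    ((Fam N e).filter (fun S' => ¬ Disjoint ((ES S).erase e) ((ES S').erase e))).card ≤
      N * (n - 3).choose (N - 3) := by
  have hcard : S.card = N := by
    have := hS
    unfold Fam at this
    simp only [Finset.mem_filter, Finset.mem_powersetCard] at this
    exact this.1.2
  have hsub : (Fam N e).filter (fun S' => ¬ Disjoint ((ES S).erase e) ((ES S').erase e)) ⊆
      ((S.erase e.1.1).erase e.1.2).biUnion (fun v => (Fam N e).filter (fun S' => v ∈ S')) := by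
    intro S' hS'
    rw [Finset.mem_filter] at hS'
    obtain ⟨hF, hd⟩ := hS'
    rw [Finset.not_disjoint_iff] at hd
    obtain ⟨f, hf1, hf2⟩ := hd
    rw [Finset.mem_erase, mem_ES] at hf1 hf2
    simp only [Finset.mem_biUnion, Finset.mem_filter, Finset.mem_erase]
    by_cases ha : f.1.1 ≠ e.1.1 ∧ f.1.1 ≠ e.1.2
    · exact ⟨f.1.1, ⟨ha.2, ha.1, hf1.2.1⟩, hF, hf2.2.1⟩
    · by_cases hb : f.1.2 ≠ e.1.1 ∧ f.1.2 ≠ e.1.2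
      · exact ⟨f.1.2, ⟨hb.2, hb.1, hf1.2.2⟩, hF, hf2.2.2⟩
      · exfalso
        apply hf1.1
        have h1 := f.2
        have h2 := e.2
        apply Subtype.ext
        apply Prod.ext <;> omega
  refine (Finset.card_le_card hsub).trans ?_
  refine (Finset.card_biUnion_le_card_mul _ _ ((n - 3).choose (N - 3)) ?_).trans ?_
  · intro v hv
    simp only [Finset.mem_erase] at hv
    exact (card_Fam_three hN e v hv.2.1 hv.1).le
  · refine Nat.mul_le_mul_right _ ?_
    rw [← hcard]
    exact Finset.card_le_card ((Finset.erase_subset _ _).trans (Finset.erase_subset _ _))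

lemma choose_id {n N : ℕ} (hN : 3 ≤ N) (hn : N ≤ n) :
    (n - 2) * (n - 3).choose (N - 3) = (N - 2) * (n - 2).choose (N - 2) := by
  obtain ⟨a, rfl⟩ : ∃ a, N = a + 3 := ⟨N - 3, by omega⟩
  obtain ⟨b, rfl⟩ : ∃ b, n = b + 3 := ⟨n - 3, by omega⟩
  have := Nat.add_one_mul_choose_eq b a
  simp only [Nat.add_sub_cancel, show b + 3 - 2 = b + 1 by omega, show a + 3 - 2 = a + 1 by omega]
  rw [this]; ring

/-- number of full `N`-cliques through `e`, not requiring `e` itself to be full -/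
noncomputable def XX {k n : ℕ} (N : ℕ) (t : Template k n) (e : Edge n) : ℝ :=
  open Classical in ∑ S ∈ Fam N e, ∏ f ∈ (ES S).erase e, xi t f

noncomputable def MM (n N : ℕ) : ℝ := ((n - 2).choose (N - 2) : ℝ)

lemma var_XX {k n N : ℕ} (hk : 2 ≤ k) {p : ℝ} (hp : p ∈ Set.Ioc (0 : ℝ) 1) (i : Fin k)
    (hN : 3 ≤ N) (hn : N ≤ n) (e : Edge n) :
    ((n : ℝ) - 2) * EX p i (fun t : Template k n =>
      (XX N t e - MM n N * p ^ (Fintype.card (Edge N) - 1)) ^ 2) ≤ (N * MM n N) ^ 2 := by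
  classical
  have hc : ∀ S ∈ Fam N e, ((ES S).erase e).card = Fintype.card (Edge N) - 1 := by
    intro S hS
    unfold Fam at hS
    simp only [Finset.mem_filter, Finset.mem_powersetCard] at hS
    rw [Finset.card_erase_of_mem hS.2, card_ES S hS.1.2]
  have h := var_le hk hp i (Fam N e) (fun _ => 1) (by simp) (fun S => (ES S).erase e)
  have h2 : (fun t : Template k n => (∑ j ∈ Fam N e, (1:ℝ) * (∏ e ∈ (ES j).erase e, xi t e -
      p ^ ((ES j).erase e).card)) ^ 2) = (fun t : Template k n =>
      (XX N t e - MM n N * p ^ (Fintype.card (Edge N) - 1)) ^ 2) := by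
    funext t
    congr 1
    simp only [one_mul]
    have h5 : ∑ S ∈ Fam N e, p ^ ((ES S).erase e).card =
        MM n N * p ^ (Fintype.card (Edge N) - 1) := by
      rw [Finset.sum_congr rfl (fun S hS => by rw [hc S hS]),
        Finset.sum_const, card_Fam hN, nsmul_eq_mul]
      rfl
    rw [Finset.sum_sub_distrib, h5]
    unfold XX
    congr
  rw [h2] at h
  have h3 : ∑ S ∈ Fam N e, (((Fam N e).filter (fun S' => ¬ Disjoint ((ES S).erase e)
      ((ES S').erase e))).card : ℝ) ≤ MM n N * (N * ((n - 3).choose (N - 3) : ℝ)) := by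
    have : MM n N = ((Fam N e).card : ℝ) := by rw [card_Fam hN]; rfl
    rw [this, ← nsmul_eq_mul]
    refine Finset.sum_le_card_nsmul _ _ _ fun S hS => ?_
    exact_mod_cast count_bad hN e S hS
  have hid : ((n : ℝ) - 2) * ((n - 3).choose (N - 3) : ℝ) = ((N : ℝ) - 2) * MM n N := by
    have := choose_id hN hn
    have h' : (((n - 2 : ℕ) : ℝ)) * ((n - 3).choose (N - 3) : ℝ) =
      ((N - 2 : ℕ) : ℝ) * ((n - 2).choose (N - 2) : ℝ) := by exact_mod_cast this
    rw [Nat.cast_sub (by omega), Nat.cast_sub (by omega)] at h'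
    simpa [MM] using h'
  have hn2 : (0 : ℝ) ≤ (n : ℝ) - 2 := by
    have : (3 : ℝ) ≤ n := by exact_mod_cast (hN.trans hn)
    linarith
  have hM : 0 ≤ MM n N := by unfold MM; positivity
  calc _ ≤ ((n : ℝ) - 2) * (MM n N * (N * ((n - 3).choose (N - 3) : ℝ))) :=
        mul_le_mul_of_nonneg_left (h.trans h3) hn2
    _ = MM n N * N * (((n : ℝ) - 2) * ((n - 3).choose (N - 3) : ℝ)) := by ring
    _ = MM n N * N * (((N : ℝ) - 2) * MM n N) := by rw [hid]
    _ ≤ (N * MM n N) ^ 2 := by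
        have : (0:ℝ) ≤ N * MM n N ^ 2 := by positivity
        nlinarith

lemma var_lin {k n : ℕ} (hk : 2 ≤ k) {p : ℝ} (hp : p ∈ Set.Ioc (0 : ℝ) 1) (i : Fin k)
    (a : Edge n → ℝ) (ha : ∀ e, a e ∈ Set.Icc (0 : ℝ) 1) :
    EX p i (fun t : Template k n => (∑ e, a e * (xi t e - p)) ^ 2) ≤ Fintype.card (Edge n) := by
  classical
  have h := var_le hk hp i Finset.univ a (fun e _ => ha e) (fun e : Edge n => {e})
  simp only [Finset.prod_singleton, Finset.card_singleton, pow_one] at h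
  refine h.trans (le_of_eq ?_)
  have : ∀ j : Edge n, (Finset.univ.filter (fun j' : Edge n =>
    ¬ Disjoint ({j} : Finset (Edge n)) {j'})).card = 1 := by
    intro j
    rw [Finset.card_eq_one]
    refine ⟨j, ?_⟩
    ext x
    simp [eq_comm]
  rw [Finset.sum_congr rfl (fun j _ => by rw [this j])]
  simp

lemma card_Edge_le (n : ℕ) : (Fintype.card (Edge n) : ℝ) ≤ (n : ℝ) ^ 2 := by
  have : Fintype.card (Edge n) ≤ Fintype.card (Fin n × Fin n) := Fintype.card_subtype_le _
  simp only [Fintype.card_prod, Fintype.card_fin] at this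
  rw [sq]
  exact_mod_cast this

end Transf

namespace Transf

lemma logb_mem {k : ℕ} (hk : 2 ≤ k) (s : Finset (Fin k)) (hs : s.Nonempty) :
    Real.logb k s.card ∈ Set.Icc (0 : ℝ) 1 := by
  have hk' : (1 : ℝ) < k := by exact_mod_cast (by omega : 1 < k)
  have h1 : (1 : ℝ) ≤ s.card := by exact_mod_cast hs.card_pos
  have h2 : (s.card : ℝ) ≤ k := by
    have := s.card_le_univ
    rw [Fintype.card_fin] at this
    exact_mod_cast this
  refine ⟨Real.logb_nonneg hk' h1, ?_⟩
  rw [Real.logb_le_iff_le_rpow hk' (by linarith), Real.rpow_one]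
  exact h2

lemma ex_finite {k n : ℕ} (q : Template k n → Prop) :
    {x | ∃ t : Template k n, q t ∧ Ent t = x}.Finite := by
  have : {x | ∃ t : Template k n, q t ∧ Ent t = x} = Ent '' {t | q t} := by
    ext x; simp
  rw [this]
  exact (Set.toFinite _).image _

lemma exEnt_eq {k n : ℕ} (A : Set (Colouring k n)) : exEnt A =
    sSup {x | ∃ t : Template k n, (Proper t ∧ (∀ c, Realises c t → c ∈ A)) ∧ Ent t = x} := by
  simp only [exEnt, and_assoc]

lemma exEntRel_eq {k n : ℕ} (T : Template k n) (A : Set (Colouring k n)) : exEntRel T A =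
    sSup {x | ∃ t : Template k n, (Proper t ∧ (∀ e, t e ⊆ T e) ∧
      (∀ c, Realises c t → c ∈ A)) ∧ Ent t = x} := by
  simp only [exEntRel, and_assoc]

lemma le_exEnt {k n : ℕ} (A : Set (Colouring k n)) (t : Template k n) (h1 : Proper t)
    (h2 : ∀ c, Realises c t → c ∈ A) : Ent t ≤ exEnt A := by
  rw [exEnt_eq]
  exact le_csSup (ex_finite _).bddAbove ⟨t, ⟨h1, h2⟩, rfl⟩

lemma le_exEntRel {k n : ℕ} (T : Template k n) (A : Set (Colouring k n)) (t : Template k n)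
    (h1 : Proper t) (h0 : ∀ e, t e ⊆ T e)
    (h2 : ∀ c, Realises c t → c ∈ A) : Ent t ≤ exEntRel T A := by
  rw [exEntRel_eq]
  exact le_csSup (ex_finite _).bddAbove ⟨t, ⟨h1, h0, h2⟩, rfl⟩

lemma exEnt_attained {k n : ℕ} (A : Set (Colouring k n)) (hA : A.Nonempty) :
    ∃ t : Template k n, Proper t ∧ (∀ c, Realises c t → c ∈ A) ∧ Ent t = exEnt A := by
  obtain ⟨c, hc⟩ := hA
  have hne : {x | ∃ t : Template k n, (Proper t ∧ (∀ c, Realises c t → c ∈ A)) ∧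
      Ent t = x}.Nonempty := by
    refine ⟨_, fun e => {c e}, ⟨fun e => Finset.singleton_nonempty _, ?_⟩, rfl⟩
    intro c' hc'
    have : c' = c := funext fun e => Finset.mem_singleton.1 (hc' e)
    rwa [this]
  obtain ⟨t, ⟨h1, h2⟩, h3⟩ := hne.csSup_mem (ex_finite _)
  exact ⟨t, h1, h2, by rw [h3, exEnt_eq]⟩

lemma Ent_nonneg {k n : ℕ} (hk : 2 ≤ k) (t : Template k n) (ht : Proper t) : 0 ≤ Ent t :=
  Finset.sum_nonneg fun e _ => (logb_mem hk _ (ht e)).1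

lemma Ent_le {k n : ℕ} (hk : 2 ≤ k) (t : Template k n) (ht : Proper t) :
    Ent t ≤ Fintype.card (Edge n) := by
  unfold Ent
  refine (Finset.sum_le_sum fun e _ => (logb_mem hk _ (ht e)).2).trans ?_
  simp

lemma mono_set {k n : ℕ} (i : Fin k) (P : ∀ n, Set (Colouring k n)) (hmono : IMonotone i P)
    (c : Colouring k n) (hc : c ∈ P n) (B : Finset (Edge n)) [DecidableEq (Edge n)] :
    (fun e => if e ∈ B then i else c e) ∈ P n := by
  induction B using Finset.induction_on with
  | empty => simpa using hc
  | insert a B ha ih =>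
    have := hmono n _ a ih
    convert this using 1
    funext e
    by_cases h : e = a
    · subst h; simp
    · simp [h]

lemma lower {k n : ℕ} (i : Fin k) (P : ∀ n, Set (Colouring k n)) (hmono : IMonotone i P)
    (t : Template k n) (ht : Proper t) (hP : ∀ c, Realises c t → c ∈ P n)
    (T : Template k n) (hT : ∀ e, T e = Finset.univ ∨ T e = {i}) :
    ∑ e, Real.logb k (t e).card * xi T e ≤ exEntRel T (P n) := by
  classical
  set t' : Template k n := fun e => if T e = Finset.univ then t e else {i} with ht'
  have hE : ∑ e, Real.logb k (t e).card * xi T e = Ent t' := by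
    unfold Ent
    refine Finset.sum_congr rfl fun e _ => ?_
    by_cases h : T e = Finset.univ <;> simp [ht', xi, h]
  rw [hE]
  refine le_exEntRel T _ t' ?_ ?_ ?_
  · intro e
    by_cases h : T e = Finset.univ
    · simpa [ht', h] using ht e
    · simp [ht', h]
  · intro e
    by_cases h : T e = Finset.univ
    · rw [h]; exact Finset.subset_univ _
    · rcases hT e with h' | h'
      · exact absurd h' h
      · simp only [ht', if_neg h]; rw [h']
  · intro c hc
    choose d hd using ht
    have h0 : (fun e => if T e = Finset.univ then c e else d e) ∈ P n := by
      apply hP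
      intro e
      have := hc e
      by_cases h : T e = Finset.univ
      · simpa [ht', h] using this
      · simpa [h] using hd e
    have h1 := mono_set i P hmono _ h0 (Finset.univ.filter (fun e => T e ≠ Finset.univ))
    convert h1 using 1
    funext e
    have := hc e
    by_cases h : T e = Finset.univ
    · simp [h]
    · simpa [ht', h] using this

lemma restrict_le {k n N : ℕ} (P : ∀ n, Set (Colouring k n)) (hher : OrderHereditary P)
    (t : Template k n) (ht : Proper t) (hP : ∀ c, Realises c t → c ∈ P n)
    (S : Finset (Fin n)) (hS : S.card = N) :
    ∑ e ∈ ES S, Real.logb k (t e).card ≤ exEnt (P N) := by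
  classical
  rw [← sum_ES S hS]
  set φ := S.orderEmbOfFin hS
  refine le_exEnt (P N) (restrictT t φ φ.strictMono) (fun e => ht _) ?_
  intro c hc
  choose d hd using ht
  have hinj : Function.Injective (Edge.map φ φ.strictMono) := by
    intro a b hab
    have h1 := congrArg Subtype.val hab
    simp only [Edge.map, Prod.mk.injEq] at h1
    exact Subtype.ext (Prod.ext (φ.injective h1.1) (φ.injective h1.2))
  have h1 : Function.extend (Edge.map φ φ.strictMono) c d ∈ P n := by
    apply hP
    intro e
    by_cases h : ∃ a, Edge.map φ φ.strictMono a = e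
    · obtain ⟨a, rfl⟩ := h
      rw [hinj.extend_apply]
      exact hc a
    · rw [Function.extend_apply' _ _ _ h]
      exact hd e
  have h2 := hher N n φ φ.strictMono _ h1
  convert h2 using 1
  funext e
  exact (hinj.extend_apply _ _ _).symm

lemma sum_swap {k n N : ℕ} (T : Template k n) (g : Edge n → ℝ) :
    ∑ S ∈ Finset.powersetCard N Finset.univ, (∏ f ∈ ES S, xi T f) * ∑ e ∈ ES S, g e =
      ∑ e, g e * (xi T e * XX N T e) := by
  classical
  have h1 : ∀ S : Finset (Fin n), (∏ f ∈ ES S, xi T f) * ∑ e ∈ ES S, g e =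
      ∑ e, if e ∈ ES S then g e * (xi T e * ∏ f ∈ (ES S).erase e, xi T f) else 0 := by
    intro S
    rw [Finset.mul_sum, ← Finset.sum_filter]
    refine Finset.sum_congr (by ext; simp) fun e he => ?_
    simp only [Finset.mem_filter, Finset.mem_univ, true_and] at he
    rw [Finset.mul_prod_erase (ES S) (fun f => xi T f) he]
    ring
  rw [Finset.sum_congr rfl (fun S _ => h1 S), Finset.sum_comm]
  refine Finset.sum_congr rfl fun e _ => ?_
  rw [← Finset.sum_filter]
  unfold XX Fam
  rw [Finset.mul_sum, Finset.mul_sum]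

lemma upper {k n N : ℕ} (hk : 2 ≤ k) (i : Fin k) (P : ∀ n, Set (Colouring k n))
    (hher : OrderHereditary P) (ρ : ℝ) (hρ0 : 0 ≤ ρ) (hρ1 : ρ ≤ 1)
    (hρ : exEnt (P N) = ρ * Fintype.card (Edge N))
    (t : Template k n) (ht : Proper t) (hP : ∀ c, Realises c t → c ∈ P n)
    (T : Template k n) (hT : ∀ e, T e = Finset.univ ∨ T e = {i}) (htT : ∀ e, t e ⊆ T e)
    (μ : ℝ) (hμ : 0 < μ) (η : ℝ) (hη : 0 ≤ η)
    (hV : ∑ e, (XX N T e - μ) ^ 2 ≤ (η * μ * n) ^ 2) :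
    Ent t ≤ ρ * ∑ e, xi T e + 2 * η * n ^ 2 := by
  classical
  set w : Edge n → ℝ := fun e => Real.logb k (t e).card with hw
  have hw1 : ∀ e, w e ∈ Set.Icc (0 : ℝ) 1 := fun e => logb_mem hk _ (ht e)
  have hwx : ∀ e, w e * xi T e = w e := by
    intro e
    by_cases h : T e = Finset.univ
    · simp [xi, h]
    · have h' := (hT e).resolve_left h
      have : t e = {i} := by
        have h2 := htT e
        rw [h'] at h2
        exact (Finset.subset_singleton_iff.1 h2).resolve_left (ht e).ne_empty
      simp [hw, this]
  have hXsum : ∑ e, w e * (xi T e * XX N T e) ≤ ∑ e, ρ * (xi T e * XX N T e) := by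
    rw [← sum_swap, ← sum_swap]
    refine Finset.sum_le_sum fun S hS => ?_
    rw [Finset.mem_powersetCard] at hS
    refine mul_le_mul_of_nonneg_left ?_ (Finset.prod_nonneg fun f _ => xi_nonneg T f)
    have := restrict_le P hher t ht hP S hS.2
    rw [hρ] at this
    rw [Finset.sum_const, card_ES S hS.2, nsmul_eq_mul, mul_comm]
    exact this
  set D := ∑ e, |XX N T e - μ| with hD
  have hDle : D ≤ η * μ * n ^ 2 := by
    have h1 : D ^ 2 ≤ (Fintype.card (Edge n)) * ∑ e, (XX N T e - μ) ^ 2 := by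
      have := sq_sum_le_card_mul_sum_sq (s := (Finset.univ : Finset (Edge n)))
        (f := fun e => |XX N T e - μ|)
      simpa [sq_abs] using this
    have h2 : D ^ 2 ≤ (η * μ * n ^ 2) ^ 2 := by
      refine h1.trans ?_
      calc _ ≤ (n : ℝ) ^ 2 * (η * μ * n) ^ 2 :=
            mul_le_mul (card_Edge_le n) hV (Finset.sum_nonneg fun e _ => sq_nonneg _) (by positivity)
        _ = _ := by ring
    exact (abs_le_of_sq_le_sq' h2 (by positivity)).2
  have hkey : μ * Ent t ≤ μ * (ρ * ∑ e, xi T e) + 2 * D := by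
    have hE : μ * Ent t = ∑ e, μ * w e := by rw [← Finset.mul_sum]; rfl
    have h1 : ∑ e, μ * w e ≤ ∑ e, w e * (xi T e * XX N T e) + D := by
      rw [hD, ← Finset.sum_add_distrib]
      refine Finset.sum_le_sum fun e _ => ?_
      rw [← mul_assoc, hwx]
      have h3 := neg_abs_le (XX N T e - μ)
      have h4 := abs_nonneg (XX N T e - μ)
      have h5 := hw1 e
      nlinarith [mul_nonneg h5.1 (by linarith : 0 ≤ XX N T e - μ + |XX N T e - μ|),
        mul_nonneg h4 (by linarith [h5.2] : 0 ≤ 1 - w e)]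
    have h2 : ∑ e, ρ * (xi T e * XX N T e) ≤ μ * (ρ * ∑ e, xi T e) + D := by
      rw [hD, Finset.mul_sum, Finset.mul_sum, ← Finset.sum_add_distrib]
      refine Finset.sum_le_sum fun e _ => ?_
      have h3 := le_abs_self (XX N T e - μ)
      have h4 := abs_nonneg (XX N T e - μ)
      have h5 : 0 ≤ ρ * xi T e := mul_nonneg hρ0 (xi_nonneg T e)
      have h6 : ρ * xi T e ≤ 1 := mul_le_one₀ hρ1 (xi_nonneg T e) (xi_le_one T e)
      nlinarith [mul_nonneg h5 (by linarith : 0 ≤ |XX N T e - μ| - (XX N T e - μ)),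
        mul_nonneg h4 (by linarith : 0 ≤ 1 - ρ * xi T e)]
    rw [hE]
    linarith
  have : μ * Ent t ≤ μ * (ρ * ∑ e, xi T e + 2 * η * n ^ 2) := by nlinarith
  exact le_of_mul_le_mul_left this hμ

lemma asym (p : ℕ → ℝ) (hp : ∀ n, p n ∈ Set.Ioc (0 : ℝ) 1)
    (hpl : Tendsto (fun n => Real.log (1 / p n) / Real.log n) atTop (nhds 0)) (j : ℕ) (hj : 0 < j) :
    Tendsto (fun n : ℕ => 1 / (p n ^ j * n)) atTop (nhds 0) := by
  have hj' : (0 : ℝ) < j := by exact_mod_cast hj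
  have h1 : ∀ᶠ n : ℕ in atTop, Real.log (1 / p n) / Real.log n < 1 / (2 * j) :=
    hpl.eventually_lt_const (by positivity)
  have h3 : Tendsto (fun n : ℕ => (n : ℝ) ^ (-(1 / 2 : ℝ))) atTop (nhds 0) :=
    (tendsto_rpow_neg_atTop (by norm_num)).comp tendsto_natCast_atTop_atTop
  refine squeeze_zero' (Eventually.of_forall fun n => ?_) ?_ h3
  · have := (hp n).1
    positivity
  · filter_upwards [h1, eventually_ge_atTop 2] with n hn hn2
    have hpn := (hp n).1
    have hn1 : (1 : ℝ) < n := by exact_mod_cast (by omega : 1 < n)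
    have hlog : 0 < Real.log n := Real.log_pos hn1
    have hn0 : (0 : ℝ) < n := by linarith
    rw [div_lt_iff₀ hlog] at hn
    rw [← Real.log_le_log_iff (by positivity) (by positivity), Real.log_rpow hn0, one_div,
      Real.log_inv, Real.log_mul (by positivity) (by positivity), Real.log_pow]
    rw [one_div, Real.log_inv] at hn
    have h4 : (j : ℝ) * (-Real.log (p n)) ≤ j * (1 / (2 * j) * Real.log n) :=
      mul_le_mul_of_nonneg_left hn.le hj'.le
    have h5 : (j : ℝ) * (1 / (2 * j) * Real.log n) = 1 / 2 * Real.log n := by field_simp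
    linarith

end Transf

/-- Transference for general order-hereditary properties (Corollary 2.26). -/
theorem transference_general (k : ℕ) (hk : 2 ≤ k) (i : Fin k)
    (P : ∀ n, Set (Colouring k n))
    (hher : OrderHereditary P) (hmono : IMonotone i P) (hne : ∀ n, (P n).Nonempty)
    (p : ℕ → ℝ) (hp : ∀ n, p n ∈ Set.Ioc (0 : ℝ) 1)
    (hpl : Tendsto (fun n => Real.log (1 / p n) / Real.log n) atTop (nhds 0))
    (ε : ℝ) (hε : 0 < ε) :
    Tendsto (fun n => templateProb (p n) i
        {T : Template k n |
          p n * (exEnt (P n) - ε * (n : ℝ) ^ 2) ≤ exEntRel T (P n) ∧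
          exEntRel T (P n) ≤ p n * (exEnt (P n) + 4 * ε * (n : ℝ) ^ 2)})
      atTop (nhds 1) := by
  classical
  -- choice of N
  set r : ℕ → ℝ := fun n => exEnt (P (n + 3)) / Fintype.card (Edge (n + 3)) with hr
  have hcpos : ∀ n, (0 : ℝ) < Fintype.card (Edge (n + 3)) := by
    intro n
    have : 0 < Fintype.card (Edge (n + 3)) :=
      Fintype.card_pos_iff.2 ⟨⟨(0, 1), by simp [Fin.lt_def]⟩⟩
    exact_mod_cast this
  have hex0 : ∀ n, 0 ≤ exEnt (P n) := by
    intro n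
    obtain ⟨t, h1, -, h3⟩ := Transf.exEnt_attained (P n) (hne n)
    rw [← h3]
    exact Transf.Ent_nonneg hk t h1
  have hr0 : ∀ n, 0 ≤ r n := fun n => div_nonneg (hex0 _) (hcpos n).le
  have hbdd : BddBelow (Set.range r) := ⟨0, by rintro _ ⟨n, rfl⟩; exact hr0 n⟩
  obtain ⟨N', hN'⟩ : ∃ N', r N' < iInf r + ε := exists_lt_of_ciInf_lt (by linarith)
  have hrN : ∀ n, r N' ≤ r n + ε := fun n => by
    have := ciInf_le hbdd n
    linarith
  set N := N' + 3 with hN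
  set ρ := r N' with hρdef
  have hρ : exEnt (P N) = ρ * Fintype.card (Edge N) := by
    rw [hρdef]
    simp only [hr]
    rw [div_mul_cancel₀ _ (hcpos N').ne']
  have hρ0 : 0 ≤ ρ := hr0 N'
  have hρ1 : ρ ≤ 1 := by
    rw [hρdef]
    simp only [hr]
    rw [div_le_one (hcpos N')]
    obtain ⟨t, h1, -, h3⟩ := Transf.exEnt_attained (P (N' + 3)) (hne _)
    rw [← h3]
    exact Transf.Ent_le hk t h1
  set K := Fintype.card (Edge N) with hK
  have hKpos : 0 < K := by exact_mod_cast hcpos N'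
  have hasym := Transf.asym p hp hpl (2 * K) (by omega)
  have hlim : Tendsto (fun n : ℕ => 1 - (2 + 2 * (N : ℝ) ^ 2) / ε ^ 2 *
      (1 / (p n ^ (2 * K) * n))) atTop (nhds 1) := by
    have := (hasym.const_mul ((2 + 2 * (N : ℝ) ^ 2) / ε ^ 2)).const_sub 1
    simpa using this
  refine tendsto_of_tendsto_of_tendsto_of_le_of_le' hlim tendsto_const_nhds ?_
    (Eventually.of_forall fun n => Transf.prob_le hk (hp n) i _)
  filter_upwards [eventually_ge_atTop (N + 4)] with n hn
  have hp0 := (hp n).1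
  have hp1 := (hp n).2
  have hn4 : (4 : ℝ) ≤ n := by exact_mod_cast (by omega : 4 ≤ n)
  have hn0 : (0 : ℝ) < n := by linarith
  obtain ⟨t, ht1, ht2, ht3⟩ := Transf.exEnt_attained (P n) (hne n)
  set a : Edge n → ℝ := fun e => Real.logb k (t e).card with ha
  have ha1 : ∀ e, a e ∈ Set.Icc (0 : ℝ) 1 := fun e => Transf.logb_mem hk _ (ht1 e)
  have hasum : ∑ e, a e = exEnt (P n) := ht3
  have hMpos : 0 < Transf.MM n N := by
    unfold Transf.MM
    exact_mod_cast Nat.choose_pos (by omega)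
  set q := p n ^ (K - 1) with hq
  have hqpos : 0 < q := pow_pos hp0 _
  have hpq : p n * q = p n ^ K := by
    rw [hq, ← pow_succ']
    congr 1
    omega
  set μ := Transf.MM n N * q with hμ
  have hμpos : 0 < μ := mul_pos hMpos hqpos
  set α := (1 / (ε * p n * n ^ 2)) ^ 2 with hα
  set β := (1 / (ε * p n * μ * n)) ^ 2 with hβ
  have hα0 : 0 < α := by positivity
  have hβ0 : 0 < β := by positivity
  set Z : Template k n → ℝ := fun T =>
    α * (∑ e, a e * (Transf.xi T e - p n)) ^ 2 +
    (α * (∑ e, (1 : ℝ) * (Transf.xi T e - p n)) ^ 2 +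
     β * ∑ e, (Transf.XX N T e - μ) ^ 2) with hZ
  have hZ1 : ∀ T : Template k n, 0 ≤ α * (∑ e, a e * (Transf.xi T e - p n)) ^ 2 :=
    fun T => mul_nonneg hα0.le (sq_nonneg _)
  have hZ2 : ∀ T : Template k n, 0 ≤ α * (∑ e, (1 : ℝ) * (Transf.xi T e - p n)) ^ 2 :=
    fun T => mul_nonneg hα0.le (sq_nonneg _)
  have hZ3 : ∀ T : Template k n, 0 ≤ β * ∑ e, (Transf.XX N T e - μ) ^ 2 :=
    fun T => mul_nonneg hβ0.le (Finset.sum_nonneg fun _ _ => sq_nonneg _)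
  have hEZ : Transf.EX (p n) i Z ≤ (2 + 2 * (N : ℝ) ^ 2) / ε ^ 2 *
      (1 / (p n ^ (2 * K) * n)) := by
    rw [hZ, Transf.EX_add, Transf.EX_add, Transf.EX_mul, Transf.EX_mul, Transf.EX_mul,
      Transf.EX_sum]
    have e1 := (Transf.var_lin hk (hp n) i a ha1).trans (Transf.card_Edge_le n)
    have e2 := (Transf.var_lin hk (hp n) i (fun _ : Edge n => (1 : ℝ)) (by simp)).trans
      (Transf.card_Edge_le n)
    have e3 : ∑ e : Edge n, Transf.EX (p n) i (fun T : Template k n =>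
        (Transf.XX N T e - μ) ^ 2) ≤ (n : ℝ) ^ 2 * (2 * (N * Transf.MM n N) ^ 2 / n) := by
      have hone : ∀ e : Edge n, Transf.EX (p n) i (fun T : Template k n =>
        (Transf.XX N T e - μ) ^ 2) ≤ 2 * (N * Transf.MM n N) ^ 2 / n := by
        intro e
        have h := Transf.var_XX hk (hp n) i (N := N) (by omega) (by omega) e
        rw [← hK, ← hq, ← hμ] at h
        have hE0 : 0 ≤ Transf.EX (p n) i (fun T : Template k n =>
          (Transf.XX N T e - μ) ^ 2) :=
          Finset.sum_nonneg fun T _ => mul_nonneg (Transf.weight_nonneg (hp n) i T) (sq_nonneg _)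
        rw [le_div_iff₀ hn0]
        nlinarith
      refine (Finset.sum_le_card_nsmul _ _ _ fun e _ => hone e).trans ?_
      rw [nsmul_eq_mul, Finset.card_univ]
      exact mul_le_mul_of_nonneg_right (Transf.card_Edge_le n) (by positivity)
    have f1 : α * (n : ℝ) ^ 2 ≤ 1 / ε ^ 2 * (1 / (p n ^ (2 * K) * n)) := by
      have : α * (n : ℝ) ^ 2 = 1 / ε ^ 2 * (1 / (p n ^ 2 * n ^ 2)) := by
        rw [hα]; field_simp
      rw [this]
      refine mul_le_mul_of_nonneg_left ?_ (by positivity)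
      refine one_div_le_one_div_of_le (by positivity) ?_
      refine mul_le_mul (pow_le_pow_of_le_one hp0.le hp1 (by omega)) ?_ hn0.le (by positivity)
      nlinarith
    have f2 : β * ((n : ℝ) ^ 2 * (2 * (N * Transf.MM n N) ^ 2 / n)) =
        2 * (N : ℝ) ^ 2 / ε ^ 2 * (1 / (p n ^ (2 * K) * n)) := by
      have : p n ^ (2 * K) = (p n * q) ^ 2 := by rw [hpq]; ring
      rw [this, hβ, hμ]
      field_simp
    have g1 := mul_le_mul_of_nonneg_left e1 hα0.le
    have g2 := mul_le_mul_of_nonneg_left e2 hα0.le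
    have g3 := mul_le_mul_of_nonneg_left e3 hβ0.le
    rw [f2] at g3
    have : (2 + 2 * (N : ℝ) ^ 2) / ε ^ 2 * (1 / (p n ^ (2 * K) * n)) =
      1 / ε ^ 2 * (1 / (p n ^ (2 * K) * n)) + (1 / ε ^ 2 * (1 / (p n ^ (2 * K) * n)) +
       2 * (N : ℝ) ^ 2 / ε ^ 2 * (1 / (p n ^ (2 * K) * n))) := by ring
    rw [this]
    linarith
  refine le_trans (by linarith) (Transf.prob_ge hk (hp n) i _ Z
    (fun T => by have := hZ1 T; have := hZ2 T; have := hZ3 T; simp only [hZ]; linarith) ?_)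
  intro T hT hlt
  simp only [hZ] at hlt
  have z1 := hZ1 T
  have z2 := hZ2 T
  have z3 := hZ3 T
  have hsq : ∀ y : ℝ, α * y ^ 2 < 1 → |y| ≤ ε * p n * n ^ 2 := by
    intro y hy
    have hpos : 0 < ε * p n * n ^ 2 := by positivity
    refine abs_le_of_sq_le_sq ?_ hpos.le
    rw [hα, div_pow, one_pow, div_mul_eq_mul_div, one_mul, div_lt_one (by positivity)] at hy
    exact hy.le
  have y1 := abs_le.1 (hsq _ (by linarith : α * (∑ e, a e * (Transf.xi T e - p n)) ^ 2 < 1))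
  have y2 := abs_le.1 (hsq _ (by linarith :
    α * (∑ e, (1 : ℝ) * (Transf.xi T e - p n)) ^ 2 < 1))
  have y3 : ∑ e, (Transf.XX N T e - μ) ^ 2 ≤ (ε * p n * μ * n) ^ 2 := by
    have hy : β * ∑ e, (Transf.XX N T e - μ) ^ 2 < 1 := by linarith
    rw [hβ, div_pow, one_pow, div_mul_eq_mul_div, one_mul, div_lt_one (by positivity)] at hy
    exact hy.le
  constructor
  · refine le_trans ?_ (Transf.lower i P hmono t ht1 ht2 T hT)
    have : ∑ e, a e * (Transf.xi T e - p n) =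
        ∑ e, a e * Transf.xi T e - p n * exEnt (P n) := by
      rw [← hasum, Finset.mul_sum, ← Finset.sum_sub_distrib]
      exact Finset.sum_congr rfl fun _ _ => by ring
    rw [this] at y1
    change _ ≤ ∑ e, a e * Transf.xi T e
    linarith [y1.1]
  · unfold exEntRel
    refine Real.sSup_le ?_ (mul_nonneg hp0.le (by have := hex0 n; positivity))
    rintro x ⟨t', h1, h2, h3, rfl⟩
    have hu := Transf.upper hk i P hher ρ hρ0 hρ1 hρ t' h1 h3 T hT h2 μ hμpos (ε * p n)
      (by positivity) y3
    have hs : ∑ e, (1 : ℝ) * (Transf.xi T e - p n) =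
        ∑ e, Transf.xi T e - Fintype.card (Edge n) * p n := by
      simp [Finset.sum_sub_distrib]
    rw [hs] at y2
    have hρn : ρ * Fintype.card (Edge n) ≤ exEnt (P n) + ε * n ^ 2 := by
      have h := hrN (n - 3)
      have hc := hcpos (n - 3)
      simp only [hr] at h
      rw [show n - 3 + 3 = n by omega] at h hc
      have h5 := mul_le_mul_of_nonneg_right h hc.le
      rw [add_mul, div_mul_cancel₀ _ hc.ne'] at h5
      have h6 := mul_le_mul_of_nonneg_left (Transf.card_Edge_le n) hε.le
      linarith
    have h7 : ρ * ∑ e, Transf.xi T e ≤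
        ρ * (Fintype.card (Edge n) * p n) + ε * p n * n ^ 2 := by
      have h8 : 0 ≤ ε * p n * (n : ℝ) ^ 2 := by positivity
      have h9 := mul_le_mul_of_nonneg_left y2.2 hρ0
      have h10 := mul_le_mul_of_nonneg_right hρ1 h8
      linarith
    have h11 := mul_le_mul_of_nonneg_right hρn hp0.le
    linarith
end

section
/- Container theorem for good set-sequences equipped with embeddings: Let V = ((V_n), (binom(V_n,V_N))) be a good ssee, let k ≥ 2 and N ∈ ℕ, let F be a nonempty collection of k-colourings of V_N, and let P = Forb_V(F). For every ε > 0 there exists n₀ such that for every n ≥ n₀ there is a collection T_n of k-colouring templates for V_n satisfying: (i) for every c ∈ P_n there exists t ∈ T_n with c ∈ ⟨t⟩; (ii) for each t ∈ T_n, the number of pairs (φ, c) with φ ∈ binom(V_n,V_N), c ∈ F and c ∈ ⟨t|φ⟩ is at most ε·|binom(V_n,V_N)|; and (iii) |T_n| ≤ k^{ε·|V_n|}. -/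
open Filter

/-- A set-sequence equipped with embeddings (ssee): a sequence of finite nonempty sets
`V n` together with, for each `N` and `n`, a finite set of injections `V N → V n`
called embeddings. -/
structure SSEE where
  V : ℕ → Type
  finV : ∀ n, Finite (V n)
  neV : ∀ n, Nonempty (V n)
  emb : (N n : ℕ) → Set (V N → V n)
  embFin : ∀ N n, (emb N n).Finite
  embInj : ∀ N n, ∀ φ ∈ emb N n, Function.Injective φ

/-- `I(N,n)`: the number of ordered pairs of embeddings of `V N` into `V n` whose images
share more than one but fewer than `|V N|` elements. -/
noncomputable def SSEE.interCount (Vs : SSEE) (N n : ℕ) : ℕ :=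
  Set.ncard {p : (Vs.V N → Vs.V n) × (Vs.V N → Vs.V n) |
    p.1 ∈ Vs.emb N n ∧ p.2 ∈ Vs.emb N n ∧
    1 < (Set.range p.1 ∩ Set.range p.2).ncard ∧
    (Set.range p.1 ∩ Set.range p.2).ncard < Nat.card (Vs.V N)}

/-- A good ssee: the sets grow, each `V N` (of size `> 1`) has many embeddings into `V n`
relative to `|V n|`, and most pairs of embeddings overlap in at most one element. -/
def SSEE.Good (Vs : SSEE) : Prop :=
  Tendsto (fun n => (Nat.card (Vs.V n) : ℝ)) atTop atTop ∧
  (∀ N : ℕ, 1 < Nat.card (Vs.V N) →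
    Tendsto (fun n => ((Vs.emb N n).ncard : ℝ) / (Nat.card (Vs.V n) : ℝ)) atTop atTop) ∧
  (∀ N : ℕ, 1 < Nat.card (Vs.V N) →
    Tendsto (fun n => (Nat.card (Vs.V n) : ℝ) * (Vs.interCount N n : ℝ) /
      ((Vs.emb N n).ncard : ℝ) ^ 2) atTop (nhds 0))

/-- The hereditary property of `k`-colourings of the ssee avoiding every colouring in `F`. -/
def SSEE.Forb (Vs : SSEE) {k N : ℕ} (F : Set (Vs.V N → Fin k)) (n : ℕ) :
    Set (Vs.V n → Fin k) :=
  {c | ∀ φ ∈ Vs.emb N n, (c ∘ φ) ∉ F}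

/-- The number of pairs `(φ, c)` with `φ` an embedding of `V N` into `V n`, `c ∈ F`, and
`c` realisable from the restriction of the template `t` along `φ`. -/
noncomputable def SSEE.badPairs (Vs : SSEE) {k N n : ℕ}
    (t : Vs.V n → Finset (Fin k)) (F : Set (Vs.V N → Fin k)) : ℕ :=
  Set.ncard {p : (Vs.V N → Vs.V n) × (Vs.V N → Fin k) |
    p.1 ∈ Vs.emb N n ∧ p.2 ∈ F ∧ ∀ x, p.2 x ∈ t (p.1 x)}

set_option linter.unusedSectionVars false
namespace Cont
open Finset

variable {α : Type} [Fintype α] [DecidableEq α]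

/-- Number of edges of size `s` containing `L`. -/
def dg (G : Finset (Finset α)) (s : ℕ) (L : Finset α) : ℕ :=
  (G.filter (fun E => E.card = s ∧ L ⊆ E)).card

/-- Invariant of the container algorithm. -/
structure Inv (r K : ℕ) (G : Finset (Finset α)) : Prop where
  ne : ∀ E ∈ G, E.Nonempty
  le : ∀ E ∈ G, E.card ≤ r
  anti : ∀ E ∈ G, ∀ E' ∈ G, E ⊆ E' → E = E'
  deg : ∀ s < r, ∀ L : Finset α, L.Nonempty → dg G s L ≤ 2 * K ^ (s - L.card)

/-- Terminal states. -/
structure Fin' (r K : ℕ) (G : Finset (Finset α)) : Prop where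
  ne : ∀ E ∈ G, E.Nonempty
  le : ∀ E ∈ G, E.card ≤ r
  deg : ∀ s ≤ r, ∀ L : Finset α, L.Nonempty → dg G s L ≤ K ^ (s - L.card)

/-- The potential. -/
noncomputable def Q (r : ℕ) (y : ℝ) (G : Finset (Finset α)) : ℝ :=
  ∑ E ∈ G.filter (fun E => E.card < r), y ^ E.card

lemma sum_biUnion_le' {ι β : Type*} [DecidableEq ι] [DecidableEq β] (s : Finset ι)
    (t : ι → Finset β) (f : β → ℝ) (hf : ∀ b, 0 ≤ f b) :
    ∑ b ∈ s.biUnion t, f b ≤ ∑ i ∈ s, ∑ b ∈ t i, f b := by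
  induction s using Finset.induction_on with
  | empty => simp
  | insert a s ha ih =>
    rw [biUnion_insert, sum_insert ha]
    have h := sum_union_inter (s₁ := t a) (s₂ := s.biUnion t) (f := f)
    have h2 : 0 ≤ ∑ b ∈ t a ∩ s.biUnion t, f b := sum_nonneg (fun b _ => hf b)
    linarith

lemma geom_bound (m : ℕ) : ∑ i ∈ range m, 2 * (1/5 : ℝ) ^ (i+1) ≤ 1/2 := by
  have h : ∑ i ∈ range m, 2 * (1/5 : ℝ) ^ (i+1) = 1/2 * (1 - (1/5)^m) := by
    induction m with
    | zero => simp
    | succ m ih => rw [sum_range_succ, ih]; ring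
  rw [h]
  have : (0:ℝ) ≤ (1/5)^m := by positivity
  linarith

lemma local_bound {r K : ℕ} (hK : 1 ≤ K) {G : Finset (Finset α)} (hG : Inv r K G) {y : ℝ}
    (hy : y = 1 / (5 * K)) (L : Finset α) (hL : L.Nonempty) :
    ∑ E ∈ G.filter (fun E => E.card < r ∧ L ⊂ E), y ^ E.card ≤ y ^ L.card / 2 := by
  have hK' : (0:ℝ) < K := by exact_mod_cast hK
  have hy0 : 0 < y := by rw [hy]; positivity
  have hKy : (K:ℝ) * y = 1/5 := by rw [hy]; field_simp
  have hmaps : ∀ E ∈ G.filter (fun E => E.card < r ∧ L ⊂ E), E.card ∈ Ico (L.card + 1) r := by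
    intro E hE
    simp only [mem_filter] at hE
    rw [mem_Ico]
    exact ⟨card_lt_card hE.2.2, hE.2.1⟩
  rw [← sum_fiberwise_of_maps_to hmaps]
  calc _ ≤ ∑ s ∈ Ico (L.card + 1) r, 2 * (K:ℝ) ^ (s - L.card) * y ^ s := by
        apply sum_le_sum
        intro s hs
        rw [mem_Ico] at hs
        calc _ = ∑ E ∈ (G.filter (fun E => E.card < r ∧ L ⊂ E)).filter (fun E => E.card = s),
                  y ^ s := by
              apply sum_congr rfl
              intro E hE
              rw [(mem_filter.1 hE).2]
          _ = (((G.filter (fun E => E.card < r ∧ L ⊂ E)).filter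
                (fun E => E.card = s)).card : ℝ) * y ^ s := by
              rw [sum_const, nsmul_eq_mul]
          _ ≤ _ := by
              apply mul_le_mul_of_nonneg_right _ (by positivity)
              have h1 : ((G.filter (fun E => E.card < r ∧ L ⊂ E)).filter
                (fun E => E.card = s)).card ≤ dg G s L := by
                apply card_le_card
                intro E hE
                simp only [mem_filter] at hE ⊢
                exact ⟨hE.1.1, hE.2, hE.1.2.2.subset⟩
              exact_mod_cast h1.trans (hG.deg s hs.2 L hL)
    _ = y ^ L.card * ∑ i ∈ range (r - (L.card + 1)), 2 * (1/5 : ℝ) ^ (i+1) := by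
        rw [sum_Ico_eq_sum_range, mul_sum]
        apply sum_congr rfl
        intro i _
        have : L.card + 1 + i - L.card = i + 1 := by omega
        rw [this, ← hKy, mul_pow]
        ring
    _ ≤ y ^ L.card * (1/2) := by
        apply mul_le_mul_of_nonneg_left (geom_bound _) (by positivity)
    _ = _ := by ring

lemma Q_le {r K : ℕ} (hK : 1 ≤ K) {G : Finset (Finset α)} (hG : Inv r K G) {y : ℝ}
    (hy : y = 1 / (5 * K)) : Q r y G ≤ Fintype.card α / K := by
  have hK' : (0:ℝ) < K := by exact_mod_cast hK
  have hy0 : 0 < y := by rw [hy]; positivity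
  have h1 : Q r y G ≤ ∑ v : α, (y + ∑ E ∈ G.filter (fun E => E.card < r ∧ {v} ⊂ E), y ^ E.card) := by
    unfold Q
    calc _ ≤ ∑ E ∈ (univ : Finset α).biUnion
              (fun v => G.filter (fun E => E.card < r ∧ v ∈ E)), y ^ E.card := by
          apply sum_le_sum_of_subset_of_nonneg
          · intro E hE
            rw [mem_filter] at hE
            obtain ⟨v, hv⟩ := hG.ne E hE.1
            simp only [mem_biUnion, mem_filter, mem_univ, true_and]
            exact ⟨v, hE.1, hE.2, hv⟩
          · intros; positivity
      _ ≤ ∑ v : α, ∑ E ∈ G.filter (fun E => E.card < r ∧ v ∈ E), y ^ E.card := by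
          exact sum_biUnion_le' _ _ _ (by intros; positivity)
      _ ≤ _ := by
          apply sum_le_sum
          intro v _
          have hsub : G.filter (fun E => E.card < r ∧ v ∈ E) ⊆
              insert {v} (G.filter (fun E => E.card < r ∧ {v} ⊂ E)) := by
            intro E hE
            simp only [mem_filter, mem_insert] at hE ⊢
            by_cases h : E = {v}
            · exact Or.inl h
            · right
              refine ⟨hE.1, hE.2.1, ?_⟩
              rw [Finset.ssubset_iff_subset_ne]
              exact ⟨by simpa using hE.2.2, fun h' => h h'.symm⟩
          refine (sum_le_sum_of_subset_of_nonneg hsub (by intros; positivity)).trans ?_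
          rw [sum_insert]
          · simp
          · simp
  refine h1.trans ?_
  have h2 : ∀ v : α, (y + ∑ E ∈ G.filter (fun E => E.card < r ∧ {v} ⊂ E), y ^ E.card) ≤ 1 / K := by
    intro v
    have := local_bound hK hG hy {v} (singleton_nonempty v)
    rw [card_singleton, pow_one] at this
    have h3 : y + y / 2 ≤ 1 / K := by
      rw [hy]
      field_simp
      norm_num
    linarith
  calc _ ≤ ∑ v : α, (1 / K : ℝ) := sum_le_sum (fun v _ => h2 v)
    _ = _ := by simp [div_eq_mul_inv]

/-- Update of the state. -/
def upd (G N : Finset (Finset α)) : Finset (Finset α) :=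
  N ∪ G.filter (fun E => ∀ A ∈ N, ¬ A ⊆ E)

lemma dg_upd_le (G N : Finset (Finset α)) (s : ℕ) (L : Finset α) :
    dg (upd G N) s L ≤ dg N s L + dg G s L := by
  unfold dg upd
  rw [filter_union]
  refine (card_union_le _ _).trans ?_
  gcongr
  exact filter_subset _ _

lemma upd_cover (G N : Finset (Finset α)) : ∀ E ∈ G, ∃ A ∈ upd G N, A ⊆ E := by
  intro E hE
  by_cases h : ∀ A ∈ N, ¬ A ⊆ E
  · exact ⟨E, by simp only [upd, mem_union, mem_filter]; exact Or.inr ⟨hE, h⟩, subset_rfl⟩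
  · push Not at h
    obtain ⟨A, hA, hAE⟩ := h
    exact ⟨A, mem_union_left _ hA, hAE⟩

lemma upd_inv {r K j : ℕ} {G N : Finset (Finset α)} (hG : Inv r K G)
    (hj1 : 1 ≤ j) (hjr : j < r) (hNj : ∀ A ∈ N, A.card = j)
    (hNG : ∀ A ∈ N, ∃ E ∈ G, A ⊂ E)
    (hNd : ∀ L : Finset α, L.Nonempty → dg N j L ≤ K ^ (j - L.card))
    (hGd : ∀ L : Finset α, L.Nonempty → dg G j L ≤ K ^ (j - L.card)) :
    Inv r K (upd G N) := by
  refine ⟨?_, ?_, ?_, ?_⟩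
  · intro E hE
    simp only [upd, mem_union, mem_filter] at hE
    rcases hE with h | h
    · rw [← card_pos, hNj E h]; exact hj1
    · exact hG.ne E h.1
  · intro E hE
    simp only [upd, mem_union, mem_filter] at hE
    rcases hE with h | h
    · rw [hNj E h]; exact hjr.le
    · exact hG.le E h.1
  · intro E hE E' hE' hs
    simp only [upd, mem_union, mem_filter] at hE hE'
    rcases hE with h | h <;> rcases hE' with h' | h'
    · exact eq_of_subset_of_card_le hs (by rw [hNj E h, hNj E' h'])
    · exact absurd hs (h'.2 E h)
    · obtain ⟨E0, hE0, hlt⟩ := hNG E' h'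
      have := hG.anti E h.1 E0 hE0 (hs.trans hlt.subset)
      subst this
      exact absurd hs hlt.2
    · exact hG.anti E h.1 E' h'.1 hs
  · intro s hs L hL
    refine (dg_upd_le _ _ _ _).trans ?_
    by_cases h : s = j
    · subst h
      have := hNd L hL
      have := hGd L hL
      omega
    · have : dg N s L = 0 := by
        unfold dg
        rw [card_eq_zero, filter_eq_empty_iff]
        intro A hA hc
        exact h (hc.1.symm.trans (hNj A hA))
      rw [this, zero_add]
      exact hG.deg s hs L hL

lemma upd_Q {r K j : ℕ} (hK : 1 ≤ K) {G N : Finset (Finset α)} (hG : Inv r K G)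
    (hj1 : 1 ≤ j) (hjr : j < r) (hNj : ∀ A ∈ N, A.card = j)
    (hNG : ∀ A ∈ N, ∃ E ∈ G, A ⊂ E) {y : ℝ} (hy : y = 1 / (5 * K)) :
    Q r y G + N.card * y ^ j / 2 ≤ Q r y (upd G N) := by
  have hK' : (0:ℝ) < K := by exact_mod_cast hK
  have hy0 : 0 < y := by rw [hy]; positivity
  have e1 : Q r y (upd G N) = N.card * y ^ j +
      ∑ E ∈ (G.filter (fun E => ∀ A ∈ N, ¬ A ⊆ E)).filter (fun E => E.card < r), y ^ E.card := by
    unfold Q upd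
    rw [filter_union, sum_union]
    · congr 1
      rw [filter_true_of_mem (fun A hA => by rw [hNj A hA]; exact hjr),
        sum_congr rfl (fun A hA => by rw [hNj A hA]), sum_const, nsmul_eq_mul]
    · rw [disjoint_left]
      intro A hA hA'
      simp only [mem_filter] at hA hA'
      exact hA'.1.2 A hA.1 subset_rfl
  have e2 : Q r y G ≤
      ∑ E ∈ (G.filter (fun E => ∀ A ∈ N, ¬ A ⊆ E)).filter (fun E => E.card < r), y ^ E.card +
      ∑ E ∈ N.biUnion (fun A => G.filter (fun E => E.card < r ∧ A ⊂ E)), y ^ E.card := by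
    unfold Q
    rw [← sum_filter_add_sum_filter_not (G.filter (fun E => E.card < r))
      (fun E => ∀ A ∈ N, ¬ A ⊆ E)]
    apply add_le_add
    · rw [filter_comm]
    · apply sum_le_sum_of_subset_of_nonneg
      · intro E hE
        simp only [mem_filter, not_forall, not_not] at hE
        obtain ⟨⟨hE1, hE2⟩, A, hA, hAE⟩ := hE
        simp only [mem_biUnion, mem_filter]
        refine ⟨A, hA, hE1, hE2, ?_⟩
        obtain ⟨E0, hE0, hlt⟩ := hNG A hA
        rw [Finset.ssubset_iff_subset_ne]
        refine ⟨hAE, fun h => ?_⟩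
        subst h
        have := hG.anti A hE1 E0 hE0 hlt.subset
        exact hlt.ne this
      · intros; positivity
  have e3 : ∑ E ∈ N.biUnion (fun A => G.filter (fun E => E.card < r ∧ A ⊂ E)), y ^ E.card
      ≤ N.card * y ^ j / 2 := by
    calc _ ≤ ∑ A ∈ N, ∑ E ∈ G.filter (fun E => E.card < r ∧ A ⊂ E), y ^ E.card := by
          exact sum_biUnion_le' _ _ _ (by intros; positivity)
      _ ≤ ∑ A ∈ N, y ^ j / 2 := by
          apply sum_le_sum
          intro A hA
          have := local_bound hK hG hy A (by rw [← card_pos, hNj A hA]; exact hj1)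
          rwa [hNj A hA] at this
      _ = _ := by rw [sum_const, nsmul_eq_mul]; ring
  linarith

lemma exists_viol {r K : ℕ} {G : Finset (Finset α)} (hG : Inv r K G) (h : ¬ Fin' r K G) :
    ∃ s ≤ r, ∃ L : Finset α, L.Nonempty ∧ K ^ (s - L.card) < dg G s L ∧
      (∀ j < s, ∀ L : Finset α, L.Nonempty → dg G j L ≤ K ^ (j - L.card)) ∧
      (∀ L' : Finset α, L.card < L'.card → dg G s L' ≤ K ^ (s - L'.card)) := by
  classical
  have hex : ∃ s, s ≤ r ∧ ∃ L : Finset α, L.Nonempty ∧ K ^ (s - L.card) < dg G s L := by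
    by_contra hcon
    push Not at hcon
    exact h ⟨hG.ne, hG.le, hcon⟩
  obtain ⟨hs, L0, hL0⟩ := Nat.find_spec hex
  have hmin := fun j (hj : j < Nat.find hex) => Nat.find_min hex hj
  set s := Nat.find hex
  obtain ⟨L, hL, hmax⟩ := exists_max_image
    ((univ : Finset (Finset α)).filter (fun L => L.Nonempty ∧ K ^ (s - L.card) < dg G s L))
    card ⟨L0, by simpa using hL0⟩
  simp only [mem_filter, mem_univ, true_and] at hL hmax
  refine ⟨s, hs, L, hL.1, hL.2, ?_, ?_⟩
  · intro j hj L hL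
    have := hmin j hj
    push Not at this
    exact this (by omega) L hL
  · intro L' hL'
    by_contra hcon
    push Not at hcon
    have := hmax L' ⟨by rw [← card_pos]; omega, hcon⟩
    omega

lemma dg_le_one {G : Finset (Finset α)} {s : ℕ} {L : Finset α} (h : s ≤ L.card) : dg G s L ≤ 1 := by
  unfold dg
  rw [card_le_one]
  intro a ha b hb
  simp only [mem_filter] at ha hb
  rw [← eq_of_subset_of_card_le ha.2.2 (by omega), ← eq_of_subset_of_card_le hb.2.2 (by omega)]

lemma main_ind {r K : ℕ} (hK : 1 ≤ K) {y : ℝ} (hy : y = 1 / (5 * K)) (m : ℕ) :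
    ∀ G : Finset (Finset α), Inv r K G →
      (Fintype.card α / K : ℝ) - Q r y G < m * (y ^ r / 2) →
    ∃ F : Finset α → Finset (Finset α),
      (∀ S, Fin' r K (F S) ∧ ∀ E ∈ G, ∃ A ∈ F S, A ⊆ E) ∧
      ∀ I : Finset α, (∀ E ∈ G, ¬ E ⊆ I) → ∃ S ⊆ I,
        (S.card : ℝ) ≤ r * 2 * 5 ^ r * ((Fintype.card α / K : ℝ) - Q r y G) ∧
        ∀ S', S ⊆ S' → S' ⊆ I → ∀ E ∈ F S', ¬ E ⊆ I := by
  have hK' : (0:ℝ) < K := by exact_mod_cast hK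
  have hy0 : 0 < y := by rw [hy]; positivity
  have hKy : (K:ℝ) * y = 1/5 := by rw [hy]; field_simp
  have hy1 : y ≤ 1 := by
    have : (1:ℝ) ≤ K := by exact_mod_cast hK
    nlinarith
  induction m with
  | zero =>
    intro G hG h
    have := Q_le hK hG hy
    simp at h
    linarith
  | succ m ih =>
    intro G hG hQ
    by_cases hfin : Fin' r K G
    · refine ⟨fun _ => G, fun S => ⟨hfin, fun E hE => ⟨E, hE, subset_rfl⟩⟩, ?_⟩
      intro I hI
      refine ⟨∅, empty_subset _, ?_, fun _ _ _ => hI⟩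
      have := Q_le hK hG hy
      have h0 : 0 ≤ (Fintype.card α / K : ℝ) - Q r y G := by linarith
      simp only [card_empty, Nat.cast_zero]
      positivity
    obtain ⟨s, hs, L, hL, hviol, hlow, hmax⟩ := exists_viol hG hfin
    have hLpos : 1 ≤ L.card := card_pos.2 hL
    have hLs : L.card < s := by
      by_contra hcon
      have := dg_le_one (G := G) (s := s) (L := L) (by omega)
      have : 0 < K ^ (s - L.card) := by positivity
      omega
    have hstep : ∀ N : Finset (Finset α), ∀ j, 1 ≤ j → j < s → (∀ A ∈ N, A.card = j) →
        (∀ A ∈ N, ∃ E ∈ G, A ⊂ E) →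
        (∀ L : Finset α, L.Nonempty → dg N j L ≤ K ^ (j - L.card)) → 1 ≤ N.card →
        Inv r K (upd G N) ∧ Q r y G + N.card * y ^ j / 2 ≤ Q r y (upd G N) ∧
        (Fintype.card α / K : ℝ) - Q r y (upd G N) < m * (y ^ r / 2) := by
      intro N j hj1 hjs hNj hNG hNd hN1
      have h2 := upd_Q hK hG hj1 (by omega) hNj hNG hy (r := r)
      refine ⟨upd_inv hG hj1 (by omega) hNj hNG hNd (hlow j hjs), h2, ?_⟩
      have h3 : y ^ r ≤ y ^ j := pow_le_pow_of_le_one hy0.le hy1 (by omega)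
      have h4 : (1:ℝ) ≤ N.card := by exact_mod_cast hN1
      have h5 : 0 < y ^ j := by positivity
      push_cast at hQ
      nlinarith
    -- the two updates
    obtain ⟨E0, hE0⟩ : ∃ E0, E0 ∈ G.filter (fun E => E.card = s ∧ L ⊆ E) := by
      rw [← Finset.Nonempty, ← card_pos]
      exact lt_of_le_of_lt (Nat.zero_le _) hviol
    rw [mem_filter] at hE0
    have hone : ∀ a, 1 ≤ K ^ a := fun a => Nat.one_le_pow _ _ hK
    obtain ⟨hI1, hQ1, hm1⟩ := hstep {L} L.card hLpos hLs (by simp)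
      (by
        intro A hA
        rw [mem_singleton] at hA
        subst hA
        refine ⟨E0, hE0.1, Finset.ssubset_iff_subset_ne.2 ⟨hE0.2.2, ?_⟩⟩
        intro h
        rw [h] at hLs
        omega)
      (by
        intro L' _
        refine le_trans ?_ (hone _)
        unfold dg
        exact (card_filter_le _ _).trans (by simp)) (by simp)
    set N2 := (G.filter (fun E => E.card = s ∧ L ⊆ E)).image (fun E => E \ L) with hN2
    have hN2card : N2.card = dg G s L := by
      rw [hN2, card_image_of_injOn]
      · rfl
      · intro a ha b hb hab
        simp only [coe_filter, Set.mem_ofPred_eq] at ha hb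
        simp only at hab
        rw [← sdiff_union_of_subset ha.2.2, ← sdiff_union_of_subset hb.2.2, hab]
    obtain ⟨hI2, hQ2, hm2⟩ := hstep N2 (s - L.card) (by omega) (by omega)
      (by
        intro A hA
        simp only [hN2, mem_image, mem_filter] at hA
        obtain ⟨E, ⟨_, hE1, hE2⟩, rfl⟩ := hA
        rw [card_sdiff_of_subset hE2, hE1])
      (by
        intro A hA
        simp only [hN2, mem_image, mem_filter] at hA
        obtain ⟨E, ⟨hE, hE1, hE2⟩, rfl⟩ := hA
        exact ⟨E, hE, sdiff_ssubset hE2 hL⟩)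
      (by
        intro L' hL'
        by_cases hd : Disjoint L L'
        · have hc : (L ∪ L').card = L.card + L'.card := card_union_of_disjoint hd
          have h1 := hmax (L ∪ L') (by rw [hc]; have := card_pos.2 hL'; omega)
          rw [hc] at h1
          have h2 : dg N2 (s - L.card) L' ≤ dg G s (L ∪ L') := by
            unfold dg
            refine le_trans (card_le_card ?_) (card_image_le (f := fun E => E \ L))
            intro A hA
            simp only [hN2, mem_image, mem_filter] at hA ⊢
            obtain ⟨⟨E, ⟨hE, hE1, hE2⟩, rfl⟩, _, hA3⟩ := hA
            exact ⟨E, ⟨hE, hE1, union_subset hE2 (hA3.trans sdiff_subset)⟩, rfl⟩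
          rw [Nat.sub_sub]
          exact h2.trans h1
        · have : dg N2 (s - L.card) L' = 0 := by
            unfold dg
            rw [card_eq_zero, filter_eq_empty_iff]
            rintro A hA ⟨_, hA2⟩
            simp only [hN2, mem_image, mem_filter] at hA
            obtain ⟨E, ⟨hE, hE1, hE2⟩, rfl⟩ := hA
            exact hd (disjoint_sdiff.mono_right hA2)
          rw [this]
          exact Nat.zero_le _)
      (by rw [hN2card]; have := hone (s - L.card); omega)
    obtain ⟨F1, hF1, hF1'⟩ := ih _ hI1 hm1
    obtain ⟨F2, hF2, hF2'⟩ := ih _ hI2 hm2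
    refine ⟨fun S => if L ⊆ S then F2 S else F1 S, ?_, ?_⟩
    · intro S
      have key : ∀ N (H : Finset (Finset α)), (∀ E ∈ upd G N, ∃ A ∈ H, A ⊆ E) →
          ∀ E ∈ G, ∃ A ∈ H, A ⊆ E := by
        intro N H h E hE
        obtain ⟨A, hA, hAE⟩ := upd_cover G N E hE
        obtain ⟨B, hB, hBA⟩ := h A hA
        exact ⟨B, hB, hBA.trans hAE⟩
      dsimp only
      split_ifs
      · exact ⟨(hF2 S).1, key _ _ (hF2 S).2⟩
      · exact ⟨(hF1 S).1, key _ _ (hF1 S).2⟩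
    · intro I hI
      by_cases hLI : L ⊆ I
      · obtain ⟨S, hSI, hScard, hS⟩ := hF2' I (by
          intro E hE hEI
          simp only [upd, mem_union, mem_filter] at hE
          rcases hE with hE | hE
          · simp only [hN2, mem_image, mem_filter] at hE
            obtain ⟨E', ⟨hE', _, hE2⟩, rfl⟩ := hE
            apply hI E' hE'
            rw [← sdiff_union_of_subset hE2]
            exact union_subset hEI hLI
          · exact hI E hE.1 hEI)
        refine ⟨S ∪ L, union_subset hSI hLI, ?_, ?_⟩
        · have h1 : ((S ∪ L).card : ℝ) ≤ S.card + r := by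
            have := card_union_le S L
            have h2 : (S ∪ L).card ≤ S.card + r := by omega
            exact_mod_cast h2
          have h3 : (1/5 : ℝ) ^ r ≤ N2.card * y ^ (s - L.card) := by
            calc (1/5 : ℝ) ^ r ≤ (1/5) ^ (s - L.card) :=
                  pow_le_pow_of_le_one (by norm_num) (by norm_num) (by omega)
              _ = (K:ℝ) ^ (s - L.card) * y ^ (s - L.card) := by rw [← mul_pow, hKy]
              _ ≤ _ := by
                  apply mul_le_mul_of_nonneg_right _ (by positivity)
                  rw [hN2card]
                  exact_mod_cast hviol.le
          have h4 : (5:ℝ) ^ r * (1/5) ^ r = 1 := by rw [← mul_pow]; norm_num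
          have h5 : (0:ℝ) ≤ r * 2 * 5 ^ r := by positivity
          have h6 : Q r y G + (1/5 : ℝ) ^ r / 2 ≤ Q r y (upd G N2) := by linarith
          have h7 := mul_le_mul_of_nonneg_left h6 h5
          have h8 : (r:ℝ) * 2 * 5 ^ r * ((1/5 : ℝ) ^ r / 2) = r := by
            calc _ = (r:ℝ) * ((5:ℝ) ^ r * (1/5) ^ r) := by ring
              _ = r := by rw [h4, mul_one]
          rw [mul_add, h8] at h7
          rw [mul_sub] at hScard ⊢
          linarith
        · intro S' hS1 hS2
          dsimp only
          rw [if_pos (subset_union_right.trans hS1)]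
          exact hS S' (subset_union_left.trans hS1) hS2
      · obtain ⟨S, hSI, hScard, hS⟩ := hF1' I (by
          intro E hE hEI
          simp only [upd, mem_union, mem_filter, mem_singleton] at hE
          rcases hE with rfl | hE
          · exact hLI hEI
          · exact hI E hE.1 hEI)
        refine ⟨S, hSI, hScard.trans ?_, ?_⟩
        · apply mul_le_mul_of_nonneg_left _ (by positivity)
          have : (0:ℝ) ≤ ({L} : Finset (Finset α)).card * y ^ L.card / 2 := by positivity
          linarith
        · intro S' hS1 hS2
          dsimp only
          rw [if_neg (fun h => hLI (h.trans hS2))]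
          exact hS S' hS1 hS2

/-- Container lemma for `r`-uniform hypergraphs. -/
lemma container {r K : ℕ} (hr : 1 ≤ r) (hK : 1 ≤ K) (H : Finset (Finset α))
    (hH : ∀ E ∈ H, E.card = r) :
    ∃ F : Finset α → Finset (Finset α),
      (∀ S, Fin' r K (F S) ∧ ∀ E ∈ H, ∃ A ∈ F S, A ⊆ E) ∧
      ∀ I : Finset α, (∀ E ∈ H, ¬ E ⊆ I) → ∃ S : Finset α,
        (S.card : ℝ) ≤ r * 2 * 5 ^ r * (Fintype.card α / K : ℝ) ∧
        ∀ E ∈ F S, ¬ E ⊆ I := by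
  have hK' : (0:ℝ) < K := by exact_mod_cast hK
  have hinv : Inv r K H := by
    refine ⟨?_, fun E hE => (hH E hE).le, ?_, ?_⟩
    · intro E hE; rw [← card_pos, hH E hE]; exact hr
    · intro E hE E' hE' hs
      exact eq_of_subset_of_card_le hs (by rw [hH E hE, hH E' hE'])
    · intro s hs L hL
      have : dg H s L = 0 := by
        unfold dg
        rw [card_eq_zero, filter_eq_empty_iff]
        intro A hA hc
        have := hH A hA
        omega
      rw [this]; exact Nat.zero_le _
  have hQ : Q r (1 / (5 * K)) H = 0 := by
    unfold Q
    rw [filter_false_of_mem, sum_empty]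
    intro E hE
    rw [hH E hE]; omega
  have hp : (0:ℝ) < (1 / (5 * K)) ^ r / 2 := by positivity
  obtain ⟨m, hm⟩ := exists_nat_gt ((Fintype.card α / K : ℝ) / ((1 / (5 * K)) ^ r / 2))
  rw [div_lt_iff₀ hp] at hm
  obtain ⟨F, hF, hF'⟩ := main_ind hK rfl m H hinv (by rw [hQ, sub_zero]; exact hm)
  refine ⟨F, hF, fun I hI => ?_⟩
  obtain ⟨S, hSI, hS, h⟩ := hF' I hI
  rw [hQ, sub_zero] at hS
  exact ⟨S, hS, h S subset_rfl hSI⟩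

lemma fin_card {r K : ℕ} (hK : 1 ≤ K) {G : Finset (Finset α)} (hG : Fin' r K G) :
    G.card ≤ Fintype.card α * ((r + 1) * K ^ r) := by
  have hsub : G ⊆ (univ : Finset α).biUnion (fun v => (range (r+1)).biUnion
      (fun s => G.filter (fun E => E.card = s ∧ {v} ⊆ E))) := by
    intro E hE
    obtain ⟨v, hv⟩ := hG.ne E hE
    simp only [mem_biUnion, mem_univ, true_and, mem_filter, mem_range]
    exact ⟨v, E.card, by have := hG.le E hE; omega, hE, rfl, by simpa using hv⟩
  refine (card_le_card hsub).trans ?_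
  rw [← card_univ]
  refine card_biUnion_le_card_mul _ _ _ ?_
  intro v _
  conv_rhs => rw [← card_range (r+1)]
  refine card_biUnion_le_card_mul _ _ _ ?_
  intro s hs
  rw [mem_range] at hs
  refine (hG.deg s (by omega) {v} (singleton_nonempty v)).trans ?_
  exact Nat.pow_le_pow_right hK (by omega)

lemma small_sets {x : ℝ} (hx0 : 0 < x) (hx1 : x ≤ 1) (b : ℝ) (_hb : 0 ≤ b) :
    (((univ : Finset (Finset α)).filter (fun S => (S.card : ℝ) ≤ b)).card : ℝ) ≤
      Real.exp (x * Fintype.card α + b * Real.log (1 / x)) := by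
  have h1 : ∑ S : Finset α, x ^ S.card = (1 + x) ^ Fintype.card α := by
    have := Finset.sum_pow_mul_eq_add_pow x 1 (univ : Finset α)
    simp only [one_pow, mul_one, powerset_univ, card_univ] at this
    rw [this, add_comm]
  have h2 : ∀ S ∈ (univ : Finset (Finset α)).filter (fun S => (S.card : ℝ) ≤ b),
      Real.exp (-(b * Real.log (1 / x))) ≤ x ^ S.card := by
    intro S hS
    rw [mem_filter] at hS
    rw [← Real.exp_log (pow_pos hx0 S.card), Real.exp_le_exp, Real.log_pow, one_div, Real.log_inv]
    have := Real.log_nonpos hx0.le hx1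
    nlinarith [hS.2]
  have h3 := Finset.card_nsmul_le_sum _ _ _ h2
  have h4 : ∑ S ∈ (univ : Finset (Finset α)).filter (fun S => (S.card : ℝ) ≤ b), x ^ S.card
      ≤ ∑ S : Finset α, x ^ S.card := by
    apply sum_le_sum_of_subset_of_nonneg (filter_subset _ _)
    intros; positivity
  have h5 : (1 + x) ^ Fintype.card α ≤ Real.exp (x * Fintype.card α) := by
    rw [mul_comm, Real.exp_nat_mul]
    apply pow_le_pow_left₀ (by positivity)
    linarith [Real.add_one_le_exp x]
  rw [nsmul_eq_mul] at h3
  rw [Real.exp_add]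
  have h6 : 0 < Real.exp (b * Real.log (1 / x)) := Real.exp_pos _
  rw [Real.exp_neg] at h3
  have h7 := (h3.trans h4).trans (h1.le.trans h5)
  rwa [← div_eq_mul_inv, div_le_iff₀ h6] at h7

end Cont

namespace Cont
open Finset

lemma count_bad {ι α : Type} [DecidableEq ι] [DecidableEq α] (r : ℕ) (P B : Finset ι)
    (e : ι → Finset α) (he : ∀ p ∈ P, (e p).card = r) (A : Finset (Finset α))
    (hA : ∀ a ∈ A, 2 ≤ a.card) (hB : B ⊆ P) (hBA : ∀ p ∈ B, ∃ a ∈ A, a ⊆ e p) :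
    B.card ^ 2 ≤ A.card * (2 ^ r *
      ((P ×ˢ P).filter (fun q => 2 ≤ (e q.1 ∩ e q.2).card)).card) := by
  have h1 : B.card ≤ ∑ a ∈ A, (P.filter (fun p => a ⊆ e p)).card := by
    refine le_trans (card_le_card ?_) (card_biUnion_le (s := A)
      (t := fun a => P.filter (fun p => a ⊆ e p)))
    intro p hp
    obtain ⟨a, ha, hap⟩ := hBA p hp
    simp only [mem_biUnion, mem_filter]
    exact ⟨a, ha, hB hp, hap⟩
  have h2 : (∑ a ∈ A, (P.filter (fun p => a ⊆ e p)).card) ^ 2 ≤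
      A.card * ∑ a ∈ A, (P.filter (fun p => a ⊆ e p)).card ^ 2 := sq_sum_le_card_mul_sum_sq
  have h3 : ∑ a ∈ A, (P.filter (fun p => a ⊆ e p)).card ^ 2 ≤
      2 ^ r * ((P ×ˢ P).filter (fun q => 2 ≤ (e q.1 ∩ e q.2).card)).card := by
    set D := (P ×ˢ P).filter (fun q => 2 ≤ (e q.1 ∩ e q.2).card) with hD
    calc _ ≤ ∑ a ∈ A, (D.filter (fun q => a ⊆ e q.1 ∩ e q.2)).card := by
          apply sum_le_sum
          intro a ha
          rw [sq, ← card_product]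
          apply card_le_card
          intro q hq
          simp only [mem_product, mem_filter] at hq
          have hs : a ⊆ e q.1 ∩ e q.2 := subset_inter hq.1.2 hq.2.2
          simp only [hD, mem_filter, mem_product]
          exact ⟨⟨⟨hq.1.1, hq.2.1⟩, (hA a ha).trans (card_le_card hs)⟩, hs⟩
      _ = ∑ q ∈ D, (A.filter (fun a => a ⊆ e q.1 ∩ e q.2)).card := by
          simp only [card_filter]
          exact sum_comm
      _ ≤ ∑ q ∈ D, 2 ^ r := by
          apply sum_le_sum
          intro q hq
          simp only [hD, mem_filter, mem_product] at hq
          rw [← he q.1 hq.1.1, ← card_powerset]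
          apply card_le_card
          intro a ha
          rw [mem_filter] at ha
          rw [mem_powerset]
          exact ha.2.trans inter_subset_left
      _ = _ := by rw [sum_const, smul_eq_mul, mul_comm]
  calc _ ≤ (∑ a ∈ A, (P.filter (fun p => a ⊆ e p)).card) ^ 2 := Nat.pow_le_pow_left h1 2
    _ ≤ _ := h2
    _ ≤ _ := Nat.mul_le_mul_left _ h3

/-- The edge associated with an embedding and a colouring. -/
def edge {X Y : Type} [Fintype X] [DecidableEq Y] {k : ℕ} (p : (X → Y) × (X → Fin k)) :
    Finset (Y × Fin k) := univ.image (fun x => (p.1 x, p.2 x))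

lemma edge_card {X Y : Type} [Fintype X] [DecidableEq Y] {k : ℕ} (p : (X → Y) × (X → Fin k))
    (h : Function.Injective p.1) : (edge p).card = Fintype.card X := by
  unfold edge
  rw [card_image_of_injective, card_univ]
  intro a b hab
  exact h (Prod.ext_iff.1 hab).1

lemma edge_inter {X Y : Type} [Fintype X] [DecidableEq Y] {k : ℕ} (p q : (X → Y) × (X → Fin k))
    (h : Function.Injective p.1) :
    (edge p ∩ edge q).card ≤ (Set.range p.1 ∩ Set.range q.1).ncard := by
  have hfin : (Set.range p.1 ∩ Set.range q.1).Finite := (Set.finite_range _).inter_of_left _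
  rw [Set.ncard_eq_toFinset_card _ hfin]
  apply card_le_card_of_injOn Prod.fst
  · intro z hz
    simp only [edge, coe_inter, coe_image, coe_univ, Set.image_univ, Set.mem_inter_iff,
      Set.mem_range] at hz
    obtain ⟨⟨x, hx⟩, ⟨x', hx'⟩⟩ := hz
    simp only [Set.Finite.coe_toFinset, Set.mem_inter_iff, Set.mem_range]
    exact ⟨⟨x, by rw [← hx]⟩, ⟨x', by rw [← hx']⟩⟩
  · intro z hz w hw hzw
    simp only [edge, coe_inter, coe_image, coe_univ, Set.image_univ, Set.mem_inter_iff,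
      Set.mem_range] at hz hw
    obtain ⟨⟨x, rfl⟩, _⟩ := hz
    obtain ⟨⟨x', rfl⟩, _⟩ := hw
    have := h hzw
    rw [this]

lemma pairs_le (Vs : SSEE) (N n : ℕ) :
    Set.ncard {p : (Vs.V N → Vs.V n) × (Vs.V N → Vs.V n) |
      p.1 ∈ Vs.emb N n ∧ p.2 ∈ Vs.emb N n ∧ 1 < (Set.range p.1 ∩ Set.range p.2).ncard} ≤
    Vs.interCount N n + (Vs.emb N n).ncard * Nat.card (Vs.V N) ^ Nat.card (Vs.V N) := by
  have := Vs.finV N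
  have := Vs.finV n
  set T : Set ((Vs.V N → Vs.V n) × (Vs.V N → Vs.V n)) :=
    (fun q : (Vs.V N → Vs.V n) × (Vs.V N → Vs.V N) => (q.1, q.1 ∘ q.2)) ''
      ((Vs.emb N n) ×ˢ Set.univ) with hT
  have hTc : T.ncard ≤ (Vs.emb N n).ncard * Nat.card (Vs.V N) ^ Nat.card (Vs.V N) := by
    refine (Set.ncard_image_le (Set.toFinite _)).trans ?_
    rw [Set.ncard_prod, Set.ncard_univ, Nat.card_fun]
  unfold SSEE.interCount
  refine le_trans (Set.ncard_le_ncard (t := {p : (Vs.V N → Vs.V n) × (Vs.V N → Vs.V n) |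
    p.1 ∈ Vs.emb N n ∧ p.2 ∈ Vs.emb N n ∧
    1 < (Set.range p.1 ∩ Set.range p.2).ncard ∧
    (Set.range p.1 ∩ Set.range p.2).ncard < Nat.card (Vs.V N)} ∪ T) ?_ (Set.toFinite _)) ?_
  · rintro ⟨φ, ψ⟩ ⟨h1, h2, h3⟩
    by_cases h : (Set.range φ ∩ Set.range ψ).ncard < Nat.card (Vs.V N)
    · exact Or.inl ⟨h1, h2, h3, h⟩
    · right
      push Not at h
      have hr : (Set.range ψ).ncard = Nat.card (Vs.V N) := by
        rw [← Set.image_univ, Set.ncard_image_of_injective _ (Vs.embInj N n ψ h2), Set.ncard_univ]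
      have he : Set.range φ ∩ Set.range ψ = Set.range ψ :=
        Set.eq_of_subset_of_ncard_le Set.inter_subset_right (by rw [hr]; exact h) (Set.toFinite _)
      have hsub : ∀ x, ∃ x', φ x' = ψ x := by
        intro x
        have : ψ x ∈ Set.range φ ∩ Set.range ψ := by rw [he]; exact ⟨x, rfl⟩
        exact this.1
      choose σ hσ using hsub
      refine ⟨(φ, σ), ⟨h1, Set.mem_univ _⟩, ?_⟩
      exact Prod.ext rfl (funext hσ)
  · exact (Set.ncard_union_le _ _).trans (Nat.add_le_add_left hTc _)

/-- The deterministic container statement for ssee. -/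
lemma ssee_det (Vs : SSEE) (k N n K : ℕ) (hK : 1 ≤ K) (F : Set (Vs.V N → Fin k))
    (x : ℝ) (hx0 : 0 < x) (hx1 : x ≤ 1) :
    ∃ T : Finset (Vs.V n → Finset (Fin k)),
      (∀ t ∈ T, ∀ x, (t x).Nonempty) ∧
      (∀ c ∈ Vs.Forb F n, ∃ t ∈ T, ∀ x, c x ∈ t x) ∧
      (∀ t ∈ T, (Nat.card (Vs.V N) ≤ 1 → Vs.badPairs t F = 0) ∧
        Vs.badPairs t F ^ 2 ≤
        (Nat.card (Vs.V n) * k) * ((Nat.card (Vs.V N) + 1) * K ^ Nat.card (Vs.V N)) *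
        (2 ^ Nat.card (Vs.V N) * ((k ^ Nat.card (Vs.V N)) ^ 2 * (Vs.interCount N n +
          (Vs.emb N n).ncard * Nat.card (Vs.V N) ^ Nat.card (Vs.V N))))) ∧
      (T.card : ℝ) ≤ Real.exp (x * (Nat.card (Vs.V n) * k : ℕ) +
        (Nat.card (Vs.V N) * 2 * 5 ^ Nat.card (Vs.V N) * ((Nat.card (Vs.V n) * k : ℕ) / K)) *
          Real.log (1 / x)) := by
  classical
  have := Vs.finV N
  have := Vs.finV n
  have := Vs.neV N
  have i1 : Fintype (Vs.V N) := Fintype.ofFinite _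
  have i2 : Fintype (Vs.V n) := Fintype.ofFinite _
  have hW : Fintype.card (Vs.V n × Fin k) = Nat.card (Vs.V n) * k := by
    rw [Fintype.card_prod, Fintype.card_fin, Nat.card_eq_fintype_card]
  have hr : 1 ≤ Nat.card (Vs.V N) := Nat.card_pos
  have hNr : Fintype.card (Vs.V N) = Nat.card (Vs.V N) := (Nat.card_eq_fintype_card).symm
  set r := Nat.card (Vs.V N) with hrdef
  set P : Finset ((Vs.V N → Vs.V n) × (Vs.V N → Fin k)) :=
    univ.filter (fun p => p.1 ∈ Vs.emb N n ∧ p.2 ∈ F) with hP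
  have hPc : ∀ p ∈ P, (edge p).card = r := by
    intro p hp
    simp only [hP, mem_filter, mem_univ, true_and] at hp
    rw [edge_card p (Vs.embInj N n p.1 hp.1), hNr]
  obtain ⟨Φ, hΦ, hΦ'⟩ := container hr hK (P.image edge) (by
    intro E hE
    obtain ⟨p, hp, rfl⟩ := mem_image.1 hE
    exact hPc p hp)
  rw [hW] at hΦ'
  set b : ℝ := r * 2 * 5 ^ r * ((Nat.card (Vs.V n) * k : ℕ) / K) with hb
  set tm : Finset (Vs.V n × Fin k) → Vs.V n → Finset (Fin k) :=
    fun S v => univ.filter (fun i => {(v, i)} ∉ Φ S) with htm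
  refine ⟨((univ.filter (fun S : Finset (Vs.V n × Fin k) => (S.card : ℝ) ≤ b)).image tm).filter
    (fun t => ∀ v, (t v).Nonempty), ?_, ?_, ?_, ?_⟩
  · intro t ht
    exact (mem_filter.1 ht).2
  · intro c hc
    obtain ⟨S, hS, hSI⟩ := hΦ' (univ.image (fun v => (v, c v))) (by
      intro E hE hEI
      obtain ⟨p, hp, rfl⟩ := mem_image.1 hE
      simp only [hP, mem_filter, mem_univ, true_and] at hp
      have hcp : c ∘ p.1 = p.2 := by
        funext z
        have h1 : (p.1 z, p.2 z) ∈ edge p := mem_image_of_mem _ (mem_univ z)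
        obtain ⟨v, _, hv⟩ := mem_image.1 (hEI h1)
        obtain ⟨h2, h3⟩ := Prod.ext_iff.1 hv
        simp only at h2 h3
        rw [Function.comp_apply, ← h2, h3]
      apply hc p.1 hp.1
      rw [hcp]
      exact hp.2)
    have hct : ∀ v, c v ∈ tm S v := by
      intro v
      simp only [htm, mem_filter, mem_univ, true_and]
      intro h
      exact hSI _ h (by simp)
    refine ⟨tm S, ?_, hct⟩
    rw [mem_filter]
    refine ⟨mem_image_of_mem _ (mem_filter.2 ⟨mem_univ _, hS⟩), fun v => ⟨c v, hct v⟩⟩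
  · intro t ht
    obtain ⟨S, _, rfl⟩ := mem_image.1 (mem_filter.1 ht).1
    set A := (Φ S).filter (fun a => 2 ≤ a.card) with hA
    set B := P.filter (fun p => ∀ z, p.2 z ∈ tm S (p.1 z)) with hB
    have hbad : Vs.badPairs (tm S) F = B.card := by
      unfold SSEE.badPairs
      rw [← Set.ncard_coe_finset]
      congr 1
      ext p
      simp only [hB, hP, coe_filter, mem_filter, mem_univ, true_and, Set.mem_ofPred_eq, and_assoc]
    have hBA : ∀ p ∈ B, ∃ a ∈ A, a ⊆ edge p := by
      intro p hp
      rw [hB, mem_filter] at hp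
      obtain ⟨a, ha, hae⟩ := (hΦ S).2 (edge p) (mem_image_of_mem _ hp.1)
      refine ⟨a, ?_, hae⟩
      rw [hA, mem_filter]
      refine ⟨ha, ?_⟩
      by_contra hlt
      have h1 := card_pos.2 ((hΦ S).1.ne a ha)
      obtain ⟨w, rfl⟩ := card_eq_one.1 (show a.card = 1 by omega)
      rw [singleton_subset_iff] at hae
      obtain ⟨z, _, rfl⟩ := mem_image.1 hae
      have := hp.2 z
      simp only [htm, mem_filter, mem_univ, true_and] at this
      exact this ha
    rw [hbad]
    constructor
    · intro hr1
      rw [card_eq_zero, eq_empty_iff_forall_notMem]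
      intro p hp
      obtain ⟨a, ha, _⟩ := hBA p hp
      rw [hA, mem_filter] at ha
      have := (hΦ S).1.le a ha.1
      omega
    · refine (count_bad r P B edge hPc A (fun a ha => (mem_filter.1 ha).2)
        (filter_subset _ _) hBA).trans ?_
      have hAc : A.card ≤ Nat.card (Vs.V n) * k * ((r + 1) * K ^ r) := by
        rw [← hW]
        exact (card_filter_le _ _).trans (fin_card hK (hΦ S).1)
      refine Nat.mul_le_mul hAc (Nat.mul_le_mul_left _ ?_)
      set D : Set ((Vs.V N → Vs.V n) × (Vs.V N → Vs.V n)) := {p |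
        p.1 ∈ Vs.emb N n ∧ p.2 ∈ Vs.emb N n ∧ 1 < (Set.range p.1 ∩ Set.range p.2).ncard} with hD
      have hDc := pairs_le Vs N n
      rw [← hD] at hDc
      have hDf : D.Finite := Set.toFinite _
      calc _ ≤ ((univ : Finset ((Vs.V N → Fin k) × (Vs.V N → Fin k))) ×ˢ hDf.toFinset).card := by
            apply card_le_card_of_injOn (fun q => ((q.1.2, q.2.2), (q.1.1, q.2.1)))
            · intro q hq
              simp only [coe_filter, mem_product, Set.mem_ofPred_eq, hP, mem_filter, mem_univ,
                true_and] at hq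
              simp only [coe_product, coe_univ, Set.Finite.coe_toFinset, Set.mem_prod,
                Set.mem_univ, true_and]
              refine ⟨hq.1.1.1, hq.1.2.1, ?_⟩
              exact lt_of_lt_of_le hq.2 (edge_inter _ _ (Vs.embInj N n _ hq.1.1.1))
            · intro q _ q' _ h
              simp only [Prod.mk.injEq] at h
              exact Prod.ext (Prod.ext h.2.1 h.1.1) (Prod.ext h.2.2 h.1.2)
        _ = (k ^ r) ^ 2 * D.ncard := by
            rw [card_product, ← Set.ncard_eq_toFinset_card D hDf, card_univ, Fintype.card_prod,
              Fintype.card_fun, Fintype.card_fin, hNr, sq]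
        _ ≤ _ := Nat.mul_le_mul_left _ hDc
  · refine le_trans ?_ ((small_sets (α := Vs.V n × Fin k) hx0 hx1 b (by positivity)).trans ?_)
    · exact_mod_cast (card_filter_le _ _).trans card_image_le
    · rw [hW]

end Cont

/-- Container theorem for good set-sequences equipped with embeddings (Theorem 3.10). -/
theorem ssee_containers (Vs : SSEE) (hgood : Vs.Good) (k N : ℕ) (hk : 2 ≤ k)
    (F : Set (Vs.V N → Fin k)) (hF : F.Nonempty) (ε : ℝ) (hε : 0 < ε) :
    ∃ n₀ : ℕ, ∀ n, n₀ ≤ n → ∃ T : Finset (Vs.V n → Finset (Fin k)),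
      (∀ t ∈ T, ∀ x, (t x).Nonempty) ∧
      (∀ c ∈ Vs.Forb F n, ∃ t ∈ T, ∀ x, c x ∈ t x) ∧
      (∀ t ∈ T, (Vs.badPairs t F : ℝ) ≤ ε * ((Vs.emb N n).ncard : ℝ)) ∧
      (T.card : ℝ) ≤ (k : ℝ) ^ (ε * (Nat.card (Vs.V n) : ℝ)) := by
  have hk0 : (0:ℝ) < k := by positivity
  have hlog : 0 < Real.log k := Real.log_pos (by exact_mod_cast hk)
  set r := Nat.card (Vs.V N) with hr
  set x : ℝ := min 1 (ε * Real.log k / (2 * k)) with hx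
  have hx0 : 0 < x := lt_min one_pos (by positivity)
  have hx1 : x ≤ 1 := min_le_left _ _
  have hx2 : x * k ≤ ε * Real.log k / 2 := by
    calc x * k ≤ ε * Real.log k / (2 * k) * k := by gcongr; exact min_le_right _ _
      _ = _ := by field_simp
  have hlx : 0 ≤ Real.log (1 / x) := Real.log_nonneg (by rw [le_div_iff₀ hx0]; linarith)
  obtain ⟨K, hK⟩ := exists_nat_ge
    (max 1 ((r * 2 * 5 ^ r * k * Real.log (1 / x)) / (ε * Real.log k / 2)))
  have hK1 : 1 ≤ K := by exact_mod_cast (le_max_left _ _).trans hK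
  have hKpos : (0:ℝ) < K := by exact_mod_cast hK1
  have hK2 : r * 2 * 5 ^ r * k * Real.log (1 / x) / K ≤ ε * Real.log k / 2 := by
    have h := (le_max_right _ _).trans hK
    rw [div_le_iff₀ (by positivity)] at h
    rw [div_le_iff₀ hKpos]
    linarith
  set M : ℝ := k * ((r + 1) * K ^ r) * (2 ^ r * (k ^ r) ^ 2) with hM
  have hMpos : 0 < M := by positivity
  have hmain : ∃ n₀ : ℕ, ∀ n, n₀ ≤ n → ∀ b : ℕ, (r ≤ 1 → b = 0) →
      b ^ 2 ≤ (Nat.card (Vs.V n) * k) * ((r + 1) * K ^ r) *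
        (2 ^ r * ((k ^ r) ^ 2 * (Vs.interCount N n + (Vs.emb N n).ncard * r ^ r))) →
      (b : ℝ) ≤ ε * ((Vs.emb N n).ncard : ℝ) := by
    by_cases h1 : r ≤ 1
    · refine ⟨0, fun n _ b hb _ => ?_⟩
      rw [hb h1, Nat.cast_zero]
      positivity
    push Not at h1
    obtain ⟨_, hg2, hg3⟩ := hgood
    have e1 := (hg2 N h1).eventually_ge_atTop (2 * M * r ^ r / ε ^ 2)
    have e1' := (hg2 N h1).eventually_gt_atTop 0
    have e2 := (hg3 N h1).eventually_le_const (show (0:ℝ) < ε ^ 2 / (2 * M) by positivity)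
    obtain ⟨n₀, hn₀⟩ := eventually_atTop.1 (e1.and (e1'.and e2))
    refine ⟨n₀, fun n hn b _ hb => ?_⟩
    obtain ⟨f1, f0, f2⟩ := hn₀ n hn
    have := Vs.finV n
    have := Vs.neV n
    have hv : (0:ℝ) < Nat.card (Vs.V n) := by exact_mod_cast Nat.card_pos
    set v : ℝ := (Nat.card (Vs.V n) : ℝ) with hvdef
    set e : ℝ := ((Vs.emb N n).ncard : ℝ) with hedef
    set i : ℝ := (Vs.interCount N n : ℝ) with hidef
    have he : 0 < e := by
      by_contra hcon
      push Not at hcon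
      exact absurd f0 (not_lt.2 (div_nonpos_of_nonpos_of_nonneg hcon hv.le))
    have hb' : (b:ℝ) ^ 2 ≤ (v * k) * ((r + 1) * K ^ r) *
        (2 ^ r * ((k ^ r) ^ 2 * (i + e * r ^ r))) := by
      rw [hvdef, hedef, hidef]
      exact_mod_cast hb
    have hb2 : (b:ℝ) ^ 2 ≤ M * (v * i) + M * r ^ r * v * e := by
      refine hb'.trans (le_of_eq ?_)
      rw [hM]; ring
    rw [div_le_div_iff₀ (by positivity) hv] at f1
    rw [div_le_div_iff₀ (by positivity) (by positivity)] at f2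
    have g : (b:ℝ) ^ 2 ≤ (ε * e) ^ 2 := by
      have f1' := mul_le_mul_of_nonneg_right f1 he.le
      nlinarith
    exact (pow_le_pow_iff_left₀ (by positivity) (by positivity) two_ne_zero).1 g
  obtain ⟨n₀, hn₀⟩ := hmain
  refine ⟨n₀, fun n hn => ?_⟩
  obtain ⟨T, hT1, hT2, hT3, hT4⟩ := Cont.ssee_det Vs k N n K hK1 F x hx0 hx1
  refine ⟨T, hT1, hT2, fun t ht => hn₀ n hn _ (hT3 t ht).1 (hT3 t ht).2, hT4.trans ?_⟩
  rw [Real.rpow_def_of_pos hk0, Real.exp_le_exp]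
  push_cast
  rw [← hr]
  have hv : (0:ℝ) ≤ Nat.card (Vs.V n) := by positivity
  have h1 := mul_le_mul_of_nonneg_right (add_le_add hx2 hK2) hv
  refine le_trans (le_of_eq ?_) (h1.trans (le_of_eq ?_))
  · field_simp
  · ring
end

section
/- Alekseev–Bollobás–Thomason theorem: If P is a hereditary property of graphs with colouring number χ_c(P) = r (where 1 ≤ r < ∞), then lim_{n→∞} log₂|P_n| / C(n,2) = 1 − 1/r. -/
open Filter

/-- A graph property (closed under isomorphism) is hereditary if it is symmetric and
closed under taking induced subgraphs; equivalently, it is closed under pulling back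
along arbitrary injections of vertex sets. -/
def GraphHereditary (P : ∀ n, Set (SimpleGraph (Fin n))) : Prop :=
  ∀ (m n : ℕ) (f : Fin m ↪ Fin n) (G : SimpleGraph (Fin n)),
    G ∈ P n → G.comap f ∈ P m

/-- `G` belongs to the class `H(r, v)`: its vertex set can be partitioned into `r` parts,
the `i`-th part inducing a complete graph if `v i = true` and an empty graph if
`v i = false` (edges between different parts being arbitrary). -/
def InH {r m : ℕ} (v : Fin r → Bool) (G : SimpleGraph (Fin m)) : Prop :=
  ∃ f : Fin m → Fin r, ∀ x y : Fin m, x ≠ y → f x = f y → (G.Adj x y ↔ v (f x) = true)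



open Finset Classical in
theorem abt_embed {ι V : Type} [Nonempty V] (R : ι → ι → V → V → Prop)
    (hsym : ∀ x y a b, R x y a b → R y x b a) (δ : ℝ) (hδ : 0 < δ) (hδ1 : δ ≤ 1) (M : ℕ)
    (t : ι → ℝ) (ht : ∀ x, 0 < t x) :
    ∀ S : Finset ι, #S ≤ M → ∀ A : ι → Finset V,
      (∀ x ∈ S, M * t x ≤ δ ^ #S * #(A x)) →
      (∀ x ∈ S, ∀ y ∈ S, x ≠ y → ∀ A' ⊆ A x, ∀ B' ⊆ A y, t x ≤ #A' → t y ≤ #B' →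
        ∃ a ∈ A', δ * #B' ≤ #{b ∈ B' | R x y a b}) →
      ∃ φ : ι → V, (∀ x ∈ S, φ x ∈ A x) ∧
        ∀ x ∈ S, ∀ y ∈ S, x ≠ y → R x y (φ x) (φ y) := by
  intro S
  induction S using Finset.induction_on with
  | empty =>
    intro _ A _ _
    exact ⟨fun _ => Classical.arbitrary V, by simp, by simp⟩
  | insert x₀ S hx ih =>
    intro hM A hA hg
    rw [card_insert_of_notMem hx] at hM hA
    have hM1 : (1 : ℝ) ≤ M := by exact_mod_cast (by omega : 1 ≤ M)
    have hbig : ∀ x ∈ insert x₀ S, M * t x ≤ #(A x) := by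
      intro x hxS
      refine (hA x hxS).trans ?_
      have : δ ^ (#S + 1) ≤ 1 := pow_le_one₀ hδ.le hδ1
      nlinarith [(Nat.cast_nonneg #(A x) : (0:ℝ) ≤ _)]
    -- bad sets
    let B : ι → Finset V := fun y => {a ∈ A x₀ | ((#{b ∈ A y | R x₀ y a b} : ℕ) : ℝ) < δ * #(A y)}
    have hB : ∀ y ∈ S, (#(B y) : ℝ) ≤ t x₀ := by
      intro y hy
      by_contra hlt
      push Not at hlt
      have hne : x₀ ≠ y := fun h => hx (h ▸ hy)
      obtain ⟨a, ha, hab⟩ := hg x₀ (mem_insert_self _ _) y (mem_insert_of_mem hy) hne (B y)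
        (filter_subset _ _) (A y) (Subset.refl _) hlt.le (by
          refine le_trans ?_ (hbig y (mem_insert_of_mem hy))
          nlinarith [ht y])
      have := (mem_filter.1 ha).2
      linarith
    have hU : #(S.biUnion B) < #(A x₀) := by
      have h1 : (#(S.biUnion B) : ℝ) ≤ ∑ y ∈ S, (#(B y) : ℝ) := by exact_mod_cast card_biUnion_le
      have h2 : ∑ y ∈ S, (#(B y) : ℝ) ≤ #S * t x₀ := by
        simpa using sum_le_sum hB
      have h3 : (#S : ℝ) * t x₀ < M * t x₀ := by
        have : (#S : ℝ) < M := by exact_mod_cast (by omega : #S < M)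
        exact mul_lt_mul_of_pos_right this (ht _)
      have h4 := hbig x₀ (mem_insert_self _ _)
      exact_mod_cast (by linarith : (#(S.biUnion B) : ℝ) < #(A x₀))
    obtain ⟨a, haA, haB⟩ := exists_mem_notMem_of_card_lt_card hU
    have hgood : ∀ y ∈ S, δ * #(A y) ≤ #{b ∈ A y | R x₀ y a b} := by
      intro y hy
      by_contra hlt
      push Not at hlt
      exact haB (mem_biUnion.2 ⟨y, hy, mem_filter.2 ⟨haA, hlt⟩⟩)
    obtain ⟨φ, hφ1, hφ2⟩ := ih (by omega) (fun y => {b ∈ A y | R x₀ y a b}) (by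
        intro y hy
        refine (hA y (mem_insert_of_mem hy)).trans ?_
        have := hgood y hy
        rw [pow_succ, mul_assoc]
        gcongr)
      (by
        intro x hxS y hyS hxy A' hA' B' hB'
        exact hg x (mem_insert_of_mem hxS) y (mem_insert_of_mem hyS) hxy A'
          (hA'.trans (filter_subset _ _)) B' (hB'.trans (filter_subset _ _)))
    have hne : ∀ y ∈ S, y ≠ x₀ := fun y hy h => hx (h ▸ hy)
    refine ⟨Function.update φ x₀ a, ?_, ?_⟩
    · intro x hxS
      rcases mem_insert.1 hxS with rfl | h
      · simpa using haA
      · rw [Function.update_of_ne (hne x h)]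
        exact (mem_filter.1 (hφ1 x h)).1
    · intro x hxS y hyS hxy
      rcases mem_insert.1 hxS with rfl | h <;> rcases mem_insert.1 hyS with rfl | h'
      · exact (hxy rfl).elim
      · rw [Function.update_self, Function.update_of_ne (hne y h')]
        exact (mem_filter.1 (hφ1 y h')).2
      · rw [Function.update_self, Function.update_of_ne (hne x h)]
        exact hsym _ _ _ _ (mem_filter.1 (hφ1 x h)).2
      · rw [Function.update_of_ne (hne x h), Function.update_of_ne (hne y h')]
        exact hφ2 x h y h' hxy

open Finset Classical in
theorem abt_ramsey (a b : ℕ) : ∃ N : ℕ, ∀ {V : Type} (c : V → V → Prop)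
    (_ : ∀ x y, c x y → c y x) (S : Finset V), N ≤ #S →
    (∃ T ⊆ S, #T = a ∧ ∀ x ∈ T, ∀ y ∈ T, x ≠ y → c x y) ∨
    (∃ T ⊆ S, #T = b ∧ ∀ x ∈ T, ∀ y ∈ T, x ≠ y → ¬ c x y) := by
  obtain ⟨n, hn⟩ : ∃ n, a + b = n := ⟨_, rfl⟩
  induction n generalizing a b with
  | zero => exact ⟨0, fun c _ S _ => Or.inl ⟨∅, by simp, by simp; omega, by simp⟩⟩
  | succ n ih =>
    rcases Nat.eq_zero_or_pos a with rfl | ha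
    · exact ⟨0, fun c _ S _ => Or.inl ⟨∅, by simp, by simp, by simp⟩⟩
    rcases Nat.eq_zero_or_pos b with rfl | hb
    · exact ⟨0, fun c _ S _ => Or.inr ⟨∅, by simp, by simp, by simp⟩⟩
    obtain ⟨N₁, h₁⟩ := ih (a - 1) b (by omega)
    obtain ⟨N₂, h₂⟩ := ih a (b - 1) (by omega)
    refine ⟨N₁ + N₂ + 1, fun {V} c hc S hS => ?_⟩
    obtain ⟨x, hx⟩ : S.Nonempty := card_pos.1 (by omega)
    have hcard := card_filter_add_card_filter_not (s := S.erase x) (fun y => c x y)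
    rw [card_erase_of_mem hx] at hcard
    have hsub : ∀ (q : V → Prop) [DecidablePred q], (S.erase x).filter q ⊆ S := fun q _ =>
      (filter_subset _ _).trans (erase_subset _ _)
    by_cases hN : N₁ ≤ #((S.erase x).filter (fun y => c x y))
    · rcases h₁ c hc _ hN with ⟨T, hT, hTc, hTT⟩ | ⟨T, hT, hTc, hTT⟩
      · have hxT : x ∉ T := fun h => by simpa using hT h
        refine Or.inl ⟨insert x T, insert_subset hx (hT.trans (hsub _)), ?_, ?_⟩
        · rw [card_insert_of_notMem hxT]; omega
        · intro y hy z hz hyz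
          rcases mem_insert.1 hy with rfl | hy' <;> rcases mem_insert.1 hz with rfl | hz'
          · exact (hyz rfl).elim
          · exact (mem_filter.1 (hT hz')).2
          · exact hc _ _ (mem_filter.1 (hT hy')).2
          · exact hTT y hy' z hz' hyz
      · exact Or.inr ⟨T, hT.trans (hsub _), hTc, hTT⟩
    · rcases h₂ c hc ((S.erase x).filter (fun y => ¬ c x y)) (by omega) with
        ⟨T, hT, hTc, hTT⟩ | ⟨T, hT, hTc, hTT⟩
      · exact Or.inl ⟨T, hT.trans (hsub _), hTc, hTT⟩
      · have hxT : x ∉ T := fun h => by simpa using hT h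
        refine Or.inr ⟨insert x T, insert_subset hx (hT.trans (hsub _)), ?_, ?_⟩
        · rw [card_insert_of_notMem hxT]; omega
        · intro y hy z hz hyz
          rcases mem_insert.1 hy with rfl | hy' <;> rcases mem_insert.1 hz with rfl | hz'
          · exact (hyz rfl).elim
          · exact (mem_filter.1 (hT hz')).2
          · exact fun h => (mem_filter.1 (hT hy')).2 (hc _ _ h)
          · exact hTT y hy' z hz' hyz


open Finset Classical in
theorem abt_erdosStone (r : ℕ) (hr : 1 ≤ r) (η : ℝ) (hη : 0 < η) (t : ℕ) :
    ∃ M₀ : ℕ, ∀ M ≥ M₀, ∀ G : SimpleGraph (Fin M),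
      (1 - 1 / (r:ℝ) + η) * (M:ℝ) ^ 2 ≤ #{p : Fin M × Fin M | G.Adj p.1 p.2} →
      SimpleGraph.IsContained (SimpleGraph.completeEquipartiteGraph (r + 1) t) G := by
  obtain ⟨n₀, hn₀⟩ := eventually_atTop.1
    (SimpleGraph.eventually_completeEquipartiteGraph_isContained_of_minDegree
      (ε := η / 4) (by positivity) r t)
  obtain ⟨K, hK⟩ := exists_nat_gt (((n₀ : ℝ) + 2 / η + 1) ^ 2 * (2 / η))
  refine ⟨K + 1, fun M hM G hG => ?_⟩
  have hMK : (K : ℝ) + 1 ≤ M := by exact_mod_cast hM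
  have hK0 : (0:ℝ) ≤ K := by positivity
  have hr' : (0:ℝ) ≤ 1 - 1 / (r:ℝ) := by
    have : (1:ℝ) ≤ r := by exact_mod_cast hr
    have : 1 / (r:ℝ) ≤ 1 := by rw [div_le_one (by linarith)]; exact this
    linarith
  set c : ℝ := 1 - 1 / (r:ℝ) + η / 2 with hc
  let N : Finset (Fin M) → ℝ := fun S => ∑ x ∈ S, ∑ y ∈ S, if G.Adj x y then (1:ℝ) else 0
  have hNle : ∀ S, N S ≤ (#S : ℝ) ^ 2 := by
    intro S
    calc N S ≤ ∑ x ∈ S, ∑ y ∈ S, (1:ℝ) := by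
          apply sum_le_sum; intro x _; apply sum_le_sum; intro y _; split_ifs <;> norm_num
      _ = (#S : ℝ) ^ 2 := by simp [sq]
  have hNuniv : N univ = #{p : Fin M × Fin M | G.Adj p.1 p.2} := by
    simp only [N]
    rw [← sum_product', card_filter]
    push_cast
    rfl
  obtain ⟨S, -, hS⟩ := exists_max_image (univ : Finset (Finset (Fin M)))
    (fun S => N S - c * (#S : ℝ) ^ 2) ⟨∅, mem_univ _⟩
  have h1 : η / 2 * (M:ℝ) ^ 2 ≤ N S - c * (#S : ℝ) ^ 2 := by
    refine le_trans ?_ (hS univ (mem_univ _))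
    rw [hNuniv, card_univ, Fintype.card_fin, hc]
    linarith
  have hc1 : c ≤ 1 := by
    have h2 := hNle univ
    rw [hNuniv, card_univ, Fintype.card_fin] at h2
    have h3 := hG.trans h2
    have h4 : (0:ℝ) < (M:ℝ) ^ 2 := by
      have : (0:ℝ) < M := by linarith
      positivity
    have : 1 - 1 / (r:ℝ) + η ≤ 1 := by
      by_contra h; push Not at h; nlinarith
    linarith
  have hs : (n₀ : ℝ) + 2 / η + 1 ≤ #S := by
    have h2 := hNle S
    have h3 : η / 2 * (M:ℝ) ^ 2 ≤ (#S : ℝ) ^ 2 := by nlinarith [sq_nonneg (#S : ℝ)]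
    have h4 : (K:ℝ) ≤ (M:ℝ) ^ 2 := by nlinarith
    have h5 : ((n₀ : ℝ) + 2 / η + 1) ^ 2 ≤ (#S : ℝ) ^ 2 := by
      refine le_trans ?_ h3
      have : ((n₀ : ℝ) + 2 / η + 1) ^ 2 = η / 2 * (((n₀ : ℝ) + 2 / η + 1) ^ 2 * (2 / η)) := by
        field_simp
      rw [this]
      have := hK.le.trans h4
      gcongr
    exact le_of_sq_le_sq h5 (by positivity)
  have hdeg : ∀ v ∈ S, (1 - 1 / (r:ℝ) + η / 4) * #S ≤ #{y ∈ S | G.Adj v y} := by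
    intro v hv
    have h2 := hS (S.erase v) (mem_univ _)
    have h3 : N S = N (S.erase v) + 2 * #{y ∈ S | G.Adj v y} := by
      have hd : (#{y ∈ S | G.Adj v y} : ℝ) = ∑ y ∈ S.erase v, if G.Adj v y then (1:ℝ) else 0 := by
        rw [sum_erase S (a := v) (f := fun y => if G.Adj v y then (1:ℝ) else 0) (by simp)]
        simp
      have hd' : (#{y ∈ S | G.Adj v y} : ℝ) = ∑ y ∈ S.erase v, if G.Adj y v then (1:ℝ) else 0 := by
        rw [hd]; simp only [G.adj_comm]
      simp only [N]
      conv_lhs => rw [← insert_erase hv]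
      rw [sum_insert (notMem_erase _ _), sum_insert (notMem_erase _ _)]
      have : ∀ x ∈ S.erase v, (∑ y ∈ insert v (S.erase v), if G.Adj x y then (1:ℝ) else 0)
          = (if G.Adj x v then (1:ℝ) else 0) + ∑ y ∈ S.erase v, if G.Adj x y then (1:ℝ) else 0 :=
        fun x _ => sum_insert (notMem_erase _ _)
      rw [sum_congr rfl this, sum_add_distrib, ← hd, ← hd']
      simp; ring
    have h4 : (#(S.erase v) : ℝ) = #S - 1 := by
      rw [card_erase_of_mem hv, Nat.cast_sub (card_pos.2 ⟨v, hv⟩)]; simp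
    rw [h3, h4] at h2
    have h5 : 2 ≤ η * #S := by
      have : 2 / η ≤ #S := by linarith [(Nat.cast_nonneg n₀ : (0:ℝ) ≤ _)]
      rwa [div_le_iff₀ hη, mul_comm] at this
    rw [hc] at h2 hc1
    nlinarith
  let e := S.orderEmbOfFin rfl
  have hle : SimpleGraph.IsContained (SimpleGraph.completeEquipartiteGraph (r + 1) t) (G.comap e) := by
    apply hn₀ #S
    · have : (n₀ : ℝ) ≤ #S := by
        have : 0 < 2 / η := by positivity
        linarith
      exact_mod_cast this
    · have hne : Nonempty (Fin #S) := by
        refine ⟨⟨0, ?_⟩⟩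
        have : (0 : ℝ) < #S := by
          have : 0 < 2 / η := by positivity
          linarith [(Nat.cast_nonneg n₀ : (0:ℝ) ≤ _)]
        exact_mod_cast this
      obtain ⟨v, hv⟩ := (G.comap e).exists_minimal_degree_vertex
      rw [hv]
      refine (hdeg (e v) (S.orderEmbOfFin_mem rfl v)).trans ?_
      have : {y ∈ S | G.Adj (e v) y} = ((G.comap e).neighborFinset v).map e.toEmbedding := by
        ext y
        simp only [mem_filter, Finset.mem_map, SimpleGraph.mem_neighborFinset, SimpleGraph.comap_adj]
        constructor
        · rintro ⟨hy, hy'⟩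
          have : y ∈ Set.range e := by
            rw [Finset.range_orderEmbOfFin]; exact hy
          obtain ⟨z, rfl⟩ := this
          exact ⟨z, hy', rfl⟩
        · rintro ⟨z, hz, rfl⟩
          exact ⟨S.orderEmbOfFin_mem rfl z, hz⟩
      rw [this, card_map, SimpleGraph.card_neighborFinset_eq_degree]
  exact hle.trans ⟨(SimpleGraph.Embedding.comap e.toEmbedding G).toCopy⟩

open Finset Classical in
theorem abt_count_fun {M k : ℕ} (i j : Fin M) (hij : i ≠ j) (Q : Fin k → Fin k → Prop) :
    (k:ℝ) ^ 2 * #{φ : Fin M → Fin k | Q (φ i) (φ j)} =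
      #{p : Fin k × Fin k | Q p.1 p.2} * (k:ℝ) ^ M := by
  have h1 : ∀ a b : Fin k, k ^ 2 * #{φ : Fin M → Fin k | φ i = a ∧ φ j = b} = k ^ M := by
    intro a b
    have : ({φ : Fin M → Fin k | φ i = a ∧ φ j = b} : Finset _) =
        Fintype.piFinset (fun l => if l = i then {a} else if l = j then {b} else univ) := by
      ext φ
      simp only [mem_filter, mem_univ, true_and, Fintype.mem_piFinset]
      constructor
      · rintro ⟨rfl, rfl⟩ l
        split_ifs with h h'
        · simp [h]
        · simp [h']
        · simp
      · intro h
        have hi := h i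
        have hj := h j
        rw [if_pos rfl] at hi
        rw [if_neg hij.symm, if_pos rfl] at hj
        exact ⟨by simpa using hi, by simpa using hj⟩
    rw [this, Fintype.card_piFinset]
    have h2 : k ^ 2 = ∏ l : Fin M, ((if l = i then k else 1) * (if l = j then k else 1)) := by
      rw [prod_mul_distrib]; simp [sq]
    rw [h2, ← prod_mul_distrib]
    have h3 : ∀ l ∈ (univ : Finset (Fin M)), ((if l = i then k else 1) * (if l = j then k else 1)) *
        #(if l = i then ({a} : Finset (Fin k)) else if l = j then {b} else univ) = k := by
      intro l _
      by_cases h : l = i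
      · have : l ≠ j := fun h' => hij (h.symm.trans h')
        simp [h, hij]
      · by_cases h' : l = j
        · simp [h', hij.symm]
        · simp [h, h']
    rw [prod_congr rfl h3]; simp
  have h2 : #{φ : Fin M → Fin k | Q (φ i) (φ j)} =
      ∑ p ∈ ({p : Fin k × Fin k | Q p.1 p.2} : Finset _),
        #{φ : Fin M → Fin k | φ i = p.1 ∧ φ j = p.2} := by
    rw [card_eq_sum_card_fiberwise (f := fun φ : Fin M → Fin k => (φ i, φ j))
      (t := ({p : Fin k × Fin k | Q p.1 p.2} : Finset _))]
    · apply sum_congr rfl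
      intro p hp
      congr 1
      ext φ
      simp only [mem_filter, mem_univ, true_and] at hp ⊢
      constructor
      · rintro ⟨_, rfl⟩; exact ⟨rfl, rfl⟩
      · rintro ⟨h1, h2⟩; exact ⟨by rw [h1, h2]; exact hp, by ext1 <;> assumption⟩
    · intro φ hφ
      simpa using hφ
  have h3 : k ^ 2 * #{φ : Fin M → Fin k | Q (φ i) (φ j)} =
      #{p : Fin k × Fin k | Q p.1 p.2} * k ^ M := by
    rw [h2, mul_sum, sum_congr rfl (fun p _ => h1 p.1 p.2)]; simp
  exact_mod_cast h3

open Finset Classical in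
theorem abt_average (r : ℕ) (hr : 1 ≤ r) (η : ℝ) (hη : 0 < η) (t : ℕ) :
    ∃ ε > (0:ℝ), ∃ k₀ : ℕ, ∀ k ≥ k₀, ∀ Gr Reg : SimpleGraph (Fin k),
      (#{p : Fin k × Fin k | p.1 ≠ p.2 ∧ ¬ Reg.Adj p.1 p.2} : ℝ) ≤ ε * (k:ℝ) ^ 2 →
      (1 - 1 / (r:ℝ) + η) * (k:ℝ) ^ 2 ≤ #{p : Fin k × Fin k | Gr.Adj p.1 p.2} →
      ∃ ψ : Fin (r + 1) × Fin t → Fin k, (∀ p q, p ≠ q → Reg.Adj (ψ p) (ψ q)) ∧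
        ∀ p q, p.1 ≠ q.1 → Gr.Adj (ψ p) (ψ q) := by
  obtain ⟨M₀, hM₀⟩ := abt_erdosStone r hr (η / 2) (by positivity) t
  obtain ⟨M₁, hM₁⟩ := exists_nat_gt (4 * (1 + η) / η)
  obtain ⟨M, hMdef⟩ : ∃ M, M = M₀ + M₁ + 1 := ⟨_, rfl⟩
  have hM1 : (1:ℝ) ≤ M := by exact_mod_cast (by omega : 1 ≤ M)
  have hMη : 4 * (1 + η) ≤ M * η := by
    rw [div_lt_iff₀ hη] at hM₁
    have : (M₁:ℝ) ≤ M := by exact_mod_cast (by omega : M₁ ≤ M)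
    nlinarith
  obtain ⟨k₁, hk₁⟩ := exists_nat_gt (8 * (M:ℝ) ^ 2 / η)
  refine ⟨η / (8 * (M:ℝ) ^ 2), by positivity, k₁ + 1, fun k hk Gr Reg hReg hGr => ?_⟩
  have hr' : (0:ℝ) ≤ 1 - 1 / (r:ℝ) ∧ 1 - 1 / (r:ℝ) ≤ 1 := by
    have : (1:ℝ) ≤ r := by exact_mod_cast hr
    have h : 1 / (r:ℝ) ≤ 1 := by rw [div_le_one (by linarith)]; exact this
    have h' : 0 ≤ 1 / (r:ℝ) := by positivity
    constructor <;> linarith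
  set c : ℝ := 1 - 1 / (r:ℝ) with hc
  have hkpos : (0:ℝ) < k := by exact_mod_cast (by omega : 0 < k)
  have hkη : 8 * (M:ℝ) ^ 2 ≤ k * η := by
    rw [div_lt_iff₀ hη] at hk₁
    have : (k₁:ℝ) ≤ k := by exact_mod_cast (by omega : k₁ ≤ k)
    nlinarith
  let D : Finset (Fin M × Fin M) := (univ : Finset (Fin M)).offDiag
  have hD : (#D : ℝ) = (M:ℝ) ^ 2 - M := by
    simp only [D, offDiag_card, card_univ, Fintype.card_fin]
    rw [Nat.cast_sub (by nlinarith [(by omega : 1 ≤ M)])]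
    push_cast; ring
  have hDsum : ∀ Q : Fin k → Fin k → Prop,
      (k:ℝ) ^ 2 * ∑ φ : Fin M → Fin k, (#{p ∈ D | Q (φ p.1) (φ p.2)} : ℝ) =
        #D * (#{p : Fin k × Fin k | Q p.1 p.2} * (k:ℝ) ^ M) := by
    intro Q
    have : ∑ φ : Fin M → Fin k, (#{p ∈ D | Q (φ p.1) (φ p.2)} : ℝ) =
        ∑ p ∈ D, (#{φ : Fin M → Fin k | Q (φ p.1) (φ p.2)} : ℝ) := by
      simp only [card_filter]
      push_cast
      rw [sum_comm]
    rw [this, mul_sum, sum_congr rfl (fun p hp => abt_count_fun p.1 p.2 (mem_offDiag.1 hp).2.2 Q)]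
    rw [sum_const, nsmul_eq_mul]
  have hX := hDsum Gr.Adj
  have hY : (k:ℝ) ^ 2 * ∑ φ : Fin M → Fin k, (#{p ∈ D | ¬ Reg.Adj (φ p.1) (φ p.2)} : ℝ) =
        #D * (#{p : Fin k × Fin k | ¬ Reg.Adj p.1 p.2} * (k:ℝ) ^ M) := by
    convert hDsum (fun a b => ¬ Reg.Adj a b)
  have hbad : (#{p : Fin k × Fin k | ¬ Reg.Adj p.1 p.2} : ℝ) ≤ η / (4 * (M:ℝ) ^ 2) * (k:ℝ) ^ 2 := by
    have h1 : ({p : Fin k × Fin k | ¬ Reg.Adj p.1 p.2} : Finset _) ⊆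
        ({p : Fin k × Fin k | p.1 ≠ p.2 ∧ ¬ Reg.Adj p.1 p.2} : Finset _) ∪
          (univ : Finset (Fin k)).image (fun a => (a, a)) := by
      rintro ⟨a, b⟩ h
      simp only [mem_filter, mem_univ, true_and, mem_union, mem_image] at h ⊢
      by_cases hab : a = b
      · right; exact ⟨a, by rw [hab]⟩
      · left; exact ⟨hab, h⟩
    have h2 := (card_le_card h1).trans (card_union_le _ _)
    have h3 : #((univ : Finset (Fin k)).image (fun a => (a, a))) ≤ k := by
      refine card_image_le.trans ?_; simp
    have h4 : (#{p : Fin k × Fin k | ¬ Reg.Adj p.1 p.2} : ℝ) ≤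
        #{p : Fin k × Fin k | p.1 ≠ p.2 ∧ ¬ Reg.Adj p.1 p.2} + k := by
      have h2' := (Nat.cast_le (α := ℝ)).2 (h2.trans (Nat.add_le_add_left h3 _))
      rwa [Nat.cast_add] at h2'
    have h5 : (k:ℝ) ≤ η / (8 * (M:ℝ) ^ 2) * (k:ℝ) ^ 2 := by
      rw [div_mul_eq_mul_div, le_div_iff₀ (by positivity)]
      nlinarith
    have h6 : η / (4 * (M:ℝ) ^ 2) * (k:ℝ) ^ 2 = η / (8 * (M:ℝ) ^ 2) * (k:ℝ) ^ 2
        + η / (8 * (M:ℝ) ^ 2) * (k:ℝ) ^ 2 := by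
      field_simp; norm_num
    linarith
  have key : ∃ φ : Fin M → Fin k, (c + η / 2) * (M:ℝ) ^ 2 ≤
      (#{p ∈ D | Gr.Adj (φ p.1) (φ p.2)} : ℝ) -
        (M:ℝ) ^ 2 * (#{p ∈ D | ¬ Reg.Adj (φ p.1) (φ p.2)} : ℝ) := by
    have hne : Nonempty (Fin k) := ⟨⟨0, by omega⟩⟩
    obtain ⟨φ, -, hφ⟩ := exists_le_of_sum_le (s := (univ : Finset (Fin M → Fin k)))
      (f := fun _ => (c + η / 2) * (M:ℝ) ^ 2) (g := fun φ =>
        (#{p ∈ D | Gr.Adj (φ p.1) (φ p.2)} : ℝ) -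
        (M:ℝ) ^ 2 * (#{p ∈ D | ¬ Reg.Adj (φ p.1) (φ p.2)} : ℝ)) univ_nonempty (by
      rw [sum_sub_distrib, ← mul_sum (f := fun φ : Fin M → Fin k =>
        (#{p ∈ D | ¬ Reg.Adj (φ p.1) (φ p.2)} : ℝ))]
      have hk2 : (0:ℝ) < (k:ℝ) ^ 2 := by positivity
      refine le_of_mul_le_mul_left ?_ hk2
      rw [mul_sub, mul_left_comm ((k:ℝ) ^ 2) ((M:ℝ) ^ 2), hX, hY, hD]
      simp only [sum_const, card_univ, Fintype.card_fun, Fintype.card_fin, nsmul_eq_mul]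
      push_cast
      have hkM : (0:ℝ) < (k:ℝ) ^ M := by positivity
      have e1 : (c + η) * (k:ℝ) ^ 2 - (M:ℝ) ^ 2 * (η / (4 * (M:ℝ) ^ 2) * (k:ℝ) ^ 2) ≤
          (#{p : Fin k × Fin k | Gr.Adj p.1 p.2} : ℝ) -
          (M:ℝ) ^ 2 * (#{p : Fin k × Fin k | ¬ Reg.Adj p.1 p.2} : ℝ) := by
        gcongr
      have e2 : (c + η) * (k:ℝ) ^ 2 - (M:ℝ) ^ 2 * (η / (4 * (M:ℝ) ^ 2) * (k:ℝ) ^ 2)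
          = (c + 3 * η / 4) * (k:ℝ) ^ 2 := by
        field_simp; ring
      rw [e2] at e1
      have e3 : (c + η / 2) * (M:ℝ) ^ 2 ≤ ((M:ℝ) ^ 2 - M) * (c + 3 * η / 4) := by
        have : (M:ℝ) * (c + 3 * η / 4) ≤ M * (M * η / 4) := by
          apply mul_le_mul_of_nonneg_left _ (by linarith)
          linarith
        nlinarith
      have e4 : (0:ℝ) ≤ (M:ℝ) ^ 2 - M := by nlinarith
      calc (k:ℝ) ^ 2 * ((k:ℝ) ^ M * ((c + η / 2) * (M:ℝ) ^ 2))
          ≤ (k:ℝ) ^ 2 * ((k:ℝ) ^ M * (((M:ℝ) ^ 2 - M) * (c + 3 * η / 4))) := by gcongr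
        _ = ((M:ℝ) ^ 2 - M) * (k:ℝ) ^ M * ((c + 3 * η / 4) * (k:ℝ) ^ 2) := by ring
        _ ≤ ((M:ℝ) ^ 2 - M) * (k:ℝ) ^ M * ((#{p : Fin k × Fin k | Gr.Adj p.1 p.2} : ℝ) -
          (M:ℝ) ^ 2 * (#{p : Fin k × Fin k | ¬ Reg.Adj p.1 p.2} : ℝ)) := by gcongr
        _ = _ := by ring)
    exact ⟨φ, hφ⟩
  obtain ⟨φ, hφ⟩ := key
  have hXle : (#{p ∈ D | Gr.Adj (φ p.1) (φ p.2)} : ℝ) ≤ (M:ℝ) ^ 2 - M := by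
    rw [← hD]; exact_mod_cast card_filter_le _ _
  have hcpos : 0 ≤ (c + η / 2) * (M:ℝ) ^ 2 := by
    have := hr'.1
    positivity
  have hY0 : #{p ∈ D | ¬ Reg.Adj (φ p.1) (φ p.2)} = 0 := by
    by_contra h
    have h1 : (1:ℝ) ≤ #{p ∈ D | ¬ Reg.Adj (φ p.1) (φ p.2)} := by
      exact_mod_cast Nat.one_le_iff_ne_zero.2 h
    have h2 : (M:ℝ) ^ 2 * 1 ≤ (M:ℝ) ^ 2 * #{p ∈ D | ¬ Reg.Adj (φ p.1) (φ p.2)} := by gcongr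
    linarith
  have hRegφ : ∀ i j, i ≠ j → Reg.Adj (φ i) (φ j) := by
    intro i j hij
    by_contra h
    rw [card_eq_zero] at hY0
    have : (i, j) ∈ ({p ∈ D | ¬ Reg.Adj (φ p.1) (φ p.2)} : Finset _) := by
      simp [D, hij, h]
    rw [hY0] at this
    simp at this
  obtain ⟨f⟩ := hM₀ M (by omega) (Gr.comap φ) (by
    rw [hY0] at hφ
    simp only [Nat.cast_zero, mul_zero, sub_zero] at hφ
    refine hφ.trans ?_
    exact_mod_cast card_le_card (by
      intro p hp
      simp only [mem_filter, mem_univ, true_and] at hp ⊢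
      exact hp.2))
  refine ⟨fun p => φ (f p), fun p q hpq => hRegφ _ _ (fun h => hpq (f.injective h)), ?_⟩
  intro p q hpq
  exact f.toHom.map_adj (v := p) (w := q) hpq

open Classical in
/-- The fibre of `p` over `i`, as a finset. -/
noncomputable def abtFib {n k : ℕ} (p : Fin n → Fin k) (i : Fin k) : Finset (Fin n) :=
  Finset.univ.filter (fun x => p x = i)

open Finset Classical in
theorem abt_interedges {n : ℕ} (G : SimpleGraph (Fin n)) (A B : Finset (Fin n)) :
    (G.edgeDensity A B : ℝ) * (#A * #B) = ∑ a ∈ A, (#{b ∈ B | G.Adj a b} : ℝ) := by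
  have h1 : #(G.interedges A B) = ∑ a ∈ A, #{b ∈ B | G.Adj a b} := by
    rw [SimpleGraph.interedges_def, card_filter, sum_product]
    simp only [card_filter]
  rw [SimpleGraph.edgeDensity_def, h1]
  push_cast
  by_cases hA : #A = 0
  · rw [card_eq_zero] at hA; simp [hA]
  by_cases hB : #B = 0
  · rw [card_eq_zero] at hB; simp [hB]
  have hA' : (#A : ℝ) ≠ 0 := by exact_mod_cast hA
  have hB' : (#B : ℝ) ≠ 0 := by exact_mod_cast hB
  field_simp

open Finset Classical in
theorem abt_dens_lo {n : ℕ} (G : SimpleGraph (Fin n)) (A B : Finset (Fin n)) (hA : A.Nonempty)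
    (δ : ℝ) (h : δ ≤ G.edgeDensity A B) : ∃ a ∈ A, δ * #B ≤ #{b ∈ B | G.Adj a b} := by
  apply exists_le_of_sum_le hA
  rw [← abt_interedges, sum_const, nsmul_eq_mul]
  calc (#A : ℝ) * (δ * #B) = δ * (#A * #B) := by ring
    _ ≤ _ := by gcongr

open Finset Classical in
theorem abt_dens_hi {n : ℕ} (G : SimpleGraph (Fin n)) (A B : Finset (Fin n)) (hA : A.Nonempty)
    (δ : ℝ) (h : G.edgeDensity A B ≤ 1 - δ) : ∃ a ∈ A, δ * #B ≤ #{b ∈ B | ¬ G.Adj a b} := by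
  obtain ⟨a, ha, h1⟩ : ∃ a ∈ A, (#{b ∈ B | G.Adj a b} : ℝ) ≤ (1 - δ) * #B := by
    apply exists_le_of_sum_le hA
    rw [← abt_interedges, sum_const, nsmul_eq_mul]
    calc _ ≤ (1 - δ) * ((#A : ℝ) * #B) := by gcongr
      _ = _ := by ring
  refine ⟨a, ha, ?_⟩
  have h2 : (#{b ∈ B | G.Adj a b} : ℝ) + #{b ∈ B | ¬ G.Adj a b} = #B := by
    exact_mod_cast card_filter_add_card_filter_not (s := B) (fun b => G.Adj a b)
  linarith

open Finset Classical in
theorem abt_reg (ε : ℝ) (hε : 0 < ε) (l : ℕ) : ∃ K : ℕ, ∀ n ≥ l, ∀ G : SimpleGraph (Fin n),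
    ∃ k, l ≤ k ∧ k ≤ K ∧ ∃ p : Fin n → Fin k, (∀ i, (abtFib p i).Nonempty) ∧
      (∀ i, (#(abtFib p i) : ℝ) ≤ n / k + 1) ∧
      (#{q : Fin k × Fin k | q.1 ≠ q.2 ∧ ¬ G.IsUniform ε (abtFib p q.1) (abtFib p q.2)} : ℝ)
        ≤ ε * (k:ℝ) ^ 2 := by
  refine ⟨SzemerediRegularity.bound ε l, fun n hn G => ?_⟩
  obtain ⟨Q, hQ, hl, hK, hU⟩ := szemeredi_regularity G hε (l := l) (by simpa using hn)
  let e := Q.parts.equivFin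
  let p : Fin n → Fin #Q.parts := fun x => e ⟨Q.part x, Q.part_mem.2 (mem_univ x)⟩
  have hfib : ∀ i, abtFib p i = (e.symm i).1 := by
    intro i
    ext x
    simp only [abtFib, mem_filter, mem_univ, true_and, p]
    rw [← Equiv.eq_symm_apply, Subtype.ext_iff]
    simp only
    constructor
    · intro h; rw [← h]; exact Q.mem_part (mem_univ x)
    · intro h; exact Q.part_eq_of_mem (e.symm i).2 h
  refine ⟨#Q.parts, hl, hK, p, ?_, ?_, ?_⟩
  · intro i; rw [hfib]; exact Q.nonempty_of_mem_parts (e.symm i).2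
  · intro i
    rw [hfib]
    have h1 := hQ.card_part_le_average_add_one (e.symm i).2
    have h2 : (#(e.symm i).1 : ℝ) ≤ ((#(univ : Finset (Fin n)) / #Q.parts : ℕ) : ℝ) + 1 := by
      exact_mod_cast h1
    refine h2.trans ?_
    have := Nat.cast_div_le (α := ℝ) (m := #(univ : Finset (Fin n))) (n := #Q.parts)
    simp only [card_univ, Fintype.card_fin] at this ⊢
    linarith
  · have h1 : #{q : Fin #Q.parts × Fin #Q.parts |
        q.1 ≠ q.2 ∧ ¬ G.IsUniform ε (abtFib p q.1) (abtFib p q.2)} ≤ #(Q.nonUniforms G ε) := by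
      apply card_le_card_of_injOn (fun q => ((e.symm q.1).1, (e.symm q.2).1))
      · rintro ⟨i, j⟩ h
        simp only [coe_filter, mem_univ, true_and, Set.mem_ofPred_eq, hfib] at h
        rw [mem_coe, Finpartition.mk_mem_nonUniforms]
        refine ⟨(e.symm i).2, (e.symm j).2, ?_, h.2⟩
        intro h'
        exact h.1 (e.symm.injective (Subtype.ext h'))
      · rintro ⟨i, j⟩ _ ⟨i', j'⟩ _ h
        simp only [Prod.mk.injEq] at h
        exact Prod.ext (e.symm.injective (Subtype.ext h.1)) (e.symm.injective (Subtype.ext h.2))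
    have h2 : ((#Q.parts * (#Q.parts - 1) : ℕ) : ℝ) ≤ (#Q.parts : ℝ) ^ 2 := by
      rw [sq]; exact_mod_cast Nat.mul_le_mul_left _ (Nat.sub_le _ _)
    calc _ ≤ (#(Q.nonUniforms G ε) : ℝ) := Nat.cast_le.2 h1
      _ ≤ ((#Q.parts * (#Q.parts - 1) : ℕ) : ℝ) * ε := hU
      _ ≤ (#Q.parts : ℝ) ^ 2 * ε := by gcongr
      _ = _ := mul_comm _ _

open Finset Classical in
/-- Grey pairs of clusters. -/
def abtGrey {n k : ℕ} (G : SimpleGraph (Fin n)) (p : Fin n → Fin k) (ε δ : ℝ) (i j : Fin k) : Prop :=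
  i ≠ j ∧ G.IsUniform ε (abtFib p i) (abtFib p j) ∧
    2 * δ ≤ G.edgeDensity (abtFib p i) (abtFib p j) ∧
    G.edgeDensity (abtFib p i) (abtFib p j) ≤ 1 - 2 * δ

open Classical in
theorem abtGrey_symm {n k : ℕ} (G : SimpleGraph (Fin n)) (p : Fin n → Fin k) (ε δ : ℝ)
    (i j : Fin k) (h : abtGrey G p ε δ i j) : abtGrey G p ε δ j i := by
  refine ⟨h.1.symm, h.2.1.symm, ?_, ?_⟩
  · rw [SimpleGraph.edgeDensity_comm]; exact h.2.2.1
  · rw [SimpleGraph.edgeDensity_comm]; exact h.2.2.2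

open Finset Classical in
theorem abt_grey (P : ∀ n, Set (SimpleGraph (Fin n)))
    (hP : GraphHereditary P) (r : ℕ) (hr : 1 ≤ r)
    (hupp : ∀ v : Fin (r + 1) → Bool,
      ∃ (m : ℕ) (G : SimpleGraph (Fin m)), InH v G ∧ G ∉ P m)
    (η : ℝ) (hη : 0 < η) (δ : ℝ) (hδ : 0 < δ) (hδ1 : δ ≤ 1 / 4) :
    ∃ ε₀ > (0:ℝ), ∃ k₀ : ℕ, ∀ ε, 0 < ε → ε ≤ ε₀ → ∀ n, ∀ G ∈ P n, ∀ k ≥ k₀, ∀ p : Fin n → Fin k,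
      (∀ i, (abtFib p i).Nonempty) →
      (#{q : Fin k × Fin k | q.1 ≠ q.2 ∧ ¬ G.IsUniform ε (abtFib p q.1) (abtFib p q.2)} : ℝ)
        ≤ ε * (k:ℝ) ^ 2 →
      (#{q : Fin k × Fin k | abtGrey G p ε δ q.1 q.2} : ℝ) ≤ (1 - 1 / (r:ℝ) + η) * (k:ℝ) ^ 2 := by
  choose m H hH hHP using hupp
  obtain ⟨s, hs⟩ : ∃ s : ℕ, ∀ v, m v + 1 ≤ s :=
    ⟨univ.sup (fun v => m v + 1), fun v => le_sup (f := fun v => m v + 1) (mem_univ v)⟩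
  have hs1 : 1 ≤ s := (Nat.le_add_left 1 _).trans (hs (fun _ => true))
  have hs1' : (1:ℝ) ≤ s := by exact_mod_cast hs1
  obtain ⟨N, hN⟩ := abt_ramsey s s
  obtain ⟨ε₁, hε₁, k₀, hav⟩ := abt_average r hr η hη N
  refine ⟨min ε₁ (min (δ ^ s / s) δ), by positivity, k₀ + 1, ?_⟩
  intro ε hε hεle n G hG k hk p hne hirr
  have hε1 : ε ≤ ε₁ := hεle.trans (min_le_left _ _)
  have hε2 : ε ≤ δ ^ s / s := hεle.trans ((min_le_right _ _).trans (min_le_left _ _))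
  have hε3 : ε ≤ δ := hεle.trans ((min_le_right _ _).trans (min_le_right _ _))
  by_contra hlt
  push Not at hlt
  let Reg : SimpleGraph (Fin k) :=
    { Adj := fun i j => i ≠ j ∧ G.IsUniform ε (abtFib p i) (abtFib p j)
      symm := ⟨fun i j h => ⟨h.1.symm, h.2.symm⟩⟩
      loopless := ⟨fun i h => h.1 rfl⟩ }
  let Gr : SimpleGraph (Fin k) :=
    { Adj := abtGrey G p ε δ
      symm := ⟨fun i j h => abtGrey_symm G p ε δ i j h⟩
      loopless := ⟨fun i h => h.1 rfl⟩ }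
  obtain ⟨ψ, hψR, hψG⟩ := hav k (by omega) Gr Reg (by
    refine le_trans ?_ (hirr.trans (by gcongr))
    refine Nat.cast_le.2 (card_le_card ?_)
    intro q hq
    simp only [mem_filter, mem_univ, true_and, Reg] at hq ⊢
    exact ⟨hq.1, fun h => hq.2 ⟨hq.1, h⟩⟩) hlt.le
  have hψinj : Function.Injective ψ := by
    intro a b hab
    by_contra h
    exact (hψR a b h).1 hab
  -- Ramsey in each class
  have hram : ∀ i : Fin (r + 1), ∃ b : Bool, ∃ T : Finset (Fin N), #T = s ∧
      ∀ x ∈ T, ∀ y ∈ T, x ≠ y →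
        (b = true ↔ (1 / 2 : ℝ) ≤ G.edgeDensity (abtFib p (ψ (i, x))) (abtFib p (ψ (i, y)))) := by
    intro i
    rcases hN (fun x y : Fin N =>
      (1 / 2 : ℝ) ≤ G.edgeDensity (abtFib p (ψ (i, x))) (abtFib p (ψ (i, y))))
      (fun x y h => by rw [SimpleGraph.edgeDensity_comm]; exact h) univ (by simp) with
      ⟨T, -, hT, hTT⟩ | ⟨T, -, hT, hTT⟩
    · exact ⟨true, T, hT, fun x hx y hy hxy => by simpa using hTT x hx y hy hxy⟩
    · exact ⟨false, T, hT, fun x hx y hy hxy => by simpa using hTT x hx y hy hxy⟩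
  choose v T hT hTT using hram
  obtain ⟨f, hf⟩ := hH v
  have hms : m v ≤ s := (Nat.le_succ _).trans (hs v)
  let τ : Fin (m v) → Fin N := fun x => (T (f x)).orderEmbOfFin (hT (f x)) (Fin.castLE hms x)
  have hτmem : ∀ x, τ x ∈ T (f x) := fun x => (T (f x)).orderEmbOfFin_mem (hT (f x)) _
  have hτne : ∀ x y, x ≠ y → f x = f y → τ x ≠ τ y := by
    intro x y hxy hfxy h
    simp only [τ] at h
    have h' : ∀ i j : Fin (r + 1), i = j → (T i).orderEmbOfFin (hT i) (Fin.castLE hms x) =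
        (T j).orderEmbOfFin (hT j) (Fin.castLE hms y) → x = y := by
      rintro i j rfl hh
      have := ((T i).orderEmbOfFin (hT i)).injective hh
      exact Fin.castLE_injective hms this
    exact hxy (h' _ _ hfxy h)
  let A : Fin (m v) → Finset (Fin n) := fun x => abtFib p (ψ (f x, τ x))
  have hgne : ∀ x y, x ≠ y → (f x, τ x) ≠ (f y, τ y) := by
    intro x y hxy h
    rw [Prod.mk.injEq] at h
    exact hτne x y hxy h.1 h.2
  have hnV : Nonempty (Fin n) := ⟨(hne ⟨0, by omega⟩).choose⟩
  have hApos : ∀ x, (0:ℝ) < #(A x) := fun x => by exact_mod_cast card_pos.2 (hne _)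
  obtain ⟨φ, hφA, hφR⟩ := abt_embed (ι := Fin (m v)) (V := Fin n)
    (fun x y a b => (G.Adj a b ↔ (H v).Adj x y))
    (fun x y a b h => by rw [G.adj_comm, (H v).adj_comm]; exact h) δ hδ (by linarith) s
    (fun x => ε * #(A x)) (fun x => mul_pos hε (hApos x)) univ (by simpa using hms) A (by
      intro x _
      have h1 : δ ^ s ≤ δ ^ #(univ : Finset (Fin (m v))) :=
        pow_le_pow_of_le_one hδ.le (by linarith) (by simpa using hms)
      have h2 : s * ε ≤ δ ^ s := by
        rw [le_div_iff₀ (by linarith)] at hε2; linarith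
      calc (s:ℝ) * (ε * #(A x)) = (s * ε) * #(A x) := by ring
        _ ≤ _ := by
          apply mul_le_mul_of_nonneg_right (h2.trans h1) (hApos x).le) (by
      intro x _ y _ hxy A' hA' B' hB' htA htB
      have hreg := (hψR _ _ (hgne x y hxy)).2
      have hd := abs_lt.1 (hreg hA' hB' (by rw [mul_comm]; exact htA) (by rw [mul_comm]; exact htB))
      have hA'ne : A'.Nonempty := by
        rw [← card_pos]
        have : (0:ℝ) < #A' := lt_of_lt_of_le (mul_pos hε (hApos x)) htA
        exact_mod_cast this
      have hin : f x = f y → ((H v).Adj x y ↔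
          (1 / 2 : ℝ) ≤ G.edgeDensity (abtFib p (ψ (f x, τ x))) (abtFib p (ψ (f y, τ y)))) := by
        intro hfxy
        rw [hf x y hxy hfxy, ← hfxy]
        exact hTT (f x) (τ x) (hτmem x) (τ y) (hfxy ▸ hτmem y) (hτne x y hxy hfxy)
      by_cases hadj : (H v).Adj x y
      · obtain ⟨a, ha, hab⟩ := abt_dens_lo G A' B' hA'ne δ (by
          have h2 : 2 * δ ≤ G.edgeDensity (abtFib p (ψ (f x, τ x))) (abtFib p (ψ (f y, τ y))) := by
            by_cases hfxy : f x = f y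
            · have := (hin hfxy).1 hadj
              linarith
            · exact (hψG (f x, τ x) (f y, τ y) hfxy).2.2.1
          linarith [hd.1])
        refine ⟨a, ha, hab.trans (le_of_eq ?_)⟩
        congr 3
        ext b
        simp [hadj]
      · obtain ⟨a, ha, hab⟩ := abt_dens_hi G A' B' hA'ne δ (by
          have h2 : G.edgeDensity (abtFib p (ψ (f x, τ x))) (abtFib p (ψ (f y, τ y))) ≤ 1 - 2 * δ := by
            by_cases hfxy : f x = f y
            · have := (not_iff_not.2 (hin hfxy)).1 hadj
              push Not at this
              linarith
            · exact (hψG (f x, τ x) (f y, τ y) hfxy).2.2.2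
          linarith [hd.2])
        refine ⟨a, ha, hab.trans (le_of_eq ?_)⟩
        congr 3
        ext b
        simp [hadj])
  have hφinj : Function.Injective φ := by
    intro x y hxy
    by_contra h
    have h1 := hφA x (mem_univ x)
    have h2 := hφA y (mem_univ y)
    simp only [A, abtFib, mem_filter, mem_univ, true_and] at h1 h2
    rw [hxy, h2] at h1
    exact hgne x y h (hψinj h1).symm
  apply hHP v
  have := hP (m v) n ⟨φ, hφinj⟩ G hG
  convert this
  ext x y
  simp only [SimpleGraph.comap_adj, Function.Embedding.coeFn_mk]
  by_cases hxy : x = y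
  · subst hxy; simp
  · exact (hφR x (mem_univ x) y (mem_univ y) hxy).symm

open Finset Classical in
theorem abt_small_sets {α : Type} (E : Finset α) (b : ℕ) (x : ℝ) (hx : 0 < x) (hx1 : x ≤ 1) :
    (#{Y ∈ E.powerset | #Y ≤ b} : ℝ) * x ^ b ≤ (1 + x) ^ #E := by
  have h := Finset.sum_pow_mul_eq_add_pow x 1 E
  rw [add_comm 1 x, ← h]
  calc (#{Y ∈ E.powerset | #Y ≤ b} : ℝ) * x ^ b = ∑ Y ∈ E.powerset with #Y ≤ b, x ^ b := by
        rw [sum_const, nsmul_eq_mul]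
    _ ≤ ∑ Y ∈ E.powerset with #Y ≤ b, x ^ #Y * 1 ^ (#E - #Y) := by
        apply sum_le_sum
        intro Y hY
        rw [one_pow, mul_one]
        exact pow_le_pow_of_le_one hx.le hx1 (mem_filter.1 hY).2
    _ ≤ _ := by
        apply sum_le_sum_of_subset_of_nonneg (filter_subset _ _)
        intros; positivity

open Finset Classical in
theorem abt_count {α : Type} (E : Finset α) (F : Finset (Finset α))
    (C : Finset (Finset α × Finset α)) (a b : ℕ)
    (hF : ∀ X ∈ F, X ⊆ E ∧ ∃ c ∈ C, c.2 ⊆ E ∧ #c.1 ≤ a ∧ #((symmDiff X c.2) \ c.1) ≤ b) :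
    #F ≤ #C * (2 ^ a * #{Y ∈ E.powerset | #Y ≤ b}) := by
  let C' := C.filter (fun c => #c.1 ≤ a)
  have hsub : F ⊆ C'.biUnion (fun c => (c.1.powerset ×ˢ {Y ∈ E.powerset | #Y ≤ b}).image
      (fun z => z.1 ∪ (symmDiff z.2 c.2) \ c.1)) := by
    intro X hX
    obtain ⟨hXE, c, hc, hcE, hca, hcb⟩ := hF X hX
    refine mem_biUnion.2 ⟨c, mem_filter.2 ⟨hc, hca⟩, mem_image.2
      ⟨(X ∩ c.1, (symmDiff X c.2) \ c.1), ?_, ?_⟩⟩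
    · simp only [mem_product, mem_powerset, mem_filter]
      refine ⟨inter_subset_right, ?_, hcb⟩
      intro e he
      have := (Finset.mem_sdiff.1 he).1
      rw [mem_symmDiff] at this
      rcases this with h | h
      · exact hXE h.1
      · exact hcE h.1
    · ext e
      simp only [mem_union, mem_inter, Finset.mem_sdiff, mem_symmDiff]
      tauto
  refine (card_le_card hsub).trans ((card_biUnion_le_card_mul _ _
    (2 ^ a * #{Y ∈ E.powerset | #Y ≤ b}) ?_).trans ?_)
  · intro c hc
    refine card_image_le.trans ?_
    rw [card_product, card_powerset]
    exact Nat.mul_le_mul_right _ (Nat.pow_le_pow_right (by norm_num) (mem_filter.1 hc).2)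
  · exact Nat.mul_le_mul_right _ (card_filter_le _ _)

open Finset Classical in
theorem abt_fiber_sum {n k : ℕ} (p : Fin n → Fin k) (Z : Fin n → Fin n → Prop) :
    #{z : Fin n × Fin n | Z z.1 z.2} =
      ∑ q : Fin k × Fin k, #{z ∈ abtFib p q.1 ×ˢ abtFib p q.2 | Z z.1 z.2} := by
  rw [card_eq_sum_card_fiberwise (f := fun z : Fin n × Fin n => (p z.1, p z.2))
      (t := (univ : Finset (Fin k × Fin k))) (fun _ _ => mem_coe.2 (mem_univ _))]
  apply sum_congr rfl
  rintro ⟨i, j⟩ _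
  congr 1
  ext ⟨x, y⟩
  simp only [abtFib, mem_filter, mem_univ, true_and, mem_product, Prod.mk.injEq]
  tauto

/-- The ordered pairs `x < y`. -/
def abtE (n : ℕ) : Finset (Fin n × Fin n) := Finset.univ.filter (fun z => z.1 < z.2)

open Classical in
/-- pairs of vertices whose clusters form a pair in `T`. -/
noncomputable def abtPull {n K : ℕ} (p : Fin n → Fin K) (T : Finset (Fin K × Fin K)) :
    Finset (Fin n × Fin n) := (abtE n).filter (fun z => (p z.1, p z.2) ∈ T)

open Classical in
/-- the edge set of `G` as ordered pairs. -/
noncomputable def abtX {n : ℕ} (G : SimpleGraph (Fin n)) : Finset (Fin n × Fin n) :=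
  (abtE n).filter (fun z => G.Adj z.1 z.2)

open Finset Classical in
theorem abt_half {n : ℕ} (Z : Fin n → Fin n → Prop) (hZ : ∀ x y, Z x y → Z y x) :
    2 * #{z ∈ abtE n | Z z.1 z.2} ≤ #{z : Fin n × Fin n | Z z.1 z.2} := by
  have h1 : #{z ∈ abtE n | Z z.1 z.2} =
      #(({z ∈ abtE n | Z z.1 z.2} : Finset _).image Prod.swap) :=
    (card_image_of_injective _ Prod.swap_injective).symm
  have hd : Disjoint ({z ∈ abtE n | Z z.1 z.2} : Finset _)
      (({z ∈ abtE n | Z z.1 z.2} : Finset _).image Prod.swap) := by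
    rw [disjoint_left]
    rintro ⟨x, y⟩ h h'
    simp only [abtE, mem_filter, mem_univ, true_and, mem_image, Prod.exists, Prod.swap_prod_mk,
      Prod.mk.injEq] at h h'
    obtain ⟨a, b, hab, rfl, rfl⟩ := h'
    exact absurd h.1 (not_lt.2 hab.1.le)
  rw [two_mul]
  conv_lhs => rw [h1]; rw [← h1]
  calc _ = #({z ∈ abtE n | Z z.1 z.2} : Finset _) +
        #(({z ∈ abtE n | Z z.1 z.2} : Finset _).image Prod.swap) := by rw [← h1]
    _ = _ := (card_union_of_disjoint hd).symm
    _ ≤ _ := by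
      apply card_le_card
      apply union_subset
      · intro z hz
        simp only [mem_filter, mem_univ, true_and] at hz ⊢
        exact hz.2
      · intro z hz
        obtain ⟨w, hw, rfl⟩ := mem_image.1 hz
        simp only [mem_filter, mem_univ, true_and] at hw ⊢
        exact hZ _ _ hw.2

open Finset Classical in
theorem abt_err {n k : ℕ} (G : SimpleGraph (Fin n)) (p : Fin n → Fin k) (ε δ : ℝ)
    (hδ : 0 < δ) (hδ1 : δ ≤ 1 / 4) (i j : Fin k) (hij : i ≠ j)
    (hu : G.IsUniform ε (abtFib p i) (abtFib p j)) (hg : ¬ abtGrey G p ε δ i j) :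
    (#{z ∈ abtFib p i ×ˢ abtFib p j | ¬ (G.Adj z.1 z.2 ↔
        (1 / 2 : ℝ) ≤ G.edgeDensity (abtFib p i) (abtFib p j))} : ℝ) ≤
      2 * δ * (#(abtFib p i) * #(abtFib p j)) := by
  set A := abtFib p i with hA
  set B := abtFib p j with hB
  have hInterEq : (G.edgeDensity A B : ℝ) * (#A * #B) = #{z ∈ A ×ˢ B | G.Adj z.1 z.2} := by
    rw [abt_interedges, card_filter, sum_product]
    simp only [card_filter]
    push_cast
    rfl
  have htot : (#{z ∈ A ×ˢ B | G.Adj z.1 z.2} : ℝ) + #{z ∈ A ×ˢ B | ¬ G.Adj z.1 z.2} =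
      #A * #B := by
    rw [← Nat.cast_add, card_filter_add_card_filter_not, card_product, Nat.cast_mul]
  have hAB : (0:ℝ) ≤ #A * #B := by positivity
  by_cases hd : (1 / 2 : ℝ) ≤ G.edgeDensity A B
  · have h1 : 1 - 2 * δ < G.edgeDensity A B := by
      by_contra h
      push Not at h
      exact hg ⟨hij, hu, by rw [← hA, ← hB]; linarith, h⟩
    have : ({z ∈ A ×ˢ B | ¬ (G.Adj z.1 z.2 ↔ (1 / 2 : ℝ) ≤ G.edgeDensity A B)} : Finset _) =
        {z ∈ A ×ˢ B | ¬ G.Adj z.1 z.2} := by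
      ext z; simp only [mem_filter, hd, iff_true]
    rw [this]
    nlinarith
  · have h1 : G.edgeDensity A B < 2 * δ := by
      by_contra h
      push Not at h hd
      exact hg ⟨hij, hu, h, by rw [← hA, ← hB]; linarith⟩
    have : ({z ∈ A ×ˢ B | ¬ (G.Adj z.1 z.2 ↔ (1 / 2 : ℝ) ≤ G.edgeDensity A B)} : Finset _) =
        {z ∈ A ×ˢ B | G.Adj z.1 z.2} := by
      ext z; simp only [mem_filter, hd, iff_false, not_not]
    rw [this, ← hInterEq]
    gcongr

set_option maxHeartbeats 2000000 in
open Finset Classical in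
theorem abt_structure (P : ∀ n, Set (SimpleGraph (Fin n)))
    (hP : GraphHereditary P) (r : ℕ) (hr : 1 ≤ r)
    (hupp : ∀ v : Fin (r + 1) → Bool,
      ∃ (m : ℕ) (G : SimpleGraph (Fin m)), InH v G ∧ G ∉ P m)
    (η : ℝ) (hη : 0 < η) (γ : ℝ) (hγ : 0 < γ) :
    ∃ K n₀ : ℕ, ∀ n ≥ n₀, ∀ G ∈ P n, ∃ (p : Fin n → Fin K) (T T' : Finset (Fin K × Fin K)),
      (#(abtPull p T) : ℝ) ≤ (1 - 1 / (r:ℝ) + η) * (n:ℝ) ^ 2 / 2 ∧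
      (#((symmDiff (abtX G) (abtPull p T')) \ abtPull p T) : ℝ) ≤ γ * (n:ℝ) ^ 2 := by
  have hr' : (0:ℝ) ≤ 1 - 1 / (r:ℝ) ∧ 1 - 1 / (r:ℝ) ≤ 1 := by
    have : (1:ℝ) ≤ r := by exact_mod_cast hr
    have h : 1 / (r:ℝ) ≤ 1 := by rw [div_le_one (by linarith)]; exact this
    have h' : 0 ≤ 1 / (r:ℝ) := by positivity
    constructor <;> linarith
  set c : ℝ := 1 - 1 / (r:ℝ) with hc
  obtain ⟨hc0, hc1⟩ := hr'
  obtain ⟨δ, hδ, hδ1, hδγ⟩ : ∃ δ : ℝ, 0 < δ ∧ δ ≤ 1 / 4 ∧ δ ≤ γ / 8 :=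
    ⟨min (1 / 4) (γ / 8), by positivity, min_le_left _ _, min_le_right _ _⟩
  obtain ⟨ε₀, hε₀, k₀, hgrey⟩ := abt_grey P hP r hr hupp (η / 2) (by positivity) δ hδ hδ1
  obtain ⟨ε, hε, hεε, hεγ⟩ : ∃ ε : ℝ, 0 < ε ∧ ε ≤ ε₀ ∧ ε ≤ γ / 16 :=
    ⟨min ε₀ (γ / 16), by positivity, min_le_left _ _, min_le_right _ _⟩
  obtain ⟨l₁, hl₁⟩ := exists_nat_gt (16 / γ)
  obtain ⟨K, hK⟩ := abt_reg ε hε (k₀ + l₁ + 1)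
  obtain ⟨n₁, hn₁⟩ := exists_nat_gt (6 * K * (1 + η) / η)
  refine ⟨K, k₀ + l₁ + 1 + K + n₁, fun n hn G hG => ?_⟩
  obtain ⟨k, hlk, hkK, p, hne, hsize, hirr⟩ := hK n (by omega) G
  have hgr := hgrey ε hε hεε n G hG k (by omega) p hne hirr
  have hk0 : (0:ℝ) < k := by exact_mod_cast (by omega : 0 < k)
  have hn0 : (0:ℝ) < n := by exact_mod_cast (by omega : 0 < n)
  have hkn : (k:ℝ) ≤ n := by exact_mod_cast (by omega : k ≤ n)
  have hkK' : (k:ℝ) ≤ K := by exact_mod_cast hkK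
  have hKn : (K:ℝ) ≤ n := by exact_mod_cast (by omega : K ≤ n)
  have hnk : (k:ℝ) ^ 2 * ((n:ℝ) / k + 1) ^ 2 = (n + k) ^ 2 := by field_simp
  have hprod : ∀ q : Fin k × Fin k, (#(abtFib p q.1) : ℝ) * #(abtFib p q.2) ≤ ((n:ℝ) / k + 1) ^ 2 := by
    intro q
    rw [sq]
    exact mul_le_mul (hsize _) (hsize _) (by positivity) (by positivity)
  let ι : Fin k ↪ Fin K := Fin.castLEEmb hkK
  let T₀ : Finset (Fin k × Fin k) := {q | abtGrey G p ε δ q.1 q.2}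
  let T₁ : Finset (Fin k × Fin k) :=
    {q | (1 / 2 : ℝ) ≤ G.edgeDensity (abtFib p q.1) (abtFib p q.2)}
  have hmem : ∀ (T : Finset (Fin k × Fin k)) (i j : Fin k),
      (ι i, ι j) ∈ T.map (ι.prodMap ι) ↔ (i, j) ∈ T := by
    intro T i j
    exact Finset.mem_map' (ι.prodMap ι) (a := (i, j))
  refine ⟨fun x => ι (p x), T₀.map (ι.prodMap ι), T₁.map (ι.prodMap ι), ?_, ?_⟩
  · have h1 : abtPull (fun x => ι (p x)) (T₀.map (ι.prodMap ι)) =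
        {z ∈ abtE n | abtGrey G p ε δ (p z.1) (p z.2)} := by
      ext z
      simp only [abtPull, mem_filter, hmem, T₀, mem_univ, true_and]
    have h2 := abt_half (fun x y => abtGrey G p ε δ (p x) (p y))
      (fun x y h => abtGrey_symm _ _ _ _ _ _ h)
    replace h2 := h2.trans_eq (abt_fiber_sum p (fun x y => abtGrey G p ε δ (p x) (p y)))
    have h3 : ∀ q : Fin k × Fin k,
        (#{z ∈ abtFib p q.1 ×ˢ abtFib p q.2 | abtGrey G p ε δ (p z.1) (p z.2)} : ℝ) ≤
        if abtGrey G p ε δ q.1 q.2 then ((n:ℝ) / k + 1) ^ 2 else 0 := by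
      intro q
      split_ifs with h
      · refine le_trans ?_ (hprod q)
        rw [← Nat.cast_mul, ← card_product]
        exact Nat.cast_le.2 (card_filter_le _ _)
      · rw [filter_false_of_mem]
        · simp
        · intro z hz
          simp only [abtFib, mem_product, mem_filter, mem_univ, true_and] at hz
          rw [hz.1, hz.2]; exact h
    have h4 : (2:ℝ) * #{z ∈ abtE n | abtGrey G p ε δ (p z.1) (p z.2)} ≤
        #{q : Fin k × Fin k | abtGrey G p ε δ q.1 q.2} * ((n:ℝ) / k + 1) ^ 2 := by
      calc (2:ℝ) * #{z ∈ abtE n | abtGrey G p ε δ (p z.1) (p z.2)} ≤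
          ∑ q : Fin k × Fin k,
            (#{z ∈ abtFib p q.1 ×ˢ abtFib p q.2 | abtGrey G p ε δ (p z.1) (p z.2)} : ℝ) := by
            exact_mod_cast h2
        _ ≤ ∑ q : Fin k × Fin k, if abtGrey G p ε δ q.1 q.2 then ((n:ℝ) / k + 1) ^ 2 else 0 :=
            sum_le_sum (fun q _ => h3 q)
        _ = _ := by
            rw [← sum_filter, sum_const, nsmul_eq_mul]
    rw [h1]
    have h5 : (#{q : Fin k × Fin k | abtGrey G p ε δ q.1 q.2} : ℝ) * ((n:ℝ) / k + 1) ^ 2 ≤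
        (c + η / 2) * (n + k) ^ 2 := by
      rw [← hnk, ← mul_assoc]
      gcongr
    have h6 : (c + η / 2) * ((n:ℝ) + k) ^ 2 ≤ (c + η) * (n:ℝ) ^ 2 := by
      have e1 : ((n:ℝ) + k) ^ 2 ≤ (n:ℝ) ^ 2 + 3 * K * n := by nlinarith
      have e2 : 6 * K * (1 + η) ≤ n * η := by
        rw [div_lt_iff₀ hη] at hn₁
        have : (n₁:ℝ) ≤ n := by exact_mod_cast (by omega : n₁ ≤ n)
        nlinarith
      have e3 : (c + η / 2) * ((n:ℝ) + k) ^ 2 ≤ (c + η / 2) * ((n:ℝ) ^ 2 + 3 * K * n) := by gcongr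
      have e4 : (c + η / 2) * (3 * K * n) ≤ (1 + η) * (3 * K * n) := by
        apply mul_le_mul_of_nonneg_right (by linarith) (by positivity)
      nlinarith
    linarith
  · let Z : Fin n → Fin n → Prop := fun x y => ¬ abtGrey G p ε δ (p x) (p y) ∧
      ¬ (G.Adj x y ↔ (1 / 2 : ℝ) ≤ G.edgeDensity (abtFib p (p x)) (abtFib p (p y)))
    have h1 : (symmDiff (abtX G) (abtPull (fun x => ι (p x)) (T₁.map (ι.prodMap ι)))) \
        abtPull (fun x => ι (p x)) (T₀.map (ι.prodMap ι)) ⊆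
        ({z : Fin n × Fin n | Z z.1 z.2} : Finset _) := by
      intro z hz
      simp only [abtX, abtPull, Finset.mem_sdiff, mem_symmDiff, mem_filter, hmem, T₀, T₁, mem_univ,
        true_and, Z] at hz ⊢
      tauto
    have h2 := card_le_card h1
    have hZs : #({z : Fin n × Fin n | Z z.1 z.2} : Finset _) =
        ∑ q : Fin k × Fin k, #{z ∈ abtFib p q.1 ×ˢ abtFib p q.2 | Z z.1 z.2} := by
      convert abt_fiber_sum p Z
    rw [hZs] at h2
    have h3 : ∀ q : Fin k × Fin k,
        (#{z ∈ abtFib p q.1 ×ˢ abtFib p q.2 | Z z.1 z.2} : ℝ) ≤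
        ((if q.1 = q.2 then ((n:ℝ) / k + 1) ^ 2 else 0) +
        (if q.1 ≠ q.2 ∧ ¬ G.IsUniform ε (abtFib p q.1) (abtFib p q.2) then
          ((n:ℝ) / k + 1) ^ 2 else 0)) + 2 * δ * (#(abtFib p q.1) * #(abtFib p q.2)) := by
      intro q
      have hle : (#{z ∈ abtFib p q.1 ×ˢ abtFib p q.2 | Z z.1 z.2} : ℝ) ≤ ((n:ℝ) / k + 1) ^ 2 := by
        refine le_trans ?_ (hprod q)
        rw [← Nat.cast_mul, ← card_product]
        exact Nat.cast_le.2 (card_filter_le _ _)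
      have hpos : (0:ℝ) ≤ 2 * δ * (#(abtFib p q.1) * #(abtFib p q.2)) := by positivity
      have hpos2 : (0:ℝ) ≤ ((n:ℝ) / k + 1) ^ 2 := by positivity
      by_cases hq : q.1 = q.2
      · rw [if_pos hq]
        split_ifs <;> linarith
      · by_cases hu : G.IsUniform ε (abtFib p q.1) (abtFib p q.2)
        · rw [if_neg hq, if_neg (by tauto), zero_add, zero_add]
          by_cases hg : abtGrey G p ε δ q.1 q.2
          · rw [filter_false_of_mem]
            · simpa using hpos
            · intro z hz
              simp only [abtFib, mem_product, mem_filter, mem_univ, true_and] at hz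
              simp only [Z, hz.1, hz.2]
              tauto
          · refine le_trans ?_ (abt_err G p ε δ hδ hδ1 q.1 q.2 hq hu hg)
            refine Nat.cast_le.2 (card_le_card ?_)
            intro z hz
            rw [mem_filter] at hz ⊢
            refine ⟨hz.1, ?_⟩
            have h := hz.2
            have hz1 := hz.1
            simp only [abtFib, mem_product, mem_filter, mem_univ, true_and] at hz1
            simp only [Z, hz1.1, hz1.2] at h
            exact h.2
        · rw [if_neg hq, if_pos ⟨hq, hu⟩]
          linarith
    have hdiag : (#{q : Fin k × Fin k | q.1 = q.2} : ℝ) ≤ k := by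
      have : #{q : Fin k × Fin k | q.1 = q.2} ≤ #(univ : Finset (Fin k)) := by
        apply card_le_card_of_injOn Prod.fst (fun _ _ => mem_coe.2 (mem_univ _))
        rintro ⟨a, b⟩ h ⟨a', b'⟩ h' hh
        simp only [coe_filter, mem_univ, true_and, Set.mem_ofPred_eq] at h h' hh
        subst h h' hh; rfl
      rw [card_univ, Fintype.card_fin] at this
      exact_mod_cast this
    have hsumfib : ∑ q : Fin k × Fin k, ((#(abtFib p q.1) : ℝ) * #(abtFib p q.2)) = (n:ℝ) ^ 2 := by
      have := abt_fiber_sum p (fun _ _ => True)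
      simp only [filter_true, card_product, card_univ, Fintype.card_prod, Fintype.card_fin] at this
      rw [sq]
      exact_mod_cast this.symm
    have h4 : (#((symmDiff (abtX G) (abtPull (fun x => ι (p x)) (T₁.map (ι.prodMap ι)))) \
        abtPull (fun x => ι (p x)) (T₀.map (ι.prodMap ι))) : ℝ) ≤
        (k + ε * (k:ℝ) ^ 2) * ((n:ℝ) / k + 1) ^ 2 + 2 * δ * (n:ℝ) ^ 2 := by
      calc _ ≤ ∑ q : Fin k × Fin k,
            (#{z ∈ abtFib p q.1 ×ˢ abtFib p q.2 | Z z.1 z.2} : ℝ) := by exact_mod_cast h2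
        _ ≤ _ := sum_le_sum (fun q _ => h3 q)
        _ = (#{q : Fin k × Fin k | q.1 = q.2} + #{q : Fin k × Fin k | q.1 ≠ q.2 ∧
              ¬ G.IsUniform ε (abtFib p q.1) (abtFib p q.2)}) * ((n:ℝ) / k + 1) ^ 2
              + 2 * δ * (n:ℝ) ^ 2 := by
            rw [sum_add_distrib, sum_add_distrib, ← mul_sum, hsumfib, ← sum_filter, ← sum_filter,
              sum_const, sum_const, nsmul_eq_mul, nsmul_eq_mul, add_mul]
        _ ≤ _ := by gcongr
    refine h4.trans ?_
    have h5 : (k + ε * (k:ℝ) ^ 2) * ((n:ℝ) / k + 1) ^ 2 = (1 / k + ε) * (n + k) ^ 2 := by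
      field_simp
    have h6 : 1 / (k:ℝ) ≤ γ / 16 := by
      have : (l₁:ℝ) ≤ k := by exact_mod_cast (by omega : l₁ ≤ k)
      rw [div_lt_iff₀ hγ] at hl₁
      rw [div_le_div_iff₀ hk0 (by norm_num)]
      nlinarith
    have h7 : ((n:ℝ) + k) ^ 2 ≤ 4 * (n:ℝ) ^ 2 := by nlinarith
    rw [h5]
    have h8 : (1 / k + ε) * ((n:ℝ) + k) ^ 2 ≤ (γ / 16 + γ / 16) * (4 * (n:ℝ) ^ 2) := by
      gcongr
    have h9 : 2 * δ * (n:ℝ) ^ 2 ≤ 2 * (γ / 8) * (n:ℝ) ^ 2 := by gcongr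
    nlinarith [sq_nonneg (n:ℝ)]

theorem abtX_injective {n : ℕ} :
    Function.Injective (abtX : SimpleGraph (Fin n) → Finset (Fin n × Fin n)) := by
  intro G H h
  have key : ∀ x y : Fin n, x < y → (G.Adj x y ↔ H.Adj x y) := by
    intro x y hxy
    have := congrArg (fun s => (x, y) ∈ s) h
    simpa [abtX, abtE, hxy] using this
  ext x y
  rcases lt_trichotomy x y with hxy | hxy | hxy
  · exact key x y hxy
  · subst hxy; simp
  · rw [G.adj_comm, H.adj_comm]; exact key y x hxy

open Finset Classical in
theorem abt_cardE (n : ℕ) : (#(abtE n) : ℝ) ≤ (n:ℝ) ^ 2 / 2 := by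
  have h := abt_half (n := n) (fun _ _ => True) (fun _ _ _ => trivial)
  simp only [filter_true, card_univ, Fintype.card_prod, Fintype.card_fin] at h
  have h' : (2:ℝ) * #(abtE n) ≤ n * n := by exact_mod_cast h
  nlinarith

open Finset Classical in
theorem abt_card_bound {n K : ℕ} (Q : Set (SimpleGraph (Fin n))) (a b : ℕ)
    (h : ∀ G ∈ Q, ∃ (p : Fin n → Fin K) (T T' : Finset (Fin K × Fin K)),
      #(abtPull p T) ≤ a ∧ #((symmDiff (abtX G) (abtPull p T')) \ abtPull p T) ≤ b) :
    Q.ncard ≤ (K + 1) ^ n * (2 ^ (K * K) * 2 ^ (K * K)) *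
      (2 ^ a * #{Y ∈ (abtE n).powerset | #Y ≤ b}) := by
  let C : Finset (Finset (Fin n × Fin n) × Finset (Fin n × Fin n)) :=
    (univ : Finset ((Fin n → Fin K) × (Finset (Fin K × Fin K) × Finset (Fin K × Fin K)))).image
      (fun w => (abtPull w.1 w.2.1, abtPull w.1 w.2.2))
  have hC : #C ≤ (K + 1) ^ n * (2 ^ (K * K) * 2 ^ (K * K)) := by
    refine card_image_le.trans ?_
    simp only [card_univ, Fintype.card_prod, Fintype.card_finset, Fintype.card_fin,
      Fintype.card_fun]
    gcongr
    omega
  have h1 : Q.ncard = #(Q.toFinset.image abtX) := by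
    rw [card_image_of_injective _ abtX_injective, Set.ncard_eq_toFinset_card']
  rw [h1]
  refine (abt_count (abtE n) _ C a b ?_).trans (Nat.mul_le_mul_right _ hC)
  intro X hX
  obtain ⟨G, hG, rfl⟩ := mem_image.1 hX
  refine ⟨filter_subset _ _, ?_⟩
  obtain ⟨p, T, T', h1, h2⟩ := h G (Set.mem_toFinset.1 hG)
  exact ⟨(abtPull p T, abtPull p T'), mem_image.2 ⟨(p, T, T'), mem_univ _, rfl⟩,
    filter_subset _ _, h1, by convert h2⟩

set_option maxHeartbeats 2000000 in
open Finset Classical in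
theorem abt_upper (P : ∀ n, Set (SimpleGraph (Fin n)))
    (hP : GraphHereditary P) (r : ℕ) (hr : 1 ≤ r)
    (hupp : ∀ v : Fin (r + 1) → Bool,
      ∃ (m : ℕ) (G : SimpleGraph (Fin m)), InH v G ∧ G ∉ P m)
    (hne : ∀ n, 0 < (P n).ncard)
    (η : ℝ) (hη : 0 < η) :
    ∃ n₀ : ℕ, ∀ n ≥ n₀, Real.logb 2 ((P n).ncard : ℝ) ≤
      (1 - 1 / (r:ℝ) + 4 * η) * (n:ℝ) ^ 2 / 2 := by
  obtain ⟨x, hx0, hx1, hxη⟩ : ∃ x : ℝ, 0 < x ∧ x ≤ 1 / 2 ∧ x ≤ η / 2 :=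
    ⟨min (1 / 2) (η / 2), by positivity, min_le_left _ _, min_le_right _ _⟩
  have hL : 0 < - Real.logb 2 x := by
    have := Real.logb_neg (b := 2) (by norm_num) hx0 (by linarith)
    linarith
  set L := - Real.logb 2 x with hLdef
  have hr1 : 0 ≤ 1 - 1 / (r:ℝ) := by
    have : (1:ℝ) ≤ r := by exact_mod_cast hr
    have h : 1 / (r:ℝ) ≤ 1 := by rw [div_le_one (by linarith)]; exact this
    linarith
  set c : ℝ := 1 - 1 / (r:ℝ) with hc
  obtain ⟨K, n₁, hK⟩ := abt_structure P hP r hr hupp η hη (η / (2 * L)) (by positivity)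
  set M : ℝ := Real.logb 2 ((K:ℝ) + 1) with hM
  have hM0 : 0 ≤ M := Real.logb_nonneg (by norm_num) (by linarith [Nat.cast_nonneg (α := ℝ) K])
  obtain ⟨n₂, hn₂⟩ := exists_nat_gt (2 * (M + 2 * (K * K)) / η)
  refine ⟨n₁ + n₂ + 1, fun n hn => ?_⟩
  have hn1 : (1:ℝ) ≤ n := by exact_mod_cast (by omega : 1 ≤ n)
  have hnn : (n₂:ℝ) ≤ n := by exact_mod_cast (by omega : n₂ ≤ n)
  set a := ⌊(c + η) * (n:ℝ) ^ 2 / 2⌋₊ with ha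
  set b := ⌊η / (2 * L) * (n:ℝ) ^ 2⌋₊ with hb
  have ha' : (a:ℝ) ≤ (c + η) * (n:ℝ) ^ 2 / 2 := Nat.floor_le (by positivity)
  have hb' : (b:ℝ) ≤ η / (2 * L) * (n:ℝ) ^ 2 := Nat.floor_le (by positivity)
  have hcb := abt_card_bound (K := K) (P n) a b (fun G hG => by
    obtain ⟨p, T, T', h1, h2⟩ := hK n (by omega) G hG
    exact ⟨p, T, T', Nat.le_floor h1, Nat.le_floor h2⟩)
  have hS := abt_small_sets (abtE n) b x hx0 (by linarith)
  set S := #{Y ∈ (abtE n).powerset | #Y ≤ b} with hSdef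
  have hS0 : 0 < S := by
    rw [hSdef, card_pos]
    exact ⟨∅, by simp⟩
  have hS0' : (0:ℝ) < S := by exact_mod_cast hS0
  have hlogS : Real.logb 2 S ≤ b * L + #(abtE n) * Real.logb 2 (1 + x) := by
    have := Real.logb_le_logb_of_le (b := 2) (by norm_num) (by positivity) hS
    rw [Real.logb_mul hS0'.ne' (by positivity), Real.logb_pow, Real.logb_pow] at this
    rw [hLdef]; linarith
  have hlog1 : Real.logb 2 (1 + x) ≤ 2 * x := by
    rw [Real.logb, div_le_iff₀ (Real.log_pos (by norm_num))]
    have h1 := Real.log_le_sub_one_of_pos (show 0 < 1 + x by linarith)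
    have h2 := Real.log_two_gt_d9
    nlinarith
  have hlogP : Real.logb 2 ((P n).ncard : ℝ) ≤
      n * M + (K * K + K * K) + (a + Real.logb 2 S) := by
    have h1 : ((P n).ncard : ℝ) ≤ ((K:ℝ) + 1) ^ n * ((2:ℝ) ^ (K * K) * 2 ^ (K * K)) *
      ((2:ℝ) ^ a * S) := by exact_mod_cast hcb
    have h2 := Real.logb_le_logb_of_le (b := 2) (by norm_num)
      (by exact_mod_cast hne n) h1
    have hK1 : ((K:ℝ) + 1) ≠ 0 := by positivity
    rw [Real.logb_mul (by positivity) (by positivity),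
      Real.logb_mul (by positivity) (by positivity),
      Real.logb_mul (by positivity) (by positivity),
      Real.logb_mul (by positivity) (by positivity),
      Real.logb_pow, Real.logb_pow, Real.logb_pow, Real.logb_self_eq_one (by norm_num)] at h2
    push_cast at h2
    linarith
  have t1 : n * M + (K * K + K * K) ≤ η * (n:ℝ) ^ 2 / 2 := by
    rw [div_lt_iff₀ hη] at hn₂
    have e1 : 2 * (M + 2 * (K * K)) ≤ n * η := by nlinarith
    have e2 : n * M + (K * K + K * K) ≤ n * (M + 2 * (K * K)) := by
      have : (0:ℝ) ≤ K * K := by positivity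
      nlinarith
    nlinarith
  have t2 : b * L ≤ η * (n:ℝ) ^ 2 / 2 := by
    calc b * L ≤ (η / (2 * L) * (n:ℝ) ^ 2) * L := by gcongr
      _ = _ := by field_simp
  have t3 : #(abtE n) * Real.logb 2 (1 + x) ≤ η * (n:ℝ) ^ 2 / 2 := by
    have h0 : 0 ≤ Real.logb 2 (1 + x) := Real.logb_nonneg (by norm_num) (by linarith)
    calc #(abtE n) * Real.logb 2 (1 + x) ≤ ((n:ℝ) ^ 2 / 2) * η := by
          apply mul_le_mul (abt_cardE n) (by linarith) h0 (by positivity)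
      _ = _ := by ring
  have : (c + 4 * η) * (n:ℝ) ^ 2 / 2 = (c + η) * (n:ℝ) ^ 2 / 2 + η * (n:ℝ) ^ 2 / 2
    + η * (n:ℝ) ^ 2 / 2 + η * (n:ℝ) ^ 2 / 2 := by ring
  rw [this]
  linarith

theorem abt_lower_card (P : ∀ n, Set (SimpleGraph (Fin n))) (r : ℕ) (hr : 1 ≤ r)
    (hlow : ∃ v : Fin r → Bool, ∀ (m : ℕ) (G : SimpleGraph (Fin m)), InH v G → G ∈ P m)
    (n : ℕ) : 2 ^ (SimpleGraph.turanGraph n r).edgeFinset.card ≤ (P n).ncard := by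
  classical
  obtain ⟨v, hv⟩ := hlow
  let f : Fin n → Fin r := fun x => ⟨x % r, Nat.mod_lt _ hr⟩
  let g : Finset (Sym2 (Fin n)) → SimpleGraph (Fin n) := fun s =>
    { Adj := fun x y => x ≠ y ∧ ((f x = f y ∧ v (f x) = true) ∨ (f x ≠ f y ∧ s(x, y) ∈ s))
      symm := ⟨fun x y h => by
        refine ⟨h.1.symm, ?_⟩
        rcases h.2 with h | h
        · exact Or.inl ⟨h.1.symm, h.1 ▸ h.2⟩
        · exact Or.inr ⟨h.1.symm, Sym2.eq_swap ▸ h.2⟩⟩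
      loopless := ⟨fun x h => h.1 rfl⟩ }
  have hgP : ∀ s, g s ∈ P n := by
    intro s
    refine hv n _ ⟨f, fun x y hxy hf => ?_⟩
    simp only [g, hf, ne_eq, not_true_eq_false, false_and, or_false, true_and]
    tauto
  rw [← Finset.card_powerset, Set.ncard_eq_toFinset_card']
  apply Finset.card_le_card_of_injOn g
  · intro s _
    simpa using hgP s
  · intro s hs t ht hst
    have hs' := Finset.mem_powerset.1 (Finset.mem_coe.1 hs)
    have ht' := Finset.mem_powerset.1 (Finset.mem_coe.1 ht)
    have key : ∀ e ∈ (SimpleGraph.turanGraph n r).edgeFinset, (e ∈ s ↔ e ∈ t) := by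
      intro e he
      induction e with | _ x y =>
      rw [SimpleGraph.mem_edgeFinset, SimpleGraph.mem_edgeSet] at he
      have hne : f x ≠ f y := fun h => he (Fin.mk.inj_iff.1 h)
      have hxy : x ≠ y := fun h => hne (h ▸ rfl)
      have h1 : (g s).Adj x y ↔ (g t).Adj x y := by rw [hst]
      simpa [g, hne, hxy] using h1
    ext e
    exact ⟨fun h => (key e (hs' h)).1 h, fun h => (key e (ht' h)).2 h⟩

theorem abt_turan_lower (n r : ℕ) (hr : 1 ≤ r) :
    (1 - 1 / (r:ℝ)) * (n:ℝ) ^ 2 / 2 - ((r:ℝ) ^ 2 + 1) ≤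
      ((SimpleGraph.turanGraph n r).edgeFinset.card : ℝ) := by
  have h := SimpleGraph.card_edgeFinset_turanGraph (n := n) (r := r)
  set e := (SimpleGraph.turanGraph n r).edgeFinset.card with he
  have hr1 : (1:ℝ) ≤ r := by exact_mod_cast hr
  have hm : n % r < r := Nat.mod_lt _ hr
  have hmn : n % r ≤ n := Nat.mod_le _ _
  have hm2 : (n % r) ^ 2 ≤ n ^ 2 := Nat.pow_le_pow_left hmn 2
  have h1 : (n ^ 2 - (n % r) ^ 2) * (r - 1) < (e + 1) * (2 * r) := by
    have := Nat.lt_div_mul_add (a := (n ^ 2 - (n % r) ^ 2) * (r - 1)) (b := 2 * r) (by omega)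
    have h2 : (n ^ 2 - (n % r) ^ 2) * (r - 1) / (2 * r) ≤ e := by omega
    nlinarith
  have h2 : ((n:ℝ) ^ 2 - ((n % r : ℕ) : ℝ) ^ 2) * (r - 1) < (e + 1) * (2 * r) := by
    have h3 : (((n ^ 2 - (n % r) ^ 2) * (r - 1) : ℕ) : ℝ) < (((e + 1) * (2 * r) : ℕ) : ℝ) := by
      exact_mod_cast h1
    rw [Nat.cast_mul, Nat.cast_sub hm2, Nat.cast_sub hr] at h3
    push_cast at h3
    exact_mod_cast h3
  have hm' : ((n % r : ℕ) : ℝ) ≤ r := by exact_mod_cast hm.le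
  have hm0 : (0:ℝ) ≤ ((n % r : ℕ) : ℝ) := by positivity
  have h3 : (1 - 1 / (r:ℝ)) * (n:ℝ) ^ 2 / 2 - ((r:ℝ) ^ 2 + 1) =
      ((n:ℝ) ^ 2 * (r - 1) - ((r:ℝ) ^ 2 + 1) * (2 * r)) / (2 * r) := by
    field_simp
  rw [h3, div_le_iff₀ (by positivity)]
  have h4 : ((n % r : ℕ) : ℝ) ^ 2 * (r - 1) ≤ (r:ℝ) ^ 2 * (2 * r) := by
    apply mul_le_mul (by gcongr) (by linarith) (by linarith) (by positivity)
  nlinarith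

theorem alekseev_bollobas_thomason (P : ∀ n, Set (SimpleGraph (Fin n)))
    (hP : GraphHereditary P) (r : ℕ) (hr : 1 ≤ r)
    (hlow : ∃ v : Fin r → Bool, ∀ (m : ℕ) (G : SimpleGraph (Fin m)), InH v G → G ∈ P m)
    (hupp : ∀ v : Fin (r + 1) → Bool, ∃ (m : ℕ) (G : SimpleGraph (Fin m)), InH v G ∧ G ∉ P m) :
    Tendsto (fun n => Real.logb 2 ((P n).ncard : ℝ) / (n.choose 2 : ℝ)) atTop (nhds (1 - 1 / (r : ℝ))) := by
  have hlc := abt_lower_card P r hr hlow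
  have hne : ∀ n, 0 < (P n).ncard := fun n => lt_of_lt_of_le (by positivity) (hlc n)
  have hr1 : 0 ≤ 1 - 1 / (r:ℝ) ∧ 1 - 1 / (r:ℝ) ≤ 1 := by
    have : (1:ℝ) ≤ r := by exact_mod_cast hr
    have h : 1 / (r:ℝ) ≤ 1 := by rw [div_le_one (by linarith)]; exact this
    have h' : 0 ≤ 1 / (r:ℝ) := by positivity
    constructor <;> linarith
  have hlow' : ∀ n : ℕ, (1 - 1 / (r:ℝ)) * (n:ℝ) ^ 2 / 2 - ((r:ℝ) ^ 2 + 1) ≤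
      Real.logb 2 ((P n).ncard : ℝ) := by
    intro n
    refine (abt_turan_lower n r hr).trans ?_
    rw [Real.le_logb_iff_rpow_le (by norm_num) (by exact_mod_cast hne n), Real.rpow_natCast]
    exact_mod_cast hlc n
  set c : ℝ := 1 - 1 / (r:ℝ) with hc
  rw [Metric.tendsto_atTop]
  intro θ hθ
  obtain ⟨n₀, hn₀⟩ := abt_upper P hP r hr hupp hne (θ / 16) (by positivity)
  obtain ⟨n₁, hn₁⟩ := exists_nat_gt ((4 * (r:ℝ) ^ 2 + 8) * (1 + θ) / θ)
  refine ⟨n₀ + n₁ + 2, fun n hn => ?_⟩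
  have hup := hn₀ n (by omega)
  have hlo := hlow' n
  set ℓ := Real.logb 2 ((P n).ncard : ℝ)
  have hn2 : (2:ℝ) ≤ n := by exact_mod_cast (by omega : 2 ≤ n)
  have hnn : (n₁:ℝ) ≤ n := by exact_mod_cast (by omega : n₁ ≤ n)
  have hch : (n.choose 2 : ℝ) = n * (n - 1) / 2 := Nat.cast_choose_two ℝ n
  have hpos : (0:ℝ) < n * (n - 1) / 2 := by
    apply div_pos (mul_pos (by linarith) (by linarith)) (by norm_num)
  have hbig : (4 * (r:ℝ) ^ 2 + 8) * (1 + θ) ≤ n * θ := by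
    rw [div_lt_iff₀ hθ] at hn₁
    nlinarith
  have hr2 : 0 ≤ (r:ℝ) ^ 2 := by positivity
  rw [← hc] at hup
  rw [hch, Real.dist_eq, abs_lt]
  constructor
  · rw [lt_sub_iff_add_lt, lt_div_iff₀ hpos]
    have : (r:ℝ) ^ 2 + 1 < θ * (n * (n - 1) / 2) := by
      have : 4 * (r:ℝ) ^ 2 + 8 ≤ n * θ := by nlinarith
      nlinarith
    nlinarith
  · rw [sub_lt_iff_lt_add, div_lt_iff₀ hpos]
    have h8 : 8 * (1 + θ) ≤ n * θ := by nlinarith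
    have h9 : (c + 4 * (θ / 16)) * (n:ℝ) < (θ + c) * (n - 1) := by nlinarith
    nlinarith
end
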